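/- Every Artin-Tits group of large type satisfies Property H#, with respect to the S-sequence of transversals (T(S₀))_{S₀⊆S} in which T(S₀) is the set of elements of A_S of minimal length in their left A_{S₀}-coset: for all S', S₀ ⊆ S and every word w over S ∪ S⁻¹ with w̄ ∈ A_{S'}, setting S₀' = S' ∩ S₀, there exist a word v over S' ∪ S'⁻¹ and a word u over S₀' ∪ S₀'⁻¹ such that w →_{0,1,2} vu and v̄ ∈ T(S₀). -/

import Mathlib

namespace ArtinTits

open Classical List

variable {S : Type*}

/-- A word over `S ∪ S⁻¹`: a list of letters, each a generator together with a sign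
(`true` = the generator itself, `false` = its formal inverse). -/
abbrev Word (S : Type*) := List (S × Bool)

/-- The formal inverse of a word. -/
def wordInv (w : Word S) : Word S := w.reverse.map fun l => (l.1, !l.2)

/-- `[x,y,j⟩`: the alternating positive word `xyxy⋯` with `j` letters, beginning with `x`. -/
def altWord (x y : S) : ℕ → Word S
  | 0 => []
  | j + 1 => (x, true) :: altWord y x j

/-- `⟨x,y,j]`: the alternating positive word `⋯xy` with `j` letters, ending with `y`. -/
def altWordR (x y : S) (j : ℕ) : Word S := (altWord y x j).reverse

/-- The data of a labelled finite complete simplicial graph `Γ₀`: a symmetric label map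
with values in `{2,3,…} ∪ {∞}` on pairs of distinct vertices. -/
structure ArtinData (S : Type*) where
  m : S → S → ℕ∞
  symm : ∀ s t, m s t = m t s
  two_le : ∀ s t : S, s ≠ t → 2 ≤ m s t

/-- `u = v` is a defining (braid) relation of the Artin–Tits presentation. -/
def IsRel (A : ArtinData S) (u v : Word S) : Prop :=
  ∃ (s t : S) (k : ℕ), s ≠ t ∧ A.m s t = (k : ℕ∞) ∧
    u = altWord s t k ∧ v = altWord t s k

/-- The relator set of the Artin–Tits presentation, inside the free group. -/
def rels (A : ArtinData S) : Set (FreeGroup S) :=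
  {x | ∃ u v : Word S, IsRel A u v ∧ x = FreeGroup.mk u * (FreeGroup.mk v)⁻¹}

/-- The Artin–Tits group `A(Γ₀)` of the presentation. -/
abbrev ArtinGroup (A : ArtinData S) := PresentedGroup (rels A)

/-- `w̄`: the element of the Artin–Tits group represented by the word `w`. -/
def wbar (A : ArtinData S) (w : Word S) : ArtinGroup A :=
  PresentedGroup.mk (rels A) (FreeGroup.mk w)

/-! ### Special transformations -/

/-- Type 0: delete a factor `s s⁻¹` or `s⁻¹ s`. -/
def Step0 (w w' : Word S) : Prop :=
  ∃ (w₁ w₂ : Word S) (s : S) (b : Bool),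
    w = w₁ ++ [(s, b), (s, !b)] ++ w₂ ∧ w' = w₁ ++ w₂

/-- Type ∞: insert a factor `s s⁻¹` or `s⁻¹ s` (the inverse of type 0). -/
def StepInfty (w w' : Word S) : Prop := Step0 w' w

/-- Type 1: replace a factor `v` by `u`, or `v⁻¹` by `u⁻¹`, where `u = v` is a defining
relation. -/
def Step1 (A : ArtinData S) (w w' : Word S) : Prop :=
  ∃ (w₁ w₂ u v : Word S), IsRel A u v ∧
    ((w = w₁ ++ v ++ w₂ ∧ w' = w₁ ++ u ++ w₂) ∨
     (w = w₁ ++ wordInv v ++ w₂ ∧ w' = w₁ ++ wordInv u ++ w₂))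

/-- Type 2r: for a defining relation `u₁u₂ = v₁v₂` with `u₁, v₁` non-empty, replace a factor
`v₁⁻¹ u₁` by `v₂ u₂⁻¹`. -/
def Step2r (A : ArtinData S) (w w' : Word S) : Prop :=
  ∃ (w₁ w₂ u₁ u₂ v₁ v₂ : Word S), IsRel A (u₁ ++ u₂) (v₁ ++ v₂) ∧
    u₁ ≠ [] ∧ v₁ ≠ [] ∧
    w = w₁ ++ wordInv v₁ ++ u₁ ++ w₂ ∧ w' = w₁ ++ v₂ ++ wordInv u₂ ++ w₂

/-- Type 2l: for a defining relation `u₁u₂ = v₁v₂` with `u₂, v₂` non-empty, replace a factor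
`v₂ u₂⁻¹` by `v₁⁻¹ u₁`. -/
def Step2l (A : ArtinData S) (w w' : Word S) : Prop :=
  ∃ (w₁ w₂ u₁ u₂ v₁ v₂ : Word S), IsRel A (u₁ ++ u₂) (v₁ ++ v₂) ∧
    u₂ ≠ [] ∧ v₂ ≠ [] ∧
    w = w₁ ++ v₂ ++ wordInv u₂ ++ w₂ ∧ w' = w₁ ++ wordInv v₁ ++ u₁ ++ w₂

/-- Type 2: a type 2r or type 2l transformation. -/
def Step2 (A : ArtinData S) (w w' : Word S) : Prop := Step2r A w w' ∨ Step2l A w w'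

/-- `p` is the greatest (longest) common left factor of `x` and `y`. -/
def IsLCPrefix (p x y : Word S) : Prop :=
  p <+: x ∧ p <+: y ∧ ∀ q : Word S, q <+: x → q <+: y → q.length ≤ p.length

/-- `p` is the greatest (longest) common right factor of `x` and `y`. -/
def IsLCSuffix (p x y : Word S) : Prop :=
  p <:+ x ∧ p <:+ y ∧ ∀ q : Word S, q <:+ x → q <:+ y → q.length ≤ p.length

/-- Type 2r⋆ : a type 2r transformation `w₁ v⁻¹ v' w₂ → w₁ u (u')⁻¹ w₂` (with `vu = v'u'` a
defining relation) such that `v` is the greatest common left factor of `vu` and `v w₁⁻¹`, and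
`v'` is the greatest common left factor of `v'u'` and `v' w₂`. -/
def Step2rStar (A : ArtinData S) (w w' : Word S) : Prop :=
  ∃ (w₁ w₂ v u v' u' : Word S), IsRel A (v ++ u) (v' ++ u') ∧
    v ≠ [] ∧ v' ≠ [] ∧
    w = w₁ ++ wordInv v ++ v' ++ w₂ ∧
    w' = w₁ ++ u ++ wordInv u' ++ w₂ ∧
    IsLCPrefix v (v ++ u) (v ++ wordInv w₁) ∧
    IsLCPrefix v' (v' ++ u') (v' ++ w₂)

/-- Type 2l⋆ : a type 2l transformation `w₁ v (v')⁻¹ w₂ → w₁ u⁻¹ u' w₂` (with `uv = u'v'` a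
defining relation) such that `v` is the greatest common right factor of `uv` and `w₁ v`, and
`v'` is the greatest common right factor of `u'v'` and `w₂⁻¹ v'`. -/
def Step2lStar (A : ArtinData S) (w w' : Word S) : Prop :=
  ∃ (w₁ w₂ v u v' u' : Word S), IsRel A (u ++ v) (u' ++ v') ∧
    v ≠ [] ∧ v' ≠ [] ∧
    w = w₁ ++ v ++ wordInv v' ++ w₂ ∧
    w' = w₁ ++ wordInv u ++ u' ++ w₂ ∧
    IsLCSuffix v (u ++ v) (w₁ ++ v) ∧
    IsLCSuffix v' (u' ++ v') (wordInv w₂ ++ v')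

/-- Type 2⋆ : a type 2r⋆ or type 2l⋆ transformation. -/
def Step2Star (A : ArtinData S) (w w' : Word S) : Prop :=
  Step2rStar A w w' ∨ Step2lStar A w w'

/-- `w →_{0,1,2} w'`. -/
def Steps012 (A : ArtinData S) : Word S → Word S → Prop :=
  Relation.ReflTransGen fun x y => Step0 x y ∨ Step1 A x y ∨ Step2 A x y

/-- `w →_{0,1,2⋆} w'`. -/
def Steps012Star (A : ArtinData S) : Word S → Word S → Prop :=
  Relation.ReflTransGen fun x y => Step0 x y ∨ Step1 A x y ∨ Step2Star A x y

/-- `w →_{2⋆} w'`. -/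
def Steps2Star (A : ArtinData S) : Word S → Word S → Prop :=
  Relation.ReflTransGen (Step2Star A)

/-- `w →_{1,2⋆} w'`. -/
def Steps12Star (A : ArtinData S) : Word S → Word S → Prop :=
  Relation.ReflTransGen fun x y => Step1 A x y ∨ Step2Star A x y

/-- `w →_{1,2} w'`. -/
def Steps12 (A : ArtinData S) : Word S → Word S → Prop :=
  Relation.ReflTransGen fun x y => Step1 A x y ∨ Step2 A x y

/-! ### Classes of words -/

/-- A positive word: written over `S`. -/
def Positive (w : Word S) : Prop := ∀ l ∈ w, l.2 = true

/-- A negative word: written over `S⁻¹`. -/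
def Negative (w : Word S) : Prop := ∀ l ∈ w, l.2 = false

/-- A signed word: positive or negative. -/
def Signed (w : Word S) : Prop := Positive w ∨ Negative w

/-- An unsigned word: neither positive nor negative. -/
def Unsigned (w : Word S) : Prop := ¬ Positive w ∧ ¬ Negative w

/-- A freely reduced word: no factor `s s⁻¹` or `s⁻¹ s`. -/
def FreelyReduced (w : Word S) : Prop :=
  ∀ (w₁ w₂ : Word S) (s : S) (b : Bool), w ≠ w₁ ++ [(s, b), (s, !b)] ++ w₂

/-- A square-free word: no factor `aa`. -/
def SquareFree (w : Word S) : Prop := ∀ a : S × Bool, ¬ [a, a] <:+: w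

/-- `p̃(w)`: the length of the longest square-free positive factor of `w`. -/
noncomputable def ptilde (w : Word S) : ℕ :=
  sSup {n | ∃ v : Word S, v <:+: w ∧ Positive v ∧ SquareFree v ∧ v.length = n}

/-- `ñ(w)`: the length of the longest negative factor of `w` whose formal inverse is
square-free. -/
noncomputable def ntilde (w : Word S) : ℕ :=
  sSup {n | ∃ v : Word S, v <:+: w ∧ Negative v ∧ SquareFree (wordInv v) ∧ v.length = n}

/-- `p(w) = min(p̃(w), m)`. -/
noncomputable def pfun (M : ℕ) (w : Word S) : ℕ := min (ptilde w) M

/-- `n(w) = min(ñ(w), m)`. -/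
noncomputable def nfun (M : ℕ) (w : Word S) : ℕ := min (ntilde w) M

/-- `Ω(Γ₀)` (for a dihedral presentation with label `M`): the freely reduced words with
`max(p(w), n(w)) < M`. -/
def Omega (M : ℕ) (w : Word S) : Prop :=
  FreelyReduced w ∧ max (pfun M w) (nfun M w) < M

/-- A signed square-free word (square-free positive, or negative with square-free inverse). -/
def SignedSF (w : Word S) : Prop :=
  (Positive w ∧ SquareFree w) ∨ (Negative w ∧ SquareFree (wordInv w))

/-- `v` is the maximal square-free signed left factor of `w`. -/
def MaxSignedSFPrefix (v w : Word S) : Prop :=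
  v <+: w ∧ SignedSF v ∧ ∀ v' : Word S, v' <+: w → SignedSF v' → v'.length ≤ v.length

/-- `(v₁, …, v_k)` is the `⋆`-decomposition of `w`: the `v_i` are non-empty, `w = v₁⋯v_k`,
and each `v_i` is the maximal square-free signed left factor of `v_i⋯v_k`. -/
def StarDecomp (w : Word S) (L : List (Word S)) : Prop :=
  w = L.flatten ∧ (∀ v ∈ L, v ≠ ([] : Word S)) ∧
    ∀ i (h : i < L.length), MaxSignedSFPrefix (L.get ⟨i, h⟩) ((L.drop i).flatten)

/-! ### Groups, parabolic subgroups, geodesics -/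

/-- A word written over `T ∪ T⁻¹` for a subset `T` of the generators. -/
def WordOver (T : Set S) (w : Word S) : Prop := ∀ l ∈ w, l.1 ∈ T

/-- The standard parabolic subgroup `A_T` generated by the image of `T ⊆ S`. -/
def parab (A : ArtinData S) (T : Set S) : Subgroup (ArtinGroup A) :=
  Subgroup.closure {x | ∃ s ∈ T, x = wbar A [(s, true)]}

/-- A geodesic word: of minimal length among all words representing the same element. -/
def Geodesic (A : ArtinData S) (w : Word S) : Prop :=
  ∀ w' : Word S, wbar A w' = wbar A w → w.length ≤ w'.length

/-- A word over `T ∪ T⁻¹` that is geodesic among the words over `T ∪ T⁻¹` representing the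
same element. -/
def GeodesicOver (A : ArtinData S) (T : Set S) (w : Word S) : Prop :=
  WordOver T w ∧
    ∀ w' : Word S, WordOver T w' → wbar A w' = wbar A w → w.length ≤ w'.length

/-- The length of a group element: the length of any geodesic representative word. -/
noncomputable def elLength (A : ArtinData S) (g : ArtinGroup A) : ℕ :=
  sInf {n | ∃ w : Word S, wbar A w = g ∧ w.length = n}

/-- A positive element: one represented by a positive word. -/
def IsPosElt (A : ArtinData S) (g : ArtinGroup A) : Prop :=
  ∃ w : Word S, Positive w ∧ wbar A w = g

/-- An `H`-transversal: a subset containing `1` and exactly one element of each left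
`H`-coset. -/
def IsLeftTransversal {G : Type*} [Group G] (H : Subgroup G) (T : Set G) : Prop :=
  (1 : G) ∈ T ∧ ∀ g : G, ∃! x, x ∈ T ∧ g⁻¹ * x ∈ H

/-! ### Properties H, H⁺, H# -/

/-- Property `H`: `w →_{0,1,2} ε ↔ w̄ = 1`. -/
def PropertyH (A : ArtinData S) : Prop :=
  ∀ w : Word S, Steps012 A w [] ↔ wbar A w = 1

/-- Property `H⁺`: every word representing an element of a standard parabolic subgroup
`A_{S₀}` can be transformed by `→_{0,1,2⋆}` into a word over `S₀ ∪ S₀⁻¹`. -/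
def PropertyHPlus (A : ArtinData S) : Prop :=
  ∀ (S₀ : Set S) (w : Word S), wbar A w ∈ parab A S₀ →
    ∃ w₀ : Word S, WordOver S₀ w₀ ∧ Steps012Star A w w₀

/-- Property `H#` with respect to an `S`-sequence of transversals `T`. -/
def PropertyHSharpWrt (A : ArtinData S) (T : Set S → Set (ArtinGroup A)) : Prop :=
  (∀ S₀ : Set S, IsLeftTransversal (parab A S₀) (T S₀)) ∧
    ∀ (S' S₀ : Set S) (w : Word S), wbar A w ∈ parab A S' →
      ∃ v u : Word S, WordOver S' v ∧ WordOver (S' ∩ S₀) u ∧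
        Steps012 A w (v ++ u) ∧ wbar A v ∈ T S₀

/-- Property `H#`: property `H#` with respect to some `S`-sequence of transversals. -/
def PropertyHSharp (A : ArtinData S) : Prop :=
  ∃ T : Set S → Set (ArtinGroup A), PropertyHSharpWrt A T

/-! ### Critical words and the involution τ (relative to a dihedral pair) -/

/-- The permutation `δ` induced by conjugation by `Δ`, extended letterwise to words:
the identity if `M` is even, and the swap of `s` and `t` if `M` is odd. -/
noncomputable def deltaMap (s t : S) (M : ℕ) (w : Word S) : Word S :=
  if Even M then w
  else w.map fun l => (if l.1 = s then t else if l.1 = t then s else l.1, l.2)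

/-- `w` is an unsigned critical word (of the dihedral pair `{s,t}` with label `M`) and
`w' = τ(w)`. -/
def UCritTauPair (A : ArtinData S) (s t : S) (M : ℕ) (w w' : Word S) : Prop :=
  WordOver {s, t} w ∧ FreelyReduced w ∧ Unsigned w ∧ GeodesicOver A {s, t} w ∧
  pfun M w + nfun M w = M ∧
  ∃ (x y z z' : S) (wm : Word S),
    ({x, y} : Set S) = {s, t} ∧ ({z, z'} : Set S) = {s, t} ∧
    ((w = altWord x y (pfun M w) ++ wm ++ wordInv (altWord z z' (nfun M w)) ∧
      w' = wordInv (altWordR x y (nfun M w)) ++ deltaMap s t M wm ++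
        altWordR z z' (pfun M w)) ∨
     (w = wordInv (altWordR x y (nfun M w)) ++ wm ++ altWordR z z' (pfun M w) ∧
      w' = altWord x y (pfun M w) ++ deltaMap s t M wm ++
        wordInv (altWord z z' (nfun M w))))

/-- `w` is a positive critical word (of the dihedral pair `{s,t}` with label `M`) and
`w' = τ(w)`. -/
def PosCritTauPair (A : ArtinData S) (s t : S) (M : ℕ) (w w' : Word S) : Prop :=
  WordOver {s, t} w ∧ Positive w ∧ pfun M w = M ∧
  ∃ (x y : S) (wm : Word S), ({x, y} : Set S) = {s, t} ∧ pfun M wm < M ∧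
    ((w = altWord x y M ++ wm ∧
      (w' = deltaMap s t M wm ++ altWordR x y M ∨
       w' = deltaMap s t M wm ++ altWordR y x M) ∧
      w'.getLast? ≠ w.getLast?) ∨
     (w = wm ++ altWordR x y M ∧
      (w' = altWord x y M ++ deltaMap s t M wm ∨
       w' = altWord y x M ++ deltaMap s t M wm) ∧
      w'.head? ≠ w.head?))

/-- `w` is a negative critical word and `w' = τ(w)` (defined via formal inverses). -/
def NegCritTauPair (A : ArtinData S) (s t : S) (M : ℕ) (w w' : Word S) : Prop :=
  PosCritTauPair A s t M (wordInv w) (wordInv w')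

/-- `w` is a critical word (unsigned, positive or negative) and `w' = τ(w)`. -/
def CritTauPair (A : ArtinData S) (s t : S) (M : ℕ) (w w' : Word S) : Prop :=
  UCritTauPair A s t M w w' ∨ PosCritTauPair A s t M w w' ∨ NegCritTauPair A s t M w w'

/-- A type β transformation relative to the dihedral pair `{s,t}` with label `M`:
replace a critical factor `v` by `τ(v)`. -/
def StepBetaPair (A : ArtinData S) (s t : S) (M : ℕ) (w w' : Word S) : Prop :=
  ∃ (w₁ w₂ v v' : Word S), w = w₁ ++ v ++ w₂ ∧ w' = w₁ ++ v' ++ w₂ ∧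
    CritTauPair A s t M v v'

/-- A type β transformation (in an Artin–Tits group): a type β transformation relative to some
dihedral standard parabolic subgroup (a pair of generators with finite label). -/
def StepBeta (A : ArtinData S) (w w' : Word S) : Prop :=
  ∃ (s t : S) (M : ℕ), s ≠ t ∧ A.m s t = (M : ℕ∞) ∧ StepBetaPair A s t M w w'

/-! ### Restriction, direct products, Coxeter graph notions -/

/-- The Artin–Tits presentation induced on a subset `T` of the generators (the presentation of
the standard parabolic subgroup `A_T`). -/
def ArtinData.restrict (A : ArtinData S) (T : Set S) : ArtinData T where
  m a b := A.m a b
  symm a b := A.symm a b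
  two_le a b h := A.two_le a b fun h' => h (Subtype.ext h')

/-- The Artin–Tits presentation on the disjoint union `S₁ ⊕ S₂` obtained from presentations on
`S₁` and `S₂` by adding the commuting relations `s₁s₂ = s₂s₁` (label `2`) for `s₁ ∈ S₁`,
`s₂ ∈ S₂`. -/
def prodData {S₁ S₂ : Type*} (A₁ : ArtinData S₁) (A₂ : ArtinData S₂) :
    ArtinData (S₁ ⊕ S₂) where
  m x y :=
    match x, y with
    | Sum.inl a, Sum.inl b => A₁.m a b
    | Sum.inr a, Sum.inr b => A₂.m a b
    | _, _ => 2
  symm x y := by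
    cases x <;> cases y
    · exact A₁.symm _ _
    · rfl
    · rfl
    · exact A₂.symm _ _
  two_le x y h := by
    cases x <;> cases y
    · exact A₁.two_le _ _ fun h' => h (congrArg Sum.inl h')
    · exact le_rfl
    · exact le_rfl
    · exact A₂.two_le _ _ fun h' => h (congrArg Sum.inr h')

/-- Adjacency in the Coxeter graph `Γ` restricted to `T`: distinct vertices of `T` joined by an
edge (i.e. with label `≠ 2`, edges labelled `2` being removed in `Γ`). -/
def coxAdj (A : ArtinData S) (T : Set S) (x y : S) : Prop :=
  x ∈ T ∧ y ∈ T ∧ x ≠ y ∧ A.m x y ≠ 2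

/-- The full subgraph of the Coxeter graph on the vertex subset `T` is connected. -/
def CoxConnected (A : ArtinData S) (T : Set S) : Prop :=
  ∀ x ∈ T, ∀ y ∈ T, Relation.ReflTransGen (coxAdj A T) x y

/-- The relator set of the Coxeter presentation on `T`: the Artin relations together with the
squares of the generators. -/
def coxRels (A : ArtinData S) (T : Set S) : Set (FreeGroup T) :=
  rels (A.restrict T) ∪ {g | ∃ x : T, g = FreeGroup.of x * FreeGroup.of x}

/-- The induced presentation on `T` is of spherical type: its Coxeter group is finite. -/
def SphericalType (A : ArtinData S) (T : Set S) : Prop :=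
  Finite (PresentedGroup (coxRels A T))

/-- The induced presentation on `T` is of large type: all labels are `≥ 3` (possibly `∞`). -/
def LargeTypeOn (A : ArtinData S) (T : Set S) : Prop :=
  ∀ x ∈ T, ∀ y ∈ T, x ≠ y → 3 ≤ A.m x y

/-! ### Dihedral Artin–Tits groups -/

/-- The formal inverse of a letter. -/
def bar {S : Type*} (a : S × Bool) : S × Bool := (a.1, !a.2)

/-- Garside normal forms `Δ^k x₁ ⋯ x_r` of a dihedral Artin–Tits group with label `M`, acted on
by right multiplication. A non-trivial positive part is recorded by its last letter `e`, the
length `l` of its last maximal alternating factor, and the list `r` of lengths of the previous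
ones (the most recent first). -/
inductive DState
  | base (k : ℤ)
  | node (k : ℤ) (e : Bool) (l : ℕ) (r : List ℕ)

namespace DState

/-- The state with given stack of alternating factors. -/
def ofStack (k : ℤ) (e : Bool) : List ℕ → DState
  | [] => base k
  | l :: r => node k e l r

/-- Right multiplication by a letter. -/
def act (M : ℕ) : DState → Bool × Bool → DState
  | base k, (b, true) => node k b 1 []
  | base k, (b, false) => node (k - 1) (!b) (M - 1) []
  | node k e l r, (b, true) =>
    if b = e then node k e 1 (l :: r)
    else if l + 1 < M then node k b (l + 1) r else ofStack (k + 1) e r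
  | node k e l r, (b, false) =>
    if b = e then (if 1 < l then node k (!e) (l - 1) r else ofStack k e r)
    else node (k - 1) e (M - 1) (l :: r)

/-- Right multiplication by a word. -/
def run (M : ℕ) (q : DState) (w : Word Bool) : DState := w.foldl (act M) q

/-- The lengths of the alternating factors of a normal form lie between `1` and `M - 1`. -/
def Valid (M : ℕ) : DState → Prop
  | base _ => True
  | node _ _ l r => (1 ≤ l ∧ l < M) ∧ ∀ x ∈ r, 1 ≤ x ∧ x < M

/-- The weight of an alternating factor of length `l` with respect to the threshold `p`. -/
def wt (p l : ℕ) : ℤ := if l ≤ p then l else 2 * p - l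

/-- The height function with threshold `p`: it changes by `±1` along each edge of the Cayley
graph. -/
def height (M p : ℕ) : DState → ℤ
  | base k => (2 * p - M) * k
  | node k _ l r => (2 * p - M) * k + wt p l + (r.map (wt p)).sum

variable {M : ℕ}

theorem valid_ofStack {k : ℤ} {e : Bool} {r : List ℕ} (h : ∀ x ∈ r, 1 ≤ x ∧ x < M) :
    Valid M (ofStack k e r) := by
  cases r with
  | nil => trivial
  | cons l r => exact ⟨h l (by simp), fun x hx => h x (by simp [hx])⟩

theorem height_ofStack (p : ℕ) (k : ℤ) (e : Bool) (r : List ℕ) :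
    height M p (ofStack k e r) = (2 * p - M) * k + (r.map (wt p)).sum := by
  cases r <;> simp [ofStack, height, add_assoc]

theorem valid_act (hM : 2 ≤ M) {q : DState} (hq : Valid M q) (a : Bool × Bool) :
    Valid M (act M q a) := by
  obtain ⟨b, σ⟩ := a
  cases q with
  | base k => cases σ <;> simp [act, Valid] <;> omega
  | node k e l r =>
    obtain ⟨hl, hr⟩ := hq
    cases σ
    · simp only [act]
      split_ifs
      · exact ⟨by omega, hr⟩
      · exact valid_ofStack hr
      · refine ⟨by omega, ?_⟩
        simpa using ⟨hl, hr⟩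
    · simp only [act]
      split_ifs
      · refine ⟨by omega, ?_⟩
        simpa using ⟨hl, hr⟩
      · exact ⟨by omega, hr⟩
      · exact valid_ofStack hr

theorem valid_run (hM : 2 ≤ M) (w : Word Bool) {q : DState} (hq : Valid M q) :
    Valid M (run M q w) := by
  induction w generalizing q with
  | nil => exact hq
  | cons a w ih => exact ih (valid_act hM hq a)

@[simp] theorem run_nil (q : DState) : run M q [] = q := rfl

@[simp] theorem run_cons (q : DState) (a : Bool × Bool) (w : Word Bool) :
    run M q (a :: w) = run M (act M q a) w := rfl

@[simp] theorem run_append (q : DState) (u v : Word Bool) :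
    run M q (u ++ v) = run M (run M q u) v := by
  simp [run, List.foldl_append]

theorem act_bar (hM : 2 ≤ M) {q : DState} (hq : Valid M q) (a : Bool × Bool) :
    act M (act M q a) (bar a) = q := by
  obtain ⟨b, σ⟩ := a
  cases q with
  | base k =>
    cases σ
    · have : ¬ (M - 1 + 1 < M) := by omega
      simp [act, bar, this, ofStack]
    · simp [act, bar, ofStack]
  | node k e l r =>
    obtain ⟨hl, hr⟩ := hq
    cases σ
    · by_cases hb : b = e
      · subst hb
        by_cases h1 : 1 < l
        · have : l - 1 + 1 < M := by omega
          have h2 : l - 1 + 1 = l := by omega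
          simp [act, bar, h1, h2]
          intro h
          omega
        · have h2 : l = 1 := by omega
          subst h2
          cases r with
          | nil => simp [act, bar, ofStack]
          | cons l' r => simp [act, bar, ofStack]
      · have : ¬ (M - 1 + 1 < M) := by omega
        simp [act, bar, hb, this, ofStack]
    · by_cases hb : b = e
      · subst hb
        simp [act, bar, ofStack]
      · by_cases h1 : l + 1 < M
        · have h2 : 1 < l + 1 := by omega
          have h3 : (!b) = e := by cases b <;> cases e <;> simp_all
          simp [act, bar, hb, h1, h3]
          intro h
          omega
        · have h2 : M - 1 = l := by omega
          have h3 : (!b) = e := by cases b <;> cases e <;> simp_all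
          cases r with
          | nil => simp [act, bar, ofStack, hb, h1, h2, h3]
          | cons l' r => simp [act, bar, ofStack, hb, h1, h2]

@[simp] theorem bar_bar {S : Type*} (a : S × Bool) : bar (bar a) = a := by simp [bar]

/-! Variation of the height functions along edges. -/

theorem wt_succ (p l : ℕ) : wt p (l + 1) = wt p l + if l + 1 ≤ p then 1 else -1 := by
  unfold wt; push_cast; split_ifs <;> omega

theorem wt_zero (p : ℕ) : wt p 0 = 0 := by simp [wt]

theorem wt_top {p : ℕ} (hp : p ≤ M) : wt p M = 2 * p - M := by
  unfold wt; split_ifs <;> omega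

theorem height_base_pos (p : ℕ) (k : ℤ) (b : Bool) :
    height M p (act M (base k) (b, true)) = height M p (base k) + if 1 ≤ p then 1 else -1 := by
  have := wt_succ p 0
  simp only [wt_zero, zero_add] at this
  simp [act, height, this]

theorem height_base_neg (hM : 2 ≤ M) {p : ℕ} (hp : p ≤ M) (k : ℤ) (b : Bool) :
    height M p (act M (base k) (b, false)) =
      height M p (base k) + if p < M then 1 else -1 := by
  have h := wt_succ p (M - 1)
  have h2 : M - 1 + 1 = M := by omega
  rw [h2, wt_top hp] at h
  simp only [act, height, List.map_nil, List.sum_nil]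
  have : wt p (M - 1) = 2 * p - M - if M ≤ p then 1 else -1 := by rw [h]; ring
  rw [this]
  split_ifs <;> first | omega | ring

theorem height_node_pos_same (p : ℕ) (k : ℤ) (e : Bool) (l : ℕ) (r : List ℕ) :
    height M p (act M (node k e l r) (e, true)) =
      height M p (node k e l r) + if 1 ≤ p then 1 else -1 := by
  have := wt_succ p 0
  simp only [wt_zero, zero_add] at this
  simp [act, height, this]
  ring

theorem height_node_pos_ne {p : ℕ} (hp : p ≤ M) (k : ℤ) (e : Bool) {l : ℕ} (hl : l < M)
    (r : List ℕ) :
    height M p (act M (node k e l r) (!e, true)) =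
      height M p (node k e l r) + if l < p then 1 else -1 := by
  have h := wt_succ p l
  by_cases h1 : l + 1 < M
  · simp only [act, height, h1]
    simp [h]
    ring
  · have h2 : l + 1 = M := by omega
    rw [h2, wt_top hp] at h
    have h3 : wt p l = 2 * p - M - if l < p then 1 else -1 := by
      rw [h]; simp [← h2]
    have h4 : act M (node k e l r) (!e, true) = ofStack (k + 1) e r := by simp [act, h1]
    rw [h4, height_ofStack]
    simp only [height, h3]
    ring

theorem height_node_neg_same {p : ℕ} (k : ℤ) (e : Bool) {l : ℕ} (hl : 1 ≤ l)
    (r : List ℕ) :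
    height M p (act M (node k e l r) (e, false)) =
      height M p (node k e l r) + if p < l then 1 else -1 := by
  have h := wt_succ p (l - 1)
  have h2 : l - 1 + 1 = l := by omega
  rw [h2] at h
  by_cases h1 : 1 < l
  · simp only [act, height, h1]
    simp [h]
    split_ifs <;> omega
  · have h2 : l = 1 := by omega
    subst h2
    simp [wt_zero] at h
    have h4 : act M (node k e 1 r) (e, false) = ofStack k e r := by simp [act]
    rw [h4, height_ofStack]
    simp only [height, h]
    split_ifs <;> omega

theorem height_node_neg_ne (hM : 2 ≤ M) {p : ℕ} (hp : p ≤ M) (k : ℤ) (e : Bool) (l : ℕ)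
    (r : List ℕ) :
    height M p (act M (node k e l r) (!e, false)) =
      height M p (node k e l r) + if p < M then 1 else -1 := by
  have h := wt_succ p (M - 1)
  have h2 : M - 1 + 1 = M := by omega
  rw [h2, wt_top hp] at h
  have : wt p (M - 1) = 2 * p - M - if M ≤ p then 1 else -1 := by rw [h]; ring
  simp [act, height, this]
  split_ifs <;> first | omega | ring

theorem height_act (hM : 2 ≤ M) {p : ℕ} (hp : p ≤ M) {q : DState} (hq : Valid M q)
    (a : Bool × Bool) :
    height M p (act M q a) = height M p q + 1 ∨ height M p (act M q a) = height M p q - 1 := by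
  obtain ⟨b, σ⟩ := a
  cases q with
  | base k =>
    cases σ
    · rw [height_base_neg hM hp]; split_ifs <;> simp [sub_eq_add_neg]
    · rw [height_base_pos]; split_ifs <;> simp [sub_eq_add_neg]
  | node k e l r =>
    obtain ⟨hl, hr⟩ := hq
    by_cases hb : b = e
    · subst hb
      cases σ
      · rw [height_node_neg_same _ _ hl.1]; split_ifs <;> simp [sub_eq_add_neg]
      · rw [height_node_pos_same]; split_ifs <;> simp [sub_eq_add_neg]
    · have hb : b = !e := by cases b <;> cases e <;> simp_all
      subst hb
      cases σ
      · rw [height_node_neg_ne hM hp]; split_ifs <;> simp [sub_eq_add_neg]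
      · rw [height_node_pos_ne hp _ _ hl.2]; split_ifs <;> simp [sub_eq_add_neg]

end DState

/-- The `n`-fold iterate of Boolean negation. -/
def tw : ℕ → Bool → Bool
  | 0, b => b
  | n + 1, b => !(tw n b)

@[simp] theorem tw_zero (b : Bool) : tw 0 b = b := rfl

theorem tw_succ (n : ℕ) (b : Bool) : tw (n + 1) b = !(tw n b) := rfl

@[simp] theorem tw_not (n : ℕ) (b : Bool) : tw n (!b) = !(tw n b) := by
  induction n with
  | zero => rfl
  | succ n ih => simp [tw_succ, ih]

theorem tw_add (m n : ℕ) (b : Bool) : tw (m + n) b = tw m (tw n b) := by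
  induction m with
  | zero => simp
  | succ m ih => rw [Nat.add_right_comm, tw_succ, tw_succ, ih]

@[simp] theorem tw_tw (n : ℕ) (b : Bool) : tw n (tw n b) = b := by
  induction n with
  | zero => rfl
  | succ n ih => simp [tw_succ, ih]

/-- The alternating positive word of length `j` over two generators, starting with `b`. -/
def alt (b : Bool) (j : ℕ) : Word Bool := altWord b (!b) j

@[simp] theorem alt_zero (b : Bool) : alt b 0 = [] := rfl

theorem alt_succ (b : Bool) (j : ℕ) : alt b (j + 1) = (b, true) :: alt (!b) j := by
  simp [alt, altWord]

theorem alt_add (b : Bool) (i j : ℕ) : alt b (i + j) = alt b i ++ alt (tw i b) j := by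
  induction i generalizing b with
  | zero => simp
  | succ i ih => rw [Nat.add_right_comm, alt_succ, ih, alt_succ]; simp [tw_succ]

@[simp] theorem length_alt (b : Bool) (j : ℕ) : (alt b j).length = j := by
  induction j generalizing b with
  | zero => rfl
  | succ j ih => simp [alt_succ, ih]

@[simp] theorem wordInv_nil {S : Type*} : wordInv ([] : Word S) = [] := rfl

theorem wordInv_cons {S : Type*} (a : S × Bool) (w : Word S) :
    wordInv (a :: w) = wordInv w ++ [bar a] := by simp [wordInv, bar]

@[simp] theorem wordInv_append {S : Type*} (u v : Word S) :
    wordInv (u ++ v) = wordInv v ++ wordInv u := by simp [wordInv]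

@[simp] theorem wordInv_wordInv {S : Type*} (u : Word S) : wordInv (wordInv u) = u := by
  induction u with
  | nil => rfl
  | cons a u ih => rw [wordInv_cons, wordInv_append, ih]; simp [wordInv, bar]

@[simp] theorem length_wordInv {S : Type*} (u : Word S) : (wordInv u).length = u.length := by
  simp [wordInv]

namespace DState

variable {M : ℕ}

theorem valid_base (k : ℤ) : Valid M (base k) := trivial

theorem run_climb (k : ℤ) (e : Bool) (l j : ℕ) (r : List ℕ) (h : l + j < M) :
    run M (node k e l r) (alt (!e) j) = node k (tw j e) (l + j) r := by
  induction j generalizing e l with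
  | zero => rfl
  | succ j ih =>
    have h1 : act M (node k e l r) (!e, true) = node k (!e) (l + 1) r := by
      have : l + 1 < M := by omega
      simp [act, this]
    rw [alt_succ, run_cons, h1, ih _ _ (by omega)]
    simp [tw_succ, add_assoc, add_comm 1 j]

theorem run_climb_top (k : ℤ) (e : Bool) (l j : ℕ) (r : List ℕ) (h : l + j + 1 = M) :
    run M (node k e l r) (alt (!e) (j + 1)) = ofStack (k + 1) (tw j e) r := by
  induction j generalizing e l with
  | zero =>
    have : ¬ (l + 1 < M) := by omega
    simp [alt_succ, act, this]
  | succ j ih =>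
    have h1 : act M (node k e l r) (!e, true) = node k (!e) (l + 1) r := by
      have : l + 1 < M := by omega
      simp [act, this]
    rw [alt_succ, run_cons, h1, ih _ _ (by omega)]
    simp [tw_succ]

theorem act_push (k : ℤ) (e : Bool) (r : List ℕ) :
    act M (ofStack k e r) (e, true) = node k e 1 r := by
  cases r <;> simp [ofStack, act]

theorem run_push (k : ℤ) (e : Bool) (l : ℕ) (r : List ℕ) (h : l + 1 < M) :
    run M (ofStack k e r) (alt e (l + 1)) = node k (tw l e) (l + 1) r := by
  rw [alt_succ, run_cons, act_push, run_climb _ _ _ _ _ (by omega), add_comm]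

theorem run_push_top (hM : 2 ≤ M) (k : ℤ) (e : Bool) (r : List ℕ) :
    run M (ofStack k e r) (alt e M) = ofStack (k + 1) (tw M e) r := by
  obtain ⟨j, rfl⟩ : ∃ j, M = j + 1 + 1 := ⟨M - 2, by omega⟩
  rw [alt_succ, run_cons, act_push, run_climb_top _ _ _ _ _ (by omega)]
  simp [tw_succ]

/-- The action of the Garside element on states. -/
def garside (M : ℕ) : DState → DState
  | base k => base (k + 1)
  | node k e l r => node (k + 1) (tw M e) l r

theorem run_alt_top (hM : 2 ≤ M) {q : DState} (hq : Valid M q) (b : Bool) :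
    run M q (alt b M) = garside M q := by
  cases q with
  | base k => exact run_push_top hM k b []
  | node k e l r =>
    by_cases hb : b = e
    · subst hb
      exact run_push_top hM k b (l :: r)
    · have hb : b = !e := by cases b <;> cases e <;> simp_all
      subst hb
      obtain ⟨⟨h1, h2⟩, -⟩ := hq
      obtain ⟨l, rfl⟩ : ∃ l', l = l' + 1 := ⟨l - 1, by omega⟩
      obtain ⟨j, hj⟩ : ∃ j, M = (j + 1) + (l + 1) := ⟨M - l - 2, by omega⟩
      have h3 : alt (!e) M = alt (!e) (j + 1) ++ alt (tw j e) (l + 1) := by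
        rw [hj, alt_add]; simp [tw_succ]
      rw [h3, run_append, run_climb_top _ _ _ _ _ (by omega), run_push _ _ _ _ (by omega)]
      simp only [garside]
      rw [← tw_add]
      congr 1
      rw [hj, show j + 1 + (l + 1) = (l + j) + 1 + 1 by ring, tw_succ, tw_succ]
      simp

theorem height_garside (p : ℕ) (q : DState) :
    height M p (garside M q) = height M p q + (2 * p - M) := by
  cases q <;> simp [garside, height] <;> ring

theorem run_wordInv (hM : 2 ≤ M) {q : DState} (hq : Valid M q) (w : Word Bool) :
    run M (run M q w) (wordInv w) = q := by
  induction w generalizing q with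
  | nil => rfl
  | cons a w ih =>
    rw [wordInv_cons, run_cons, run_append, ih (valid_act hM hq a)]
    exact act_bar hM hq a

theorem run_wordInv_left (hM : 2 ≤ M) {q : DState} (hq : Valid M q) (w : Word Bool) :
    run M (run M q (wordInv w)) w = q := by
  simpa using run_wordInv hM hq (wordInv w)

/-! ### Reversible transformations over two generators -/

/-- The two sides of a transformation of type `1` or `2` over two generators. -/
inductive Core (M : ℕ) : Word Bool → Word Bool → Prop
  | pos (b : Bool) : Core M (alt b M) (alt (!b) M)
  | neg (b : Bool) : Core M (wordInv (alt b M)) (wordInv (alt (!b) M))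
  | mix (b : Bool) (v v' u u' : Word Bool) (h : v ++ v' = alt b M) (h' : u ++ u' = alt (!b) M)
      (hv : v ≠ []) (hv' : v' ≠ []) (hu : u ≠ []) (hu' : u' ≠ []) :
      Core M (v' ++ wordInv u') (wordInv v ++ u)

/-- One transformation of type `1` or `2` over two generators. -/
def RStep (M : ℕ) (c c' : Word Bool) : Prop :=
  ∃ x y u v, Core M u v ∧ c = x ++ u ++ y ∧ c' = x ++ v ++ y

/-- The equivalence relation generated by `RStep`. -/
def REquiv (M : ℕ) : Word Bool → Word Bool → Prop := Relation.EqvGen (RStep M)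

theorem REquiv.congr {c c' : Word Bool} (h : REquiv M c c') (x y : Word Bool) :
    REquiv M (x ++ c ++ y) (x ++ c' ++ y) := by
  induction h with
  | rel a b h =>
    obtain ⟨x', y', u, v, hc, rfl, rfl⟩ := h
    exact .rel _ _ ⟨x ++ x', y' ++ y, u, v, hc, by simp, by simp⟩
  | refl a => exact .refl _
  | symm a b _ ih => exact .symm _ _ ih
  | trans a b c _ _ ih ih' => exact .trans _ _ _ ih ih'

theorem REquiv.append_left {c c' : Word Bool} (h : REquiv M c c') (x : Word Bool) :
    REquiv M (x ++ c) (x ++ c') := by simpa using h.congr x []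

theorem REquiv.append_right {c c' : Word Bool} (h : REquiv M c c') (y : Word Bool) :
    REquiv M (c ++ y) (c' ++ y) := h.congr [] y

theorem Core.run_eq (hM : 2 ≤ M) {u v : Word Bool} (h : Core M u v) {q : DState}
    (hq : Valid M q) : run M q u = run M q v := by
  cases h with
  | pos b => rw [run_alt_top hM hq, run_alt_top hM hq]
  | neg b =>
    have hv := valid_run hM (wordInv (alt b M)) hq
    have h1 : run M (run M q (wordInv (alt b M))) (alt (!b) M) = q := by
      rw [run_alt_top hM hv, ← run_alt_top hM hv b, run_wordInv_left hM hq]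
    have h2 := run_wordInv hM hv (alt (!b) M)
    rw [h1] at h2
    exact h2.symm
  | mix b v v' u u' h h' =>
    have hv := valid_run hM (wordInv v) hq
    have h1 : run M q v' = run M (run M (run M q (wordInv v)) u) u' := by
      rw [← run_append _ u u', h', run_alt_top hM hv, ← run_alt_top hM hv b, ← h, run_append,
        run_wordInv_left hM hq]
    rw [run_append, h1, run_wordInv hM (valid_run hM _ hv), run_append]

theorem REquiv.run_eq (hM : 2 ≤ M) {c c' : Word Bool} (h : REquiv M c c') {q : DState}
    (hq : Valid M q) : run M q c = run M q c' := by
  induction h with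
  | rel a b h =>
    obtain ⟨x', y', u, v, hc, rfl, rfl⟩ := h
    rw [run_append, run_append, run_append, run_append, hc.run_eq hM (valid_run hM _ hq)]
  | refl a => rfl
  | symm a b _ ih => exact ih.symm
  | trans a b c _ _ ih ih' => exact ih.trans ih'

/-! ### Geodesics over two generators -/

/-- Geodesic words over two generators, characterized by a height function. -/
def Geo (M : ℕ) (c : Word Bool) : Prop :=
  ∃ p ≤ M, height M p (run M (base 0) c) = c.length

theorem height_run_le (hM : 2 ≤ M) {p : ℕ} (hp : p ≤ M) {q : DState} (hq : Valid M q)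
    (c : Word Bool) : height M p (run M q c) ≤ height M p q + c.length := by
  induction c generalizing q with
  | nil => simp
  | cons a c ih =>
    have := ih (valid_act hM hq a)
    have := height_act hM hp hq a
    simp only [run_cons, length_cons]
    push_cast
    omega

theorem height_base_zero (p : ℕ) : height M p (base 0) = 0 := by simp [height]

theorem height_word_le (hM : 2 ≤ M) {p : ℕ} (hp : p ≤ M) (c : Word Bool) :
    height M p (run M (base 0) c) ≤ c.length := by
  simpa [height_base_zero] using height_run_le hM hp (valid_base 0) c

theorem height_left (hM : 2 ≤ M) {p : ℕ} (hp : p ≤ M) {c d : Word Bool}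
    (h : height M p (run M (base 0) (c ++ d)) = (c ++ d).length) :
    height M p (run M (base 0) c) = c.length := by
  have h1 := height_word_le hM hp c
  have h2 := height_run_le hM hp (valid_run hM c (valid_base 0)) d
  rw [run_append] at h
  simp only [length_append] at h
  push_cast at h
  omega

theorem Geo.of_append (hM : 2 ≤ M) {c d : Word Bool} (h : Geo M (c ++ d)) : Geo M c := by
  obtain ⟨p, hp, h⟩ := h
  exact ⟨p, hp, height_left hM hp h⟩

theorem geo_nil : Geo M [] := ⟨0, by simp, by simp [height]⟩

theorem Geo.length_le (hM : 2 ≤ M) {c c' : Word Bool} (h : Geo M c)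
    (he : run M (base 0) c = run M (base 0) c') : c.length ≤ c'.length := by
  obtain ⟨p, hp, h⟩ := h
  have := height_word_le hM hp c'
  rw [he] at h
  omega

theorem Geo.of_length_eq {c c' : Word Bool} (h : Geo M c)
    (he : run M (base 0) c = run M (base 0) c') (hl : c.length = c'.length) : Geo M c' := by
  obtain ⟨p, hp, h⟩ := h
  exact ⟨p, hp, by rw [← he, h, hl]⟩

theorem Geo.length_eq (hM : 2 ≤ M) {c c' : Word Bool} (h : Geo M c) (h' : Geo M c')
    (he : run M (base 0) c = run M (base 0) c') : c.length = c'.length :=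
  le_antisymm (h.length_le hM he) (h'.length_le hM he.symm)

theorem run_concat (q : DState) (c : Word Bool) (a : Bool × Bool) :
    run M q (c ++ [a]) = act M (run M q c) a := by simp

theorem run_cancel (hM : 2 ≤ M) {c c' : Word Bool} {a : Bool × Bool}
    (h : run M (base 0) (c ++ [a]) = run M (base 0) (c' ++ [a])) :
    run M (base 0) c = run M (base 0) c' := by
  rw [run_concat, run_concat] at h
  rw [← act_bar hM (valid_run hM c (valid_base 0)) a, h,
    act_bar hM (valid_run hM c' (valid_base 0)) a]

theorem run_concat_bar (hM : 2 ≤ M) (c : Word Bool) (a : Bool × Bool) :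
    run M (base 0) (c ++ [a, bar a]) = run M (base 0) c := by
  simp [act_bar hM (valid_run hM c (valid_base 0)) a]

theorem eq_not_of_ne {b e : Bool} (h : b ≠ e) : b = !e := by
  cases b <;> cases e <;> simp_all

theorem not_both_down (hM : 2 ≤ M) {p : ℕ} (hp : p ≤ M) {q : DState} (hq : Valid M q)
    (b : Bool) (h : height M p (act M q (b, true)) < height M p q) :
    height M p q < height M p (act M q (b, false)) := by
  cases q with
  | base k =>
    rw [height_base_neg hM hp]
    rw [height_base_pos] at h
    split_ifs at * <;> omega
  | node k e l r =>
    obtain ⟨⟨h1, h2⟩, -⟩ := hq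
    by_cases hb : b = e
    · subst hb
      rw [height_node_neg_same _ _ h1]
      rw [height_node_pos_same] at h
      split_ifs at * <;> omega
    · obtain rfl := eq_not_of_ne hb
      rw [height_node_neg_ne hM hp]
      rw [height_node_pos_ne hp _ _ h2] at h
      split_ifs at * <;> omega

/-! Concavity of the height in the threshold. -/

/-- Half of the increment of the height when passing to the threshold `j`. -/
def slope (j : ℕ) : DState → ℤ
  | base k => k
  | node k _ l r => k + ((l :: r).countP (j ≤ ·) : ℕ)

theorem wt_succ_left (p l : ℕ) : wt (p + 1) l = wt p l + 2 * if p + 1 ≤ l then 1 else 0 := by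
  unfold wt; push_cast; split_ifs <;> omega

theorem sum_wt_succ (p : ℕ) (r : List ℕ) :
    (r.map (wt (p + 1))).sum = (r.map (wt p)).sum + 2 * (r.countP (p + 1 ≤ ·) : ℕ) := by
  induction r with
  | nil => simp
  | cons x r ih =>
    simp only [map_cons, sum_cons, ih, countP_cons, wt_succ_left]
    push_cast
    simp only [decide_eq_true_eq]
    ring

theorem height_succ (p : ℕ) (q : DState) :
    height M (p + 1) q = height M p q + 2 * slope (p + 1) q := by
  cases q with
  | base k => simp [height, slope]; ring
  | node k e l r =>
    have := sum_wt_succ p (l :: r)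
    simp only [map_cons, sum_cons] at this
    simp only [height, slope]
    push_cast
    linarith

theorem slope_anti {i j : ℕ} (h : i ≤ j) (q : DState) : slope j q ≤ slope i q := by
  cases q with
  | base k => simp [slope]
  | node k e l r =>
    simp only [slope]
    have : (l :: r).countP (fun x => decide (j ≤ x)) ≤ (l :: r).countP (fun x => decide (i ≤ x)) :=
      countP_mono_left fun x _ hx => by
        simp only [decide_eq_true_eq] at *
        omega
    omega

theorem height_parity (p : ℕ) (q : DState) : ∃ z : ℤ, height M p q = height M 0 q + 2 * z := by
  induction p with
  | zero => exact ⟨0, by simp⟩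
  | succ p ih =>
    obtain ⟨z, hz⟩ := ih
    exact ⟨z + slope (p + 1) q, by rw [height_succ, hz]; ring⟩

theorem height_top {q : DState} (hq : Valid M q) : height M M q = - height M 0 q := by
  have key : ∀ r : List ℕ, (∀ x ∈ r, 1 ≤ x ∧ x < M) →
      (r.map (wt M)).sum = - (r.map (wt 0)).sum := by
    intro r hr
    induction r with
    | nil => simp
    | cons x r ih =>
      have h1 := hr x (by simp)
      have h2 : wt M x = - wt 0 x := by
        unfold wt; split_ifs <;> push_cast <;> omega
      rw [map_cons, sum_cons, ih fun y hy => hr y (by simp [hy]), map_cons, sum_cons, h2]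
      ring
  cases q with
  | base k => simp only [height, Nat.cast_zero]; ring
  | node k e l r =>
    have := key (l :: r) (by simpa [Valid] using hq)
    simp only [map_cons, sum_cons] at this
    simp only [height]
    push_cast
    linarith

/-- A state of maximal height `n`. -/
def MaxHeight (M : ℕ) (q : DState) (n : ℕ) : Prop :=
  (∀ p ≤ M, height M p q ≤ n) ∧ ∃ p ≤ M, height M p q = n

theorem exists_maxHeight {q : DState} (hq : Valid M q) : ∃ n, MaxHeight M q n := by
  obtain ⟨p, hp, h⟩ := Finset.exists_max_image (Finset.range (M + 1)) (fun p => height M p q)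
    ⟨0, by simp⟩
  have h0 := h 0 (by simp)
  have hM := h M (by simp)
  have := height_top hq
  obtain ⟨n, hn⟩ := Int.eq_ofNat_of_zero_le (show 0 ≤ height M p q by omega)
  refine ⟨n, fun p' hp' => ?_, p, by simpa [Nat.lt_succ_iff] using hp, hn⟩
  have := h p' (by simpa [Nat.lt_succ_iff] using hp')
  omega

theorem Geo.maxHeight (hM : 2 ≤ M) {c : Word Bool} (h : Geo M c) :
    MaxHeight M (run M (base 0) c) c.length :=
  ⟨fun _ hp => height_word_le hM hp c, h⟩

theorem MaxHeight.down (hM : 2 ≤ M) {q : DState} (hq : Valid M q) {n : ℕ}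
    (h : MaxHeight M q n) {a : Bool × Bool}
    (ha : ∀ p ≤ M, height M p q = n → height M p (act M q a) < height M p q) :
    ∃ m, n = m + 1 ∧ MaxHeight M (act M q a) m := by
  obtain ⟨m, hm⟩ := exists_maxHeight (valid_act hM hq a)
  obtain ⟨hle, p, hp, hpn⟩ := h
  have h1 := ha p hp hpn
  have h2 := height_act hM hp hq a
  have h3 := hm.1 p hp
  refine ⟨m, ?_, hm⟩
  obtain ⟨-, p', hp', hm'⟩ := hm
  have h4 := height_act hM hp' hq a
  have h5 := hle p' hp'
  by_cases hn : height M p' q = n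
  · have := ha p' hp' hn
    omega
  · obtain ⟨z, hz⟩ := height_parity (M := M) p q
    obtain ⟨z', hz'⟩ := height_parity (M := M) p' q
    omega

theorem exists_descent (hM : 2 ≤ M) {q : DState} (hq : Valid M q) (h0 : q ≠ base 0) {n : ℕ}
    (h : MaxHeight M q n) :
    ∃ a, ∀ p ≤ M, height M p q = n → height M p (act M q a) < height M p q := by
  cases q with
  | base k =>
    rcases lt_trichotomy k 0 with hk | hk | hk
    · refine ⟨(true, true), fun p hp hpn => ?_⟩
      rw [height_base_pos]
      split_ifs with h1
      · have h2 := h.1 (p - 1) (by omega)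
        have h3 := height_succ (M := M) (p - 1) (base k)
        rw [Nat.sub_add_cancel h1] at h3
        simp only [slope] at h3
        omega
      · omega
    · exact absurd (by rw [hk]) h0
    · refine ⟨(true, false), fun p hp hpn => ?_⟩
      rw [height_base_neg hM hp]
      split_ifs with h1
      · have h2 := h.1 (p + 1) (by omega)
        have h3 := height_succ (M := M) p (base k)
        simp only [slope] at h3
        omega
      · omega
  | node k e l r =>
    obtain ⟨⟨h1, h2⟩, -⟩ := hq
    by_cases hs : 0 < slope l (node k e l r)
    · refine ⟨(e, false), fun p hp hpn => ?_⟩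
      rw [height_node_neg_same _ _ h1]
      split_ifs with h3
      · have h4 := h.1 (p + 1) (by omega)
        have h5 := height_succ (M := M) p (node k e l r)
        have h6 := slope_anti (show p + 1 ≤ l by omega) (node k e l r)
        omega
      · omega
    · refine ⟨(!e, true), fun p hp hpn => ?_⟩
      rw [height_node_pos_ne hp _ _ h2]
      split_ifs with h3
      · have h4 := h.1 (p - 1) (by omega)
        have h5 := height_succ (M := M) (p - 1) (node k e l r)
        rw [Nat.sub_add_cancel (by omega)] at h5
        have h6 := slope_anti (show l + 1 ≤ p by omega) (node k e l r)
        have h7 : slope (l + 1) (node k e l r) + 1 ≤ slope l (node k e l r) := by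
          simp only [slope, countP_cons]
          have : r.countP (fun x => decide (l < x)) ≤ r.countP (fun x => decide (l ≤ x)) :=
            countP_mono_left fun x _ hx => by
              simp only [decide_eq_true_eq] at *
              omega
          simp
          omega
        omega
      · omega

theorem exists_geo (hM : 2 ≤ M) {q : DState} (hq : Valid M q) {n : ℕ} (h : MaxHeight M q n) :
    ∃ c, run M (base 0) c = q ∧ c.length = n ∧ Geo M c := by
  induction n generalizing q with
  | zero =>
    by_cases h0 : q = base 0
    · exact ⟨[], h0.symm, rfl, geo_nil⟩
    · obtain ⟨a, ha⟩ := exists_descent hM hq h0 h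
      obtain ⟨m, hm, -⟩ := h.down hM hq ha
      omega
  | succ n ih =>
    by_cases h0 : q = base 0
    · subst h0
      obtain ⟨-, p, hp, h⟩ := h
      rw [height_base_zero] at h
      omega
    · obtain ⟨a, ha⟩ := exists_descent hM hq h0 h
      obtain ⟨m, hm, hm'⟩ := h.down hM hq ha
      obtain rfl : n = m := by omega
      obtain ⟨c, hc, hl, -⟩ := ih (valid_act hM hq a) hm'
      have h1 : run M (base 0) (c ++ [bar a]) = q := by
        rw [run_concat, hc, act_bar hM hq]
      obtain ⟨p, hp, hpn⟩ := h.2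
      exact ⟨c ++ [bar a], h1, by simp [hl], p, hp, by rw [h1, hpn]; simp [hl]⟩

theorem exists_geo_word (hM : 2 ≤ M) (w : Word Bool) :
    ∃ c, Geo M c ∧ run M (base 0) c = run M (base 0) w := by
  have hq := valid_run hM w (valid_base 0)
  obtain ⟨n, hn⟩ := exists_maxHeight hq
  obtain ⟨c, h, -, hg⟩ := exists_geo hM hq hn
  exact ⟨c, hg, h⟩

theorem Geo.concat_or (hM : 2 ≤ M) {c : Word Bool} (h : Geo M c) (a : Bool × Bool) :
    Geo M (c ++ [a]) ∨
      ∃ c', Geo M (c' ++ [bar a]) ∧ run M (base 0) (c' ++ [bar a]) = run M (base 0) c := by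
  have hq := valid_run hM c (valid_base 0)
  by_cases hd : ∀ p ≤ M, height M p (run M (base 0) c) = c.length →
      height M p (act M (run M (base 0) c) a) < height M p (run M (base 0) c)
  · right
    obtain ⟨m, hm, hm'⟩ := (h.maxHeight hM).down hM hq hd
    obtain ⟨c', hc', hl, -⟩ := exists_geo hM (valid_act hM hq a) hm'
    have h1 : run M (base 0) (c' ++ [bar a]) = run M (base 0) c := by
      rw [run_concat, hc', act_bar hM hq]
    exact ⟨c', h.of_length_eq h1.symm (by simp [hl, hm]), h1⟩
  · left
    push Not at hd
    obtain ⟨p, hp, h1, h2⟩ := hd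
    refine ⟨p, hp, ?_⟩
    rw [run_concat]
    have := height_act hM hp hq a
    simp only [length_append, length_singleton]
    push_cast
    omega

theorem Geo.concat_not (hM : 2 ≤ M) {c c' : Word Bool} {a : Bool × Bool}
    (h : Geo M (c ++ [a])) (h' : Geo M (c' ++ [bar a]))
    (he : run M (base 0) (c' ++ [bar a]) = run M (base 0) c) : False := by
  have h1 := h'.length_eq hM (h.of_append hM) he
  have h2 : run M (base 0) (c ++ [a]) = run M (base 0) c' := by
    rw [run_concat, ← he, run_concat]
    simpa using act_bar hM (valid_run hM c' (valid_base 0)) (bar a)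
  have h3 := h.length_le hM h2
  simp at h1 h3
  omega

end DState

theorem tw_congr {m n : ℕ} (h : m % 2 = n % 2) (b : Bool) : tw m b = tw n b := by
  have key : ∀ n, tw n b = tw (n % 2) b := by
    intro n
    induction n using Nat.twoStepInduction with
    | zero => rfl
    | one => rfl
    | more n ih _ => rw [tw_succ, tw_succ, Bool.not_not, ih]; congr 1; omega
  rw [key m, key n, h]

theorem alt_succ_right (b : Bool) (j : ℕ) : alt b (j + 1) = alt b j ++ [(tw j b, true)] := by
  rw [alt_add]; rfl

theorem wordInv_alt_succ (b : Bool) (j : ℕ) :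
    wordInv (alt b (j + 1)) = wordInv (alt (!b) j) ++ [(b, false)] := by
  rw [alt_succ, wordInv_cons]; rfl

namespace DState

variable {M : ℕ}

/-- The letter `a` is a possible last letter of a path to `q` as seen by the height with
threshold `p`. -/
def IsEnd (M p : ℕ) (q : DState) (a : Bool × Bool) : Prop :=
  height M p (act M q (bar a)) < height M p q

theorem isEnd_cases (hM : 2 ≤ M) {p : ℕ} (hp : p ≤ M) {q : DState} (hq : Valid M q)
    {a b : Bool × Bool} (hab : a ≠ b) (ha : IsEnd M p q a) (hb : IsEnd M p q b) :
    (∃ x, a = (x, true) ∧ b = (!x, true) ∧ p = M) ∨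
    (∃ x, a = (x, false) ∧ b = (!x, false) ∧ p = 0) ∨
    ∃ k e r, q = node k e p r ∧
      (a = (e, true) ∧ b = (!e, false) ∨ a = (!e, false) ∧ b = (e, true)) := by
  obtain ⟨a, σ⟩ := a
  obtain ⟨b, τ⟩ := b
  have h1 : ∀ x, IsEnd M p q (x, true) → ¬ IsEnd M p q (x, false) := fun x h h' => by
    have := not_both_down hM hp hq x h'
    unfold IsEnd bar at h
    simp at h
    omega
  by_cases hn : a = b
  · subst hn
    cases σ <;> cases τ
    · exact absurd rfl hab
    · exact absurd ha (h1 _ hb)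
    · exact absurd hb (h1 _ ha)
    · exact absurd rfl hab
  · obtain rfl : b = !a := eq_not_of_ne (Ne.symm hn)
    cases q with
    | base k =>
      unfold IsEnd bar at ha hb
      cases σ <;> cases τ <;>
        simp only [Bool.not_true, Bool.not_false, height_base_pos, height_base_neg hM hp] at ha hb
      · exact Or.inr (Or.inl ⟨a, rfl, rfl, by split_ifs at * <;> omega⟩)
      · split_ifs at * <;> omega
      · split_ifs at * <;> omega
      · exact Or.inl ⟨a, rfl, rfl, by split_ifs at * <;> omega⟩
    | node k e l r =>
      obtain ⟨⟨hl, hl'⟩, -⟩ := hq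
      have ep : IsEnd M p (node k e l r) (e, true) → l ≤ p := fun h => by
        unfold IsEnd bar at h
        simp only [Bool.not_true, height_node_neg_same _ _ hl] at h
        split_ifs at h <;> omega
      have nm : IsEnd M p (node k e l r) (!e, false) → p ≤ l := fun h => by
        unfold IsEnd bar at h
        simp only [Bool.not_false, height_node_pos_ne hp _ _ hl'] at h
        split_ifs at h <;> omega
      have np : IsEnd M p (node k e l r) (!e, true) → p = M := fun h => by
        unfold IsEnd bar at h
        simp only [Bool.not_true, height_node_neg_ne hM hp] at h
        split_ifs at h <;> omega
      have em : IsEnd M p (node k e l r) (e, false) → p = 0 := fun h => by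
        unfold IsEnd bar at h
        simp only [Bool.not_false, height_node_pos_same] at h
        split_ifs at h <;> omega
      by_cases hae : a = e
      · subst hae
        cases σ <;> cases τ
        · exact Or.inr (Or.inl ⟨a, rfl, rfl, em ha⟩)
        · have := em ha; have := np hb; omega
        · have := ep ha; have := nm hb
          obtain rfl : l = p := by omega
          exact Or.inr (Or.inr ⟨k, a, r, rfl, Or.inl ⟨rfl, rfl⟩⟩)
        · exact Or.inl ⟨a, rfl, rfl, np hb⟩
      · obtain rfl := eq_not_of_ne hae
        rw [Bool.not_not] at hb ⊢
        cases σ <;> cases τ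
        · exact Or.inr (Or.inl ⟨!e, rfl, by simp, em hb⟩)
        · have := nm ha; have := ep hb
          obtain rfl : l = p := by omega
          exact Or.inr (Or.inr ⟨k, e, r, rfl, Or.inr ⟨rfl, rfl⟩⟩)
        · have := np ha; have := em hb; omega
        · exact Or.inl ⟨!e, rfl, by simp, np ha⟩

theorem isEnd_adjacent (hM : 2 ≤ M) {p : ℕ} (hp : p + 1 ≤ M) {q : DState} (hq : Valid M q)
    {a b : Bool × Bool} (ha : IsEnd M p q a) (hb : IsEnd M p q b)
    (ha' : IsEnd M (p + 1) q a) (hb' : IsEnd M (p + 1) q b) : a = b := by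
  by_contra hab
  rcases isEnd_cases hM (by omega) hq hab ha hb with
    ⟨x, -, -, h⟩ | ⟨x, hx, hx', h⟩ | ⟨k, e, r, h, h'⟩
  · omega
  · rcases isEnd_cases hM hp hq hab ha' hb' with ⟨y, hy, -, -⟩ | ⟨y, -, -, hy⟩ | ⟨k, e, r, -, hy⟩
    · rw [hx] at hy; simp at hy
    · omega
    · rw [hx, hx'] at hy; simp at hy
  · rcases isEnd_cases hM hp hq hab ha' hb' with
      ⟨y, hy, hy', -⟩ | ⟨y, -, -, hy⟩ | ⟨k', e', r', hy, -⟩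
    · rw [hy, hy'] at h'; simp at h'
    · omega
    · rw [h] at hy
      simp at hy

theorem isEnd_concat (hM : 2 ≤ M) {p : ℕ} (hp : p ≤ M) {c : Word Bool} {a : Bool × Bool}
    (h : height M p (run M (base 0) (c ++ [a])) = (c ++ [a]).length) :
    IsEnd M p (run M (base 0) (c ++ [a])) a := by
  unfold IsEnd
  rw [h, run_concat, act_bar hM (valid_run hM c (valid_base 0))]
  have := height_word_le hM hp c
  simp
  omega

theorem Geo.last_eq (hM : 2 ≤ M) {p : ℕ} (hp : p + 1 ≤ M) {c c' : Word Bool}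
    {a b : Bool × Bool} (h : height M p (run M (base 0) (c ++ [a])) = (c ++ [a]).length)
    (h' : height M (p + 1) (run M (base 0) (c ++ [a])) = (c ++ [a]).length)
    (hg : Geo M (c' ++ [b])) (he : run M (base 0) (c ++ [a]) = run M (base 0) (c' ++ [b])) :
    a = b := by
  have hl := Geo.length_eq hM (c := c ++ [a]) ⟨p, by omega, h⟩ hg he
  have h1 := isEnd_concat hM (by omega) h
  have h2 := isEnd_concat hM hp h'
  refine isEnd_adjacent hM hp (valid_run hM _ (valid_base 0)) h1 ?_ h2 ?_
  · rw [he]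
    exact isEnd_concat hM (by omega) (by rw [← he, h, hl])
  · rw [he]
    exact isEnd_concat hM hp (by rw [← he, h', hl])

/-! ### Words with prescribed marks -/

/-- A negative alternating word, starting with the inverse of the generator other than `e`. -/
def nalt (e : Bool) (j : ℕ) : Word Bool := wordInv (alt (tw j e) j)

/-- A positive block of length `l`, or the complementary negative block. -/
def blk (M : ℕ) (e : Bool) (b : ℕ × Bool) : Word Bool :=
  bif b.2 then nalt e (M - b.1) else alt e b.1

/-- The last letter of the positive part after a block. -/
def nxt (M : ℕ) (e : Bool) (b : ℕ × Bool) : Bool :=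
  bif b.2 then tw (M - b.1 - 1) e else tw (b.1 - 1) e

/-- The concatenation of a list of blocks. -/
def blks (M : ℕ) : Bool → List (ℕ × Bool) → Word Bool
  | _, [] => []
  | e, b :: bs => blk M e b ++ blks M (nxt M e b) bs

/-- The last letter of the positive part after a list of blocks. -/
def nxts (M : ℕ) : Bool → List (ℕ × Bool) → Bool
  | e, [] => e
  | e, b :: bs => nxts M (nxt M e b) bs

theorem blks_append (e : Bool) (bs cs : List (ℕ × Bool)) :
    blks M e (bs ++ cs) = blks M e bs ++ blks M (nxts M e bs) cs := by
  induction bs generalizing e with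
  | nil => rfl
  | cons b bs ih => simp [blks, nxts, ih]

theorem nxts_append (e : Bool) (bs cs : List (ℕ × Bool)) :
    nxts M e (bs ++ cs) = nxts M (nxts M e bs) cs := by
  induction bs generalizing e with
  | nil => rfl
  | cons b bs ih => simp [nxts, ih]

theorem run_blk (hM : 2 ≤ M) (k : ℤ) (e : Bool) {r : List ℕ} (b : ℕ × Bool)
    (hr : ∀ x ∈ r, 1 ≤ x ∧ x < M) (hb : 1 ≤ b.1 ∧ b.1 < M) :
    run M (ofStack k e r) (blk M e b) =
      node (k - if b.2 then 1 else 0) (nxt M e b) b.1 r := by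
  obtain ⟨l, σ⟩ := b
  simp only at hb
  cases σ
  · obtain ⟨l, rfl⟩ : ∃ l', l = l' + 1 := ⟨l - 1, by omega⟩
    simpa [blk, nxt] using run_push k e l r hb.2
  · obtain ⟨j, hj⟩ : ∃ j, M = l + (j + 1) := ⟨M - l - 1, by omega⟩
    have h1 : M - l = j + 1 := by omega
    have h2 : M - l - 1 = j := by omega
    have h3 := run_climb_top (M := M) (k - 1) (tw j e) l j r (by omega)
    have hv : Valid M (node (k - 1) (tw j e) l r) := ⟨hb, hr⟩
    have h4 := run_wordInv hM hv (alt (!tw j e) (j + 1))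
    rw [h3] at h4
    simpa [blk, nxt, nalt, h1, h2, tw_succ] using h4

theorem run_blks (hM : 2 ≤ M) (k : ℤ) (e : Bool) {r : List ℕ} (bs : List (ℕ × Bool))
    (hr : ∀ x ∈ r, 1 ≤ x ∧ x < M) (hb : ∀ b ∈ bs, 1 ≤ b.1 ∧ b.1 < M) :
    run M (ofStack k e r) (blks M e bs) =
      ofStack (k - (bs.countP (·.2) : ℕ)) (nxts M e bs) ((bs.map Prod.fst).reverse ++ r) := by
  induction bs generalizing k e r with
  | nil => simp [blks, nxts]
  | cons b bs ih =>
    have h1 := hb b (by simp)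
    rw [blks, run_append, run_blk hM k e b hr h1]
    have h2 := ih (k - if b.2 then 1 else 0) (nxt M e b) (r := b.1 :: r)
      (by simpa using ⟨h1, hr⟩) (fun x hx => hb x (by simp [hx]))
    have h3 : (k - if b.2 then 1 else 0) - (bs.countP (·.2) : ℕ) =
        k - ((b :: bs).countP (·.2) : ℕ) := by
      rw [countP_cons]
      cases b.2
      · simp
      · simp; ring
    rw [h3] at h2
    rw [show node (k - if b.2 then 1 else 0) (nxt M e b) b.1 r =
      ofStack (k - if b.2 then 1 else 0) (nxt M e b) (b.1 :: r) from rfl, h2]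
    simp [nxts]

theorem length_blks {p : ℕ} (e : Bool) (bs : List (ℕ × Bool))
    (hb : ∀ b ∈ bs, 1 ≤ b.1 ∧ b.1 < M)
    (hg : ∀ b ∈ bs, (b.2 = true → p ≤ b.1) ∧ (b.2 = false → b.1 ≤ p)) :
    ((blks M e bs).length : ℤ) =
      -(2 * p - M) * (bs.countP (·.2) : ℕ) + ((bs.map Prod.fst).map (wt p)).sum := by
  induction bs generalizing e with
  | nil => simp [blks]
  | cons b bs ih =>
    have h1 := hb b (by simp)
    have h2 := hg b (by simp)
    have h3 := ih (nxt M e b) (fun x hx => hb x (by simp [hx])) (fun x hx => hg x (by simp [hx]))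
    obtain ⟨l, σ⟩ := b
    simp only at h1 h2
    rw [blks, length_append, Nat.cast_add, h3]
    simp only [map_cons, sum_cons, countP_cons]
    cases σ
    · have : wt p l = l := by unfold wt; rw [if_pos (h2.2 rfl)]
      simp [blk, this]; ring
    · have : wt p l = 2 * p - l := by
        have := h2.1 rfl
        unfold wt; split_ifs <;> omega
      simp [blk, this, nalt, Nat.cast_sub h1.2.le]; ring

theorem nxts_eq (e : Bool) (bs : List (ℕ × Bool)) (hb : ∀ b ∈ bs, 1 ≤ b.1 ∧ b.1 < M) :
    nxts M e bs = tw (M * bs.countP (·.2) + ((bs.map Prod.fst).map (· + 1)).sum) e := by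
  induction bs generalizing e with
  | nil => rfl
  | cons b bs ih =>
    have h1 := hb b (by simp)
    rw [nxts, ih _ (fun x hx => hb x (by simp [hx]))]
    obtain ⟨l, σ⟩ := b
    simp only at h1
    simp only [map_cons, sum_cons, countP_cons]
    cases σ
    · simp only [nxt, cond_false]
      rw [← tw_add]
      apply tw_congr
      simp
      omega
    · simp only [nxt, cond_true]
      rw [← tw_add]
      apply tw_congr
      simp [mul_add]
      omega

theorem blk_swap (e : Bool) {l l' : ℕ} (hl : 1 ≤ l ∧ l < M) (hl' : 1 ≤ l' ∧ l' < M)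
    (bs : List (ℕ × Bool)) :
    REquiv M (blks M e ((l, false) :: (l', true) :: bs))
      (blks M e ((l, true) :: (l', false) :: bs)) := by
  have h1 : nxts M e [(l, false), (l', true)] = nxts M e [(l, true), (l', false)] := by
    rw [nxts_eq _ _ (by simpa using ⟨hl, hl'⟩), nxts_eq _ _ (by simpa using ⟨hl, hl'⟩)]
    simp
  have h2 : REquiv M (blks M e [(l, false), (l', true)]) (blks M e [(l, true), (l', false)]) := by
    obtain ⟨i, rfl⟩ : ∃ i, l = i + 1 := ⟨l - 1, by omega⟩
    obtain ⟨j, hj⟩ : ∃ j, M = (j + 1) + (i + 1) := ⟨M - i - 2, by omega⟩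
    obtain ⟨j', hj'⟩ : ∃ j', M = l' + (j' + 1) := ⟨M - l' - 1, by omega⟩
    have e1 : M - (i + 1) = j + 1 := by omega
    have e2 : M - l' = j' + 1 := by omega
    have hb : tw (j' + 1) (tw i e) = tw l' (!(tw (j + 1) e)) := by
      have : ∀ b, (!(tw (j + 1) b)) = tw (j + 2) b := fun _ => rfl
      rw [this, ← tw_add, ← tw_add]
      apply tw_congr
      omega
    have h3 := Core.mix (M := M) (tw (j + 1) e) (alt (tw (j + 1) e) (j + 1)) (alt e (i + 1))
      (alt (!(tw (j + 1) e)) l') (alt (tw l' (!(tw (j + 1) e))) (j' + 1))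
      (by conv_rhs => rw [hj, alt_add, tw_tw])
      (by conv_rhs => rw [hj', alt_add])
      (by simp [alt_succ]) (by simp [alt_succ])
      (by
        obtain ⟨m, rfl⟩ : ∃ m, l' = m + 1 := ⟨l' - 1, by omega⟩
        simp [alt_succ]) (by simp [alt_succ])
    have h4 : blks M e [(i + 1, false), (l', true)] =
        alt e (i + 1) ++ wordInv (alt (tw l' (!(tw (j + 1) e))) (j' + 1)) := by
      simp only [blks, blk, nxt, cond_false, cond_true, nalt, e2, append_nil,
        Nat.add_sub_cancel, hb]
    have h5 : blks M e [(i + 1, true), (l', false)] =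
        wordInv (alt (tw (j + 1) e) (j + 1)) ++ alt (!(tw (j + 1) e)) l' := by
      simp [blks, blk, nxt, nalt, e1, tw_succ]
    rw [h4, h5]
    exact .rel _ _ ⟨[], [], _, _, h3, by simp, by simp⟩
  have h3 := h2.append_right (blks M (nxts M e [(l, false), (l', true)]) bs)
  rw [← blks_append, h1, ← blks_append] at h3
  exact h3

/-- Mark the first `K` blocks. -/
def markFirst : List ℕ → ℕ → List (ℕ × Bool)
  | [], _ => []
  | l :: ls, 0 => (l, false) :: markFirst ls 0
  | l :: ls, K + 1 => (l, true) :: markFirst ls K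

theorem markFirst_push (e : Bool) (l : ℕ) (ls : List ℕ) (K : ℕ) (hl : 1 ≤ l ∧ l < M)
    (hls : ∀ x ∈ ls, 1 ≤ x ∧ x < M) (hK : K ≤ ls.length) :
    REquiv M (blks M e ((l, false) :: markFirst ls K)) (blks M e (markFirst (l :: ls) K)) := by
  induction ls generalizing e l K with
  | nil =>
    obtain rfl : K = 0 := by simpa using hK
    exact .refl _
  | cons l' ls ih =>
    cases K with
    | zero => exact .refl _
    | succ K =>
      have hl' := hls l' (by simp)
      refine .trans _ _ _ (blk_swap e hl hl' (markFirst ls K)) ?_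
      exact (ih (nxt M e (l, true)) l' K hl' (fun x hx => hls x (by simp [hx]))
        (by simpa using hK)).append_left _

theorem markFirst_equiv (e : Bool) (bs : List (ℕ × Bool)) (hb : ∀ b ∈ bs, 1 ≤ b.1 ∧ b.1 < M) :
    REquiv M (blks M e bs) (blks M e (markFirst (bs.map Prod.fst) (bs.countP (·.2)))) := by
  induction bs generalizing e with
  | nil => exact .refl _
  | cons b bs ih =>
    have h1 := (ih (nxt M e b) (fun x hx => hb x (by simp [hx]))).append_left (blk M e b)
    obtain ⟨l, σ⟩ := b
    cases σ
    · refine .trans _ _ _ h1 ?_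
      have := markFirst_push e l (bs.map Prod.fst) (bs.countP (·.2)) (hb (l, false) (by simp))
        (by
          intro x hx
          obtain ⟨y, hy, rfl⟩ := mem_map.1 hx
          exact hb y (by simp [hy])) (by simpa using countP_le_length)
      simpa [blks, REquiv] using this
    · simpa [markFirst, blks] using h1

theorem exists_marking (p : ℕ) (r : List ℕ) (K : ℕ) (h : r.countP (p < ·) ≤ K)
    (h' : K ≤ r.countP (p ≤ ·)) :
    ∃ bs : List (ℕ × Bool), bs.map Prod.fst = r ∧ bs.countP (·.2) = K ∧
      ∀ b ∈ bs, (b.2 = true → p ≤ b.1) ∧ (b.2 = false → b.1 ≤ p) := by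
  induction r generalizing K with
  | nil => exact ⟨[], rfl, by simpa [eq_comm] using h', by simp⟩
  | cons x r ih =>
    have hle : r.countP (fun x => decide (p < x)) ≤ r.countP (fun x => decide (p ≤ x)) :=
      countP_mono_left fun x _ hx => by
        simp only [decide_eq_true_eq] at *
        omega
    simp only [countP_cons, decide_eq_true_eq] at h h'
    by_cases hx : p < x ∨ p = x ∧ r.countP (p < ·) < K
    · obtain ⟨bs, h1, h2, h3⟩ := ih (K - 1) (by split_ifs at * <;> omega)
        (by split_ifs at * <;> omega)
      refine ⟨(x, true) :: bs, by simp [h1], ?_, ?_⟩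
      · simp [h2]
        split_ifs at * <;> omega
      · intro b hb
        rcases mem_cons.1 hb with rfl | hb
        · simp; omega
        · exact h3 b hb
    · obtain ⟨bs, h1, h2, h3⟩ := ih K (by split_ifs at * <;> omega)
        (by split_ifs at * <;> omega)
      refine ⟨(x, false) :: bs, by simp [h1], by simp [h2], ?_⟩
      intro b hb
      rcases mem_cons.1 hb with rfl | hb
      · simp; omega
      · exact h3 b hb

end DState

namespace DState

variable {M : ℕ}

theorem valid_garside {q : DState} (hq : Valid M q) : Valid M (garside M q) := by
  cases q <;> exact hq

theorem ends_pos (hM : 2 ≤ M) {q : DState} (hq : Valid M q) {n : ℕ} (hn : MaxHeight M q n)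
    (x : Bool) (hmax : ∀ p ≤ M, height M p q = n → p = M) :
    ∃ d d', REquiv M (d ++ [(x, true)]) (d' ++ [(!x, true)]) ∧
      run M (base 0) (d ++ [(x, true)]) = q ∧
      (d ++ [(x, true)]).length = n ∧ (d' ++ [(!x, true)]).length = n := by
  have hs : 1 ≤ slope M q := by
    have h1 := hn.1 (M - 1) (by omega)
    have h2 := fun h => hmax (M - 1) (by omega) h
    have h3 := height_succ (M := M) (M - 1) q
    rw [Nat.sub_add_cancel (by omega)] at h3
    obtain ⟨p, hp, hpn⟩ := hn.2
    rw [hmax p hp hpn] at hpn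
    omega
  have hle : ∀ i ≤ M, height M (M - i) q ≤ n - 2 * i := by
    intro i hi
    induction i with
    | zero => simpa using hn.1 M le_rfl
    | succ i ih =>
      have h1 := ih (by omega)
      have h2 := height_succ (M := M) (M - (i + 1)) q
      rw [show M - (i + 1) + 1 = M - i by omega] at h2
      have := slope_anti (show M - i ≤ M by omega) q
      push_cast
      omega
  set q' := run M q (wordInv (alt true M)) with hq'
  have hv : Valid M q' := valid_run hM _ hq
  have hg : garside M q' = q := by
    rw [← run_alt_top hM hv true]
    exact run_wordInv_left hM hq _
  obtain ⟨m, hm⟩ := exists_maxHeight hv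
  obtain ⟨y, hy, hl, -⟩ := exists_geo hM hv hm
  have hmn : m + M ≤ n := by
    obtain ⟨p, hp, hpm⟩ := hm.2
    have h1 := height_garside (M := M) p q'
    have h2 := hle (M - p) (by omega)
    rw [show M - (M - p) = p by omega] at h2
    rw [hg] at h1
    omega
  have hrun : ∀ b, run M (base 0) (y ++ alt b M) = q := fun b => by
    rw [run_append, hy, run_alt_top hM hv, hg]
  obtain ⟨j, rfl⟩ : ∃ j, M = j + 1 := ⟨M - 1, by omega⟩
  have ha : ∀ z, alt (tw j z) (j + 1) = alt (tw j z) j ++ [(z, true)] := fun z => by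
    rw [alt_succ_right, tw_tw]
  refine ⟨y ++ alt (tw j x) j, y ++ alt (tw j (!x)) j, ?_, ?_, ?_⟩
  · rw [append_assoc, append_assoc, ← ha, ← ha]
    exact .rel _ _ ⟨y, [], _, _, Core.pos (tw j x), by simp, by simp⟩
  · rw [append_assoc, ← ha, hrun]
  · have h1 := hrun (tw j x)
    obtain ⟨p, hp, hpn⟩ := hn.2
    have h2 := height_word_le hM hp (y ++ alt (tw j x) (j + 1))
    rw [h1, hpn] at h2
    simp at h2 ⊢
    omega

theorem ends_neg (hM : 2 ≤ M) {q : DState} (hq : Valid M q) {n : ℕ} (hn : MaxHeight M q n)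
    (x : Bool) (hmax : ∀ p ≤ M, height M p q = n → p = 0) :
    ∃ d d', REquiv M (d ++ [(x, false)]) (d' ++ [(!x, false)]) ∧
      run M (base 0) (d ++ [(x, false)]) = q ∧
      (d ++ [(x, false)]).length = n ∧ (d' ++ [(!x, false)]).length = n := by
  have hs : slope 1 q ≤ -1 := by
    have h1 := hn.1 1 (by omega)
    have h2 := fun h => hmax 1 (by omega) h
    have h3 := height_succ (M := M) 0 q
    obtain ⟨p, hp, hpn⟩ := hn.2
    rw [hmax p hp hpn] at hpn
    simp at h3
    omega
  have hle : ∀ i ≤ M, height M i q ≤ n - 2 * i := by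
    intro i hi
    induction i with
    | zero => simpa using hn.1 0 (by omega)
    | succ i ih =>
      have h1 := ih (by omega)
      have h2 := height_succ (M := M) i q
      have := slope_anti (show 1 ≤ i + 1 by omega) q
      push_cast
      omega
  have hv : Valid M (garside M q) := valid_garside hq
  obtain ⟨m, hm⟩ := exists_maxHeight hv
  obtain ⟨y, hy, hl, -⟩ := exists_geo hM hv hm
  have hmn : m + M ≤ n := by
    obtain ⟨p, hp, hpm⟩ := hm.2
    have h1 := height_garside (M := M) p q
    have h2 := hle p hp
    omega
  have hrun : ∀ b, run M (base 0) (y ++ wordInv (alt b M)) = q := fun b => by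
    rw [run_append, hy, ← run_alt_top hM hq b, run_wordInv hM hq]
  obtain ⟨j, rfl⟩ : ∃ j, M = j + 1 := ⟨M - 1, by omega⟩
  have ha := fun z => wordInv_alt_succ z j
  refine ⟨y ++ wordInv (alt (!x) j), y ++ wordInv (alt (!!x) j), ?_, ?_, ?_⟩
  · rw [append_assoc, append_assoc, ← ha, ← ha]
    exact .rel _ _ ⟨y, [], _, _, Core.neg x, by simp, by simp⟩
  · rw [append_assoc, ← ha, hrun]
  · have h1 := hrun x
    obtain ⟨p, hp, hpn⟩ := hn.2
    have h2 := height_word_le hM hp (y ++ wordInv (alt x (j + 1)))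
    rw [h1, hpn] at h2
    simp at h2 ⊢
    omega

theorem ends_mixed (hM : 2 ≤ M) {k : ℤ} {e : Bool} {l : ℕ} {r : List ℕ}
    (hq : Valid M (node k e l r)) {n : ℕ} (hn : MaxHeight M (node k e l r) n)
    (hmax : ∀ p ≤ M, height M p (node k e l r) = n → p = l) :
    ∃ d d', REquiv M (d ++ [(e, true)]) (d' ++ [(!e, false)]) ∧
      run M (base 0) (d ++ [(e, true)]) = node k e l r ∧ (d ++ [(e, true)]).length = n ∧
      (d' ++ [(!e, false)]).length = n := by
  have hl := hq.1
  have hr := hq.2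
  have hln : height M l (node k e l r) = n := by
    obtain ⟨p, hp, hpn⟩ := hn.2
    rwa [hmax p hp hpn] at hpn
  have hs : 1 ≤ slope l (node k e l r) := by
    have h1 := hn.1 (l - 1) (by omega)
    have h2 := fun h => hmax (l - 1) (by omega) h
    have h3 := height_succ (M := M) (l - 1) (node k e l r)
    rw [Nat.sub_add_cancel (by omega)] at h3
    omega
  have hs' : slope (l + 1) (node k e l r) ≤ -1 := by
    have h1 := hn.1 (l + 1) (by omega)
    have h2 := fun h => hmax (l + 1) (by omega) h
    have h3 := height_succ (M := M) l (node k e l r)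
    omega
  simp only [slope, countP_cons] at hs hs'
  obtain ⟨K, hK⟩ := Int.eq_ofNat_of_zero_le (show 0 ≤ -k by
    simp at hs'
    omega)
  obtain rfl : k = -K := by omega
  have c1 : r.countP (l < ·) + 1 ≤ K := by
    simp at hs'
    omega
  have c2 : K ≤ r.countP (l ≤ ·) := by
    simp at hs
    omega
  obtain ⟨bs, b1, b2, b3⟩ := exists_marking l r.reverse K (by rw [countP_reverse]; omega)
    (by rw [countP_reverse]; omega)
  obtain ⟨cs, d1, d2, d3⟩ := exists_marking l r.reverse (K - 1) (by rw [countP_reverse]; omega)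
    (by rw [countP_reverse]; omega)
  have vb : ∀ σ, ∀ b ∈ bs ++ [(l, σ)], 1 ≤ b.1 ∧ b.1 < M := by
    intro σ b hb
    rcases mem_append.1 hb with hb | hb
    · have : b.1 ∈ bs.map Prod.fst := mem_map_of_mem hb
      rw [b1, mem_reverse] at this
      exact hr _ this
    · simp at hb
      subst hb
      exact hl
  have vc : ∀ σ, ∀ b ∈ cs ++ [(l, σ)], 1 ≤ b.1 ∧ b.1 < M := by
    intro σ b hb
    rcases mem_append.1 hb with hb | hb
    · have : b.1 ∈ cs.map Prod.fst := mem_map_of_mem hb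
      rw [d1, mem_reverse] at this
      exact hr _ this
    · simp at hb
      subst hb
      exact hl
  have h1 : (cs ++ [(l, true)]).map Prod.fst = (bs ++ [(l, false)]).map Prod.fst := by
    simp [b1, d1]
  have h2 : (cs ++ [(l, true)]).countP (·.2) = (bs ++ [(l, false)]).countP (·.2) := by
    simp [b2, d2]
    omega
  obtain ⟨N, hN⟩ : ∃ N, N = M * (bs ++ [(l, false)]).countP (·.2) +
    (((bs ++ [(l, false)]).map Prod.fst).map (· + 1)).sum := ⟨_, rfl⟩
  have nb : nxts M (tw N e) (bs ++ [(l, false)]) = e := by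
    rw [nxts_eq _ _ (vb _), ← hN, tw_tw]
  have nc : nxts M (tw N e) (cs ++ [(l, true)]) = e := by
    rw [nxts_eq _ _ (vc _), h1, h2, ← hN, tw_tw]
  have wb : ∃ d, blks M (tw N e) (bs ++ [(l, false)]) = d ++ [(e, true)] := by
    rw [nxts_append] at nb
    obtain ⟨i, rfl⟩ : ∃ i, l = i + 1 := ⟨l - 1, by omega⟩
    refine ⟨blks M (tw N e) bs ++ alt (nxts M (tw N e) bs) i, ?_⟩
    rw [blks_append]
    simp only [nxts, nxt, cond_false, Nat.add_sub_cancel] at nb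
    simp [blks, blk, alt_succ_right, nb]
  have wc : ∃ d, blks M (tw N e) (cs ++ [(l, true)]) = d ++ [(!e, false)] := by
    rw [nxts_append] at nc
    obtain ⟨i, hi⟩ : ∃ i, M - l = i + 1 := ⟨M - l - 1, by omega⟩
    simp only [nxts, nxt, cond_true, hi, Nat.add_sub_cancel] at nc
    refine ⟨blks M (tw N e) cs ++ wordInv (alt e i), ?_⟩
    rw [blks_append]
    simp [blks, blk, nalt, hi, tw_succ, nc, wordInv_alt_succ]
  obtain ⟨d, hd⟩ := wb
  obtain ⟨d', hd'⟩ := wc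
  refine ⟨d, d', ?_, ?_, ?_, ?_⟩
  · rw [← hd, ← hd']
    refine .trans _ _ _ (markFirst_equiv _ _ (vb _)) (.symm _ _ ?_)
    have h := markFirst_equiv (tw N e) _ (vc true)
    rw [h1, h2] at h
    exact h
  · have h := run_blks hM 0 (tw N e) (r := []) (bs ++ [(l, false)]) (by simp) (vb _)
    rw [nb, hd] at h
    simpa [ofStack, b1, b2] using h
  · rw [← hd]
    have h := length_blks (p := l) (tw N e) (bs ++ [(l, false)]) (vb _) (by
      intro b hb
      rcases mem_append.1 hb with hb | hb
      · exact b3 b hb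
      · simp at hb
        subst hb
        simp)
    rw [← Nat.cast_inj (R := ℤ), h, ← hln]
    simp [height, b1, b2, map_reverse, sum_reverse]
    ring
  · rw [← hd']
    have h := length_blks (p := l) (tw N e) (cs ++ [(l, true)]) (vc _) (by
      intro b hb
      rcases mem_append.1 hb with hb | hb
      · exact d3 b hb
      · simp at hb
        subst hb
        simp)
    rw [← Nat.cast_inj (R := ℤ), h, h1, h2, ← hln]
    simp [height, b1, b2, map_reverse, sum_reverse]
    ring

theorem Geo.rEquiv (hM : 2 ≤ M) {c c' : Word Bool} (h : Geo M c) (h' : Geo M c')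
    (he : run M (base 0) c = run M (base 0) c') : REquiv M c c' := by
  obtain ⟨n, hn⟩ : ∃ n, c.length = n := ⟨_, rfl⟩
  induction n generalizing c c' with
  | zero =>
    have := h.length_eq hM h' he
    obtain rfl := length_eq_zero_iff.1 hn
    obtain rfl : c' = [] := length_eq_zero_iff.1 (by omega)
    exact .refl _
  | succ n ih =>
    have hl := h.length_eq hM h' he
    rcases eq_nil_or_concat' c with rfl | ⟨c, a, rfl⟩
    · simp at hn
    rcases eq_nil_or_concat' c' with rfl | ⟨c', b, rfl⟩
    · simp at hl
    have strip : ∀ {x y : Word Bool} {z}, Geo M (x ++ [z]) → Geo M (y ++ [z]) →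
        run M (base 0) (x ++ [z]) = run M (base 0) (y ++ [z]) → (x ++ [z]).length = n + 1 →
        REquiv M (x ++ [z]) (y ++ [z]) := fun hx hy hxy hx' =>
      (ih (hx.of_append hM) (hy.of_append hM) (run_cancel hM hxy) (by simpa using hx')).append_right _
    by_cases hab : a = b
    · subst hab
      exact strip h h' he hn
    · have hq := valid_run hM (c ++ [a]) (valid_base 0)
      have hmax := h.maxHeight hM
      have hcases : ∀ p ≤ M, height M p (run M (base 0) (c ++ [a])) = (c ++ [a]).length → _ :=
        fun p hp hpn => isEnd_cases hM hp hq hab (isEnd_concat hM hp hpn)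
          (by
            rw [he]
            exact isEnd_concat hM hp (by rw [← he, hpn, hl]))
      have key : ∃ d d', REquiv M (d ++ [a]) (d' ++ [b]) ∧
          run M (base 0) (d ++ [a]) = run M (base 0) (c ++ [a]) ∧
          (d ++ [a]).length = (c ++ [a]).length ∧ (d' ++ [b]).length = (c ++ [a]).length := by
        obtain ⟨p, hp, hpn⟩ := h
        rcases hcases p hp hpn with ⟨x, ha, hb, -⟩ | ⟨x, ha, hb, -⟩ | ⟨k, e, r, hq', hx⟩
        · rw [ha, hb] at hcases ⊢
          refine ends_pos hM (by simpa [ha] using hq) (by simpa [ha] using hmax) x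
            fun p hp hpn => ?_
          rcases hcases p hp hpn with ⟨_, -, -, h⟩ | ⟨y, h, -⟩ | ⟨_, _, _, -, h⟩
          · exact h
          · simp at h
          · simp at h
        · rw [ha, hb] at hcases ⊢
          refine ends_neg hM (by simpa [ha] using hq) (by simpa [ha] using hmax) x
            fun p hp hpn => ?_
          rcases hcases p hp hpn with ⟨y, h, -⟩ | ⟨_, -, -, h⟩ | ⟨_, _, _, -, h⟩
          · simp at h
          · exact h
          · simp at h
        · have hm : ∀ p' ≤ M, height M p' (run M (base 0) (c ++ [a])) = (c ++ [a]).length →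
              p' = p := by
            intro p' hp' hpn'
            rcases hcases p' hp' hpn' with ⟨y, h, h', -⟩ | ⟨y, h, h', -⟩ | ⟨_, _, _, h, -⟩
            · rcases hx with ⟨hx, hx'⟩ | ⟨hx, hx'⟩
              · rw [hx'] at h'; simp at h'
              · rw [hx] at h; simp at h
            · rcases hx with ⟨hx, hx'⟩ | ⟨hx, hx'⟩
              · rw [hx] at h; simp at h
              · rw [hx'] at h'; simp at h'
            · rw [hq'] at h
              simp at h
              exact h.2.2.1.symm
          rw [hq'] at hm hmax hq ⊢
          obtain ⟨d, d', h1, h2, h3, h4⟩ := ends_mixed hM hq hmax hm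
          rcases hx with ⟨rfl, rfl⟩ | ⟨rfl, rfl⟩
          · exact ⟨d, d', h1, h2, h3, h4⟩
          · exact ⟨d', d, .symm _ _ h1, h1.run_eq hM (valid_base 0) ▸ h2, h4, h3⟩
      obtain ⟨d, d', h1, h2, h3, h5⟩ := key
      have g1 : Geo M (d ++ [a]) := h.of_length_eq h2.symm h3.symm
      have h4 := h1.run_eq hM (valid_base 0)
      have g2 : Geo M (d' ++ [b]) := g1.of_length_eq h4 (by rw [h3, h5])
      exact .trans _ _ _ (strip h g1 h2.symm hn)
        (.trans _ _ _ h1 (.symm _ _ (strip h' g2 (by rw [← he, ← h2, h4]) (by omega))))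

end DState

namespace DState

variable {M : ℕ}

/-! ### Geodesics over two generators ending with a power -/

theorem Geo.not_cancel (hM : 2 ≤ M) {x : Word Bool} {a : Bool × Bool}
    (h : Geo M (x ++ [a, bar a])) : False := by
  have h' : Geo M ((x ++ [a]) ++ [bar a]) := by simpa using h
  exact h'.concat_not hM (c' := x) (by simpa using h'.of_append hM) (by simp)

theorem Geo.eq_replicate (hM : 2 ≤ M) {x v : Word Bool} {s : Bool} (h : Geo M (x ++ v))
    (hv : ∀ a ∈ v, a.1 = s) : ∃ τ, v = replicate v.length (s, τ) := by
  induction v using List.reverseRecOn with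
  | nil => exact ⟨true, rfl⟩
  | append_singleton v a ih =>
    rw [← append_assoc] at h
    obtain ⟨τ, hτ⟩ := ih (h.of_append hM) fun b hb => hv b (by simp [hb])
    obtain ⟨b, σ⟩ := a
    obtain rfl : b = s := hv (b, σ) (by simp)
    rcases hn : v.length with _ | n
    · obtain rfl := length_eq_zero_iff.1 hn
      exact ⟨σ, rfl⟩
    · refine ⟨τ, ?_⟩
      rw [hn, replicate_succ'] at hτ
      by_cases hs : σ = τ
      · subst hs
        rw [length_append, length_singleton, replicate_succ', hn, replicate_succ', hτ]
      · obtain rfl := eq_not_of_ne hs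
        exact (Geo.not_cancel hM (x := x ++ replicate n (b, τ)) (a := (b, τ))
          (by simpa [hτ, bar] using h)).elim

theorem height_run_replicate {p : ℕ} (P : DState → Prop) (a : Bool × Bool)
    (hP : ∀ q, P q → P (act M q a) ∧ height M p (act M q a) = height M p q + 1)
    (j : ℕ) {q : DState} (hq : P q) :
    P (run M q (replicate j a)) ∧
      height M p (run M q (replicate j a)) = height M p q + j := by
  induction j generalizing q with
  | zero => simpa using hq
  | succ j ih =>
    obtain ⟨h1, h2⟩ := hP q hq
    obtain ⟨h3, h4⟩ := ih h1
    refine ⟨by simpa [replicate_succ] using h3, ?_⟩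
    rw [replicate_succ, run_cons, h4, h2]
    push_cast
    ring

theorem height_run_replicate_pos {p : ℕ} (hp : 1 ≤ p) (s : Bool) (j : ℕ) (k : ℤ) (l : ℕ)
    (r : List ℕ) : height M p (run M (node k s l r) (replicate j (s, true))) =
      height M p (node k s l r) + j := by
  refine (height_run_replicate (fun q => ∃ k l r, q = node k s l r) (s, true) ?_ j
    ⟨k, l, r, rfl⟩).2
  rintro _ ⟨k, l, r, rfl⟩
  refine ⟨⟨k, 1, l :: r, by simp [act]⟩, ?_⟩
  rw [height_node_pos_same, if_pos hp]

theorem height_run_replicate_neg (hM : 2 ≤ M) {p : ℕ} (hp : p < M) (s : Bool) (j : ℕ) (k : ℤ)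
    (l : ℕ) (r : List ℕ) : height M p (run M (node k (!s) l r) (replicate j (s, false))) =
      height M p (node k (!s) l r) + j := by
  refine (height_run_replicate (fun q => ∃ k l r, q = node k (!s) l r) (s, false) ?_ j
    ⟨k, l, r, rfl⟩).2
  rintro _ ⟨k, l, r, rfl⟩
  refine ⟨⟨k - 1, M - 1, l :: r, by simp [act]⟩, ?_⟩
  have := height_node_neg_ne hM hp.le k (!s) l r
  rw [Bool.not_not, if_pos hp] at this
  exact this

/-- A power of a positive letter leads to a state with a last factor of length `1`. -/
theorem run_replicate_pos {p : ℕ} (hp : 1 ≤ p) (t : Bool) (i : ℕ) :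
    (∃ k r, run M (base 0) (replicate (i + 1) (t, true)) = node k t 1 r) ∧
      height M p (run M (base 0) (replicate (i + 1) (t, true))) = i + 1 := by
  have h := height_run_replicate (M := M) (p := p) (fun q => ∃ k r, q = node k t 1 r) (t, true)
    (by
      rintro _ ⟨k, r, rfl⟩
      refine ⟨⟨k, 1 :: r, by simp [act]⟩, ?_⟩
      rw [height_node_pos_same, if_pos hp]) i (q := node 0 t 1 []) ⟨0, [], rfl⟩
  rw [replicate_succ, run_cons, show act M (base 0) (t, true) = node 0 t 1 [] from rfl]
  refine ⟨h.1, ?_⟩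
  rw [h.2]
  have := height_base_pos (M := M) p 0 t
  rw [height_base_zero, if_pos hp] at this
  change height M p (node 0 t 1 []) = _ at this
  omega

/-- A power of a negative letter leads to a state with a last factor of length `M - 1`. -/
theorem run_replicate_neg (hM : 2 ≤ M) {p : ℕ} (hp : p < M) (t : Bool) (i : ℕ) :
    (∃ k r, run M (base 0) (replicate (i + 1) (t, false)) = node k (!t) (M - 1) r) ∧
      height M p (run M (base 0) (replicate (i + 1) (t, false))) = i + 1 := by
  have h := height_run_replicate (M := M) (p := p) (fun q => ∃ k r, q = node k (!t) (M - 1) r)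
    (t, false)
    (by
      rintro _ ⟨k, r, rfl⟩
      refine ⟨⟨k - 1, (M - 1) :: r, by simp [act]⟩, ?_⟩
      have := height_node_neg_ne hM hp.le k (!t) (M - 1) r
      rwa [Bool.not_not, if_pos hp] at this) i (q := node (0 - 1) (!t) (M - 1) []) ⟨_, [], rfl⟩
  rw [replicate_succ, run_cons,
    show act M (base 0) (t, false) = node (0 - 1) (!t) (M - 1) [] from rfl]
  refine ⟨h.1, ?_⟩
  rw [h.2]
  have := height_base_neg hM hp.le 0 t
  rw [height_base_zero, if_pos hp] at this
  change height M p (node (0 - 1) (!t) (M - 1) []) = _ at this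
  omega

theorem exists_height_powers (hM : 3 ≤ M) (s : Bool) (σ τ : Bool) (i j : ℕ) :
    ∃ p, p + 1 ≤ M ∧ ∀ p', p' = p ∨ p' = p + 1 →
      height M p' (run M (base 0) (replicate i (!s, σ) ++ replicate (j + 1) (s, τ))) =
        i + (j + 1) := by
  have hM2 : 2 ≤ M := by omega
  rcases i with _ | i
  · cases τ
    · refine ⟨0, by omega, fun p' hp' => ?_⟩
      simpa using (run_replicate_neg hM2 (p := p') (by omega) s j).2
    · refine ⟨1, by omega, fun p' hp' => ?_⟩
      simpa using (run_replicate_pos (M := M) (p := p') (by omega) s j).2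
  cases σ <;> cases τ
  · refine ⟨0, by omega, fun p' hp' => ?_⟩
    obtain ⟨⟨k, r, h1⟩, h2⟩ := run_replicate_neg hM2 (p := p') (by omega) (!s) i
    rw [Bool.not_not] at h1
    rw [h1] at h2
    have h3 := height_node_neg_same (M := M) (p := p') k s (l := M - 1) (by omega) r
    have h4 : act M (node k s (M - 1) r) (s, false) = node k (!s) (M - 1 - 1) r := by
      simp only [act, if_true]
      rw [if_pos (by omega)]
    rw [if_pos (by omega), h4] at h3
    rw [run_append, h1, replicate_succ, run_cons, h4,
      height_run_replicate_neg hM2 (by omega), h3, h2]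
    push_cast
    ring
  · refine ⟨1, by omega, fun p' hp' => ?_⟩
    obtain ⟨⟨k, r, h1⟩, h2⟩ := run_replicate_neg hM2 (p := p') (by omega) (!s) i
    rw [Bool.not_not] at h1
    rw [h1] at h2
    rw [run_append, h1, height_run_replicate_pos (by omega), h2]
    push_cast
    ring
  · refine ⟨1, by omega, fun p' hp' => ?_⟩
    obtain ⟨⟨k, r, h1⟩, h2⟩ := run_replicate_pos (M := M) (p := p') (by omega) (!s) i
    rw [h1] at h2
    rw [run_append, h1, height_run_replicate_neg hM2 (by omega), h2]
    push_cast
    ring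
  · refine ⟨2, by omega, fun p' hp' => ?_⟩
    obtain ⟨⟨k, r, h1⟩, h2⟩ := run_replicate_pos (M := M) (p := p') (by omega) (!s) i
    rw [h1] at h2
    have h3 := height_node_pos_ne (M := M) (p := p') (by omega) k (!s) (l := 1) (by omega) r
    have h4 : act M (node k (!s) 1 r) (s, true) = node k s 2 r := by
      simp only [act]
      rw [if_neg (by cases s <;> simp), if_pos (by omega)]
    rw [if_pos (by omega), Bool.not_not, h4] at h3
    rw [run_append, h1, replicate_succ, run_cons, h4,
      height_run_replicate_pos (by omega), h3, h2]
    push_cast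
    ring

/-- A geodesic which is a power of one generator followed by a non-trivial power of the other
one has only one possible last letter. -/
theorem Geo.last_eq_of_powers (hM : 3 ≤ M) {u v c' : Word Bool} {a b : Bool × Bool}
    (h : Geo M (u ++ v ++ [a])) (hu : ∀ x ∈ u, x.1 = !a.1) (hv : ∀ x ∈ v, x.1 = a.1)
    (h' : Geo M (c' ++ [b]))
    (he : run M (base 0) (u ++ v ++ [a]) = run M (base 0) (c' ++ [b])) : a = b := by
  have hM2 : 2 ≤ M := by omega
  have h0 : Geo M ([] ++ u) := by
    rw [append_assoc] at h
    exact h.of_append hM2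
  obtain ⟨σ, hσ⟩ := h0.eq_replicate hM2 hu
  have h1 : Geo M (u ++ (v ++ [a])) := by rwa [← append_assoc]
  obtain ⟨τ, hτ⟩ := h1.eq_replicate hM2 (s := a.1) (by
    intro x hx
    rcases mem_append.1 hx with hx | hx
    · exact hv x hx
    · rw [mem_singleton.1 hx])
  obtain ⟨p, hp, hh⟩ := exists_height_powers hM a.1 σ τ u.length v.length
  have h2 : replicate u.length (!a.1, σ) ++ replicate (v.length + 1) (a.1, τ) =
      u ++ v ++ [a] := by
    rw [← hσ, append_assoc]
    conv_rhs => rw [hτ]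
    simp
  rw [h2] at hh
  have hl : ((u ++ v ++ [a]).length : ℤ) = u.length + (v.length + 1) := by simp
  exact Geo.last_eq hM2 hp (by rw [hh p (.inl rfl), hl]) (by rw [hh _ (.inr rfl), hl]) h' he

end DState

/-! ### Renaming generators -/

/-- Exchange of the two generators. -/
def flip (c : Word Bool) : Word Bool := c.map fun a => (!a.1, a.2)

/-- The word obtained by writing `s` for `true` and `t` for `false`. -/
def emb {S : Type*} (s t : S) (c : Word Bool) : Word S :=
  c.map fun a => (if a.1 then s else t, a.2)

namespace DState

variable {M : ℕ}

/-- Exchange of the two generators in a normal form. -/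
def flip : DState → DState
  | base k => base k
  | node k e l r => node k (!e) l r

theorem flip_act (q : DState) (a : Bool × Bool) :
    (act M q a).flip = act M q.flip (!a.1, a.2) := by
  obtain ⟨b, σ⟩ := a
  rcases q with k | ⟨k, e, l, r⟩
  · cases σ <;> simp [act, flip]
  · cases σ
    · by_cases hb : b = e
      · by_cases hl : 1 < l
        · simp [act, flip, hb, hl]
        · cases r <;> simp [act, flip, hb, hl, ofStack]
      · simp [act, flip, hb]
    · by_cases hb : b = e
      · simp [act, flip, hb]
      · by_cases hl : l + 1 < M
        · simp [act, flip, hb, hl]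
        · cases r <;> simp [act, flip, hb, hl, ofStack]

theorem flip_run (q : DState) (c : Word Bool) :
    (run M q c).flip = run M q.flip (ArtinTits.flip c) := by
  induction c generalizing q with
  | nil => rfl
  | cons a c ih =>
    rw [run_cons, ih, flip_act]
    rfl

theorem height_flip (p : ℕ) (q : DState) : height M p q.flip = height M p q := by
  cases q <;> rfl

theorem Geo.flip {c : Word Bool} (h : Geo M c) : Geo M (ArtinTits.flip c) := by
  obtain ⟨p, hp, h⟩ := h
  refine ⟨p, hp, ?_⟩
  have := flip_run (M := M) (base 0) c
  rw [DState.flip] at this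
  rw [← this, height_flip, h]
  simp [ArtinTits.flip]

theorem run_flip_eq {c c' : Word Bool} (h : run M (base 0) c = run M (base 0) c') :
    run M (base 0) (ArtinTits.flip c) = run M (base 0) (ArtinTits.flip c') := by
  have h1 := flip_run (M := M) (base 0) c
  have h2 := flip_run (M := M) (base 0) c'
  rw [DState.flip] at h1 h2
  rw [← h1, ← h2, h]

end DState

section Emb

variable {S : Type*} {s t : S}

theorem emb_flip (c : Word Bool) : emb s t (flip c) = emb t s c := by
  simp only [emb, flip, map_map]
  congr 1
  funext a
  obtain ⟨b, σ⟩ := a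
  cases b <;> rfl

theorem emb_append (c d : Word Bool) : emb s t (c ++ d) = emb s t c ++ emb s t d := by
  simp [emb]

theorem length_emb (c : Word Bool) : (emb s t c).length = c.length := by simp [emb]

theorem emb_injective (h : s ≠ t) : Function.Injective (emb s t) := by
  apply map_injective_iff.2
  rintro ⟨b, σ⟩ ⟨b', σ'⟩ h'
  cases b <;> cases b' <;> simp_all [eq_comm]

theorem emb_eq_append {c : Word Bool} {x y : Word S} (h : emb s t c = x ++ y) :
    ∃ c₁ c₂, c = c₁ ++ c₂ ∧ x = emb s t c₁ ∧ y = emb s t c₂ := by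
  obtain ⟨c₁, c₂, h1, h2, h3⟩ := map_eq_append_iff.1 h
  exact ⟨c₁, c₂, h1, h2.symm, h3.symm⟩

theorem emb_eq_concat {c : Word Bool} {x : Word S} {a : S × Bool} (h : emb s t c = x ++ [a]) :
    ∃ c₁ b, c = c₁ ++ [b] ∧ x = emb s t c₁ ∧ a = (if b.1 then s else t, b.2) := by
  obtain ⟨c₁, c₂, h1, h2, h3⟩ := emb_eq_append h
  obtain ⟨b, rfl, h4⟩ : ∃ b, c₂ = [b] ∧ a = (if b.1 then s else t, b.2) := by
    rcases c₂ with _ | ⟨b, _ | ⟨b', c₂⟩⟩ <;> simp_all [emb]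
  exact ⟨c₁, b, h1, h2, h4⟩

theorem fst_of_mem_emb {c : Word Bool} {a : S × Bool} (h : a ∈ emb s t c) :
    a.1 = s ∨ a.1 = t := by
  obtain ⟨⟨b, σ⟩, -, rfl⟩ := mem_map.1 h
  cases b <;> simp

theorem exists_emb_eq (w : Word S) (h : ∀ a ∈ w, a.1 = s ∨ a.1 = t) :
    ∃ c, w = emb s t c := by
  induction w with
  | nil => exact ⟨[], rfl⟩
  | cons a w ih =>
    obtain ⟨c, rfl⟩ := ih fun b hb => h b (by simp [hb])
    obtain ⟨x, σ⟩ := a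
    rcases h (x, σ) (by simp) with h1 | h1
    · exact ⟨(true, σ) :: c, by simp [emb, ← h1]⟩
    · by_cases h2 : x = s
      · exact ⟨(true, σ) :: c, by simp [emb, ← h2]⟩
      · exact ⟨(false, σ) :: c, by simp [emb, ← h1]⟩

theorem emb_alt (b : Bool) (j : ℕ) :
    emb s t (alt b j) = altWord (if b then s else t) (if b then t else s) j := by
  induction j generalizing b with
  | zero => rfl
  | succ j ih =>
    rw [alt_succ, altWord]
    have : emb s t ((b, true) :: alt (!b) j) =
      (if b then s else t, true) :: emb s t (alt (!b) j) := rfl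
    rw [this, ih]
    cases b <;> rfl

theorem emb_wordInv (c : Word Bool) : emb s t (wordInv c) = wordInv (emb s t c) := by
  simp [emb, wordInv, map_reverse, Function.comp_def]

end Emb

section Relations

open DState

variable {S : Type*} {A : ArtinData S} {s t : S}

/-- Two words over `{s, t}` with the same image in the dihedral group generated by `s, t`. -/
def ERel (A : ArtinData S) (s t : S) (c c' : Word S) : Prop :=
  s ≠ t ∧ ∃ (M : ℕ) (d d' : Word Bool), A.m s t = M ∧ c = emb s t d ∧ c' = emb s t d' ∧
    run M (base 0) d = run M (base 0) d'

/-- Two geodesic words over `{s, t}` with the same image in the dihedral group generated by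
`s, t`. -/
def DRel (A : ArtinData S) (s t : S) (c c' : Word S) : Prop :=
  s ≠ t ∧ ∃ (M : ℕ) (d d' : Word Bool), A.m s t = M ∧ c = emb s t d ∧ c' = emb s t d' ∧
    Geo M d ∧ Geo M d' ∧ run M (base 0) d = run M (base 0) d'

theorem label_two_le (hs : s ≠ t) {M : ℕ} (h : A.m s t = M) : 2 ≤ M := by
  have := A.two_le s t hs
  rw [h] at this
  exact_mod_cast this

theorem DRel.erel {c c' : Word S} (h : DRel A s t c c') : ERel A s t c c' := by
  obtain ⟨hs, M, d, d', hm, hc, hc', -, -, he⟩ := h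
  exact ⟨hs, M, d, d', hm, hc, hc', he⟩

theorem DRel.ne {c c' : Word S} (h : DRel A s t c c') : s ≠ t := h.1

/-- The data of `DRel` for words in given form. -/
theorem DRel.emb_iff (hs : s ≠ t) {M : ℕ} (hm : A.m s t = M) {d d' : Word Bool} :
    DRel A s t (emb s t d) (emb s t d') ↔
      Geo M d ∧ Geo M d' ∧ run M (base 0) d = run M (base 0) d' := by
  constructor
  · rintro ⟨-, M', d₁, d₁', hm', h1, h2, h⟩
    obtain rfl := emb_injective hs h1
    obtain rfl := emb_injective hs h2
    obtain rfl : M = M' := by rw [hm] at hm'; exact_mod_cast hm'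
    exact h
  · rintro h
    exact ⟨hs, M, d, d', hm, rfl, rfl, h⟩

theorem ERel.emb_iff (hs : s ≠ t) {M : ℕ} (hm : A.m s t = M) {d d' : Word Bool} :
    ERel A s t (emb s t d) (emb s t d') ↔ run M (base 0) d = run M (base 0) d' := by
  constructor
  · rintro ⟨-, M', d₁, d₁', hm', h1, h2, h⟩
    obtain rfl := emb_injective hs h1
    obtain rfl := emb_injective hs h2
    obtain rfl : M = M' := by rw [hm] at hm'; exact_mod_cast hm'
    exact h
  · rintro h
    exact ⟨hs, M, d, d', hm, rfl, rfl, h⟩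

theorem DRel.symm {c c' : Word S} (h : DRel A s t c c') : DRel A s t c' c := by
  obtain ⟨hs, M, d, d', hm, hc, hc', hg, hg', he⟩ := h
  exact ⟨hs, M, d', d, hm, hc', hc, hg', hg, he.symm⟩

theorem DRel.trans {c c' c'' : Word S} (h : DRel A s t c c') (h' : DRel A s t c' c'') :
    DRel A s t c c'' := by
  obtain ⟨hs, M, d, d', hm, rfl, rfl, hg, hg', he⟩ := h
  obtain ⟨-, M', d₁, d'', hm', h1, rfl, -, hg'', he'⟩ := h'
  obtain rfl := emb_injective hs h1
  obtain rfl : M = M' := by rw [hm] at hm'; exact_mod_cast hm'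
  exact ⟨hs, M, d, d'', hm, rfl, rfl, hg, hg'', he.trans he'⟩

theorem ERel.symm {c c' : Word S} (h : ERel A s t c c') : ERel A s t c' c := by
  obtain ⟨hs, M, d, d', hm, hc, hc', he⟩ := h
  exact ⟨hs, M, d', d, hm, hc', hc, he.symm⟩

theorem ERel.trans {c c' c'' : Word S} (h : ERel A s t c c') (h' : ERel A s t c' c'') :
    ERel A s t c c'' := by
  obtain ⟨hs, M, d, d', hm, rfl, rfl, he⟩ := h
  obtain ⟨-, M', d₁, d'', hm', h1, rfl, he'⟩ := h'
  obtain rfl := emb_injective hs h1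
  obtain rfl : M = M' := by rw [hm] at hm'; exact_mod_cast hm'
  exact ⟨hs, M, d, d'', hm, rfl, rfl, he.trans he'⟩

theorem DRel.refl_left {c c' : Word S} (h : DRel A s t c c') : DRel A s t c c :=
  h.trans h.symm

theorem DRel.refl_right {c c' : Word S} (h : DRel A s t c c') : DRel A s t c' c' :=
  h.symm.trans h

theorem DRel.flip {c c' : Word S} (h : DRel A s t c c') : DRel A t s c c' := by
  obtain ⟨hs, M, d, d', hm, rfl, rfl, hg, hg', he⟩ := h
  exact ⟨hs.symm, M, _, _, by rw [A.symm, hm], (emb_flip d).symm, (emb_flip d').symm,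
    hg.flip, hg'.flip, run_flip_eq he⟩

theorem DRel.length_eq {c c' : Word S} (h : DRel A s t c c') : c.length = c'.length := by
  obtain ⟨hs, M, d, d', hm, rfl, rfl, hg, hg', he⟩ := h
  rw [length_emb, length_emb, hg.length_eq (label_two_le hs hm) hg' he]

theorem DRel.fst_of_mem {c c' : Word S} (h : DRel A s t c c') {a : S × Bool} (ha : a ∈ c) :
    a.1 = s ∨ a.1 = t := by
  obtain ⟨hs, M, d, d', hm, rfl, rfl, hg, hg', he⟩ := h
  exact fst_of_mem_emb ha

theorem ERel.of_eq {c c' : Word S} (h : ERel A s t c c') (hc : DRel A s t c c)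
    (hc' : DRel A s t c' c') : DRel A s t c c' := by
  obtain ⟨hs, M, d, d', hm, rfl, rfl, he⟩ := h
  exact (DRel.emb_iff hs hm).2 ⟨((DRel.emb_iff hs hm).1 hc).1, ((DRel.emb_iff hs hm).1 hc').1, he⟩

theorem DRel.of_append {c d : Word S} (h : DRel A s t (c ++ d) (c ++ d)) : DRel A s t c c := by
  obtain ⟨hs, M, e, e', hm, h1, -, hg, -, -⟩ := h
  obtain ⟨e₁, e₂, rfl, rfl, rfl⟩ := emb_eq_append h1.symm
  exact (DRel.emb_iff hs hm).2 ⟨hg.of_append (label_two_le hs hm), hg.of_append (label_two_le hs hm), rfl⟩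

theorem DRel.cancel {c c' : Word S} {a : S × Bool} (h : DRel A s t (c ++ [a]) (c' ++ [a])) :
    DRel A s t c c' := by
  obtain ⟨hs, M, e, e', hm, h1, h2, hg, hg', he⟩ := h
  have hM := label_two_le hs hm
  obtain ⟨d, x, rfl, rfl, hx⟩ := emb_eq_concat h1.symm
  obtain ⟨d', y, rfl, rfl, hy⟩ := emb_eq_concat h2.symm
  obtain rfl : x = y := by
    have : emb s t [x] = emb s t [y] := by simp [emb, ← hx, ← hy]
    simpa using emb_injective hs this
  exact (DRel.emb_iff hs hm).2 ⟨hg.of_append hM, hg'.of_append hM, run_cancel hM he⟩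

theorem DState.Geo.last_eq_of_fst {M : ℕ} (hM : 2 ≤ M) {c c' : Word Bool} {a b : Bool × Bool}
    (h : Geo M (c ++ [a])) (h' : Geo M (c' ++ [b]))
    (he : run M (base 0) (c ++ [a]) = run M (base 0) (c' ++ [b])) (hab : a.1 = b.1) : a = b := by
  by_contra hne
  have hb : b = bar a := by
    obtain ⟨x, σ⟩ := a
    obtain ⟨y, τ⟩ := b
    simp only at hab
    subst hab
    simp only [bar, Prod.mk.injEq, true_and]
    apply eq_not_of_ne
    rintro rfl
    exact hne rfl
  obtain ⟨p, hp, hh⟩ := h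
  have hl := Geo.length_eq hM (c := c ++ [a]) ⟨p, hp, hh⟩ h' he
  have e1 := isEnd_concat hM hp hh
  have e2 := isEnd_concat hM hp (c := c') (a := b) (by rw [← he, hh, hl])
  rw [← he] at e2
  subst hb
  unfold IsEnd at e1 e2
  have hq := valid_run hM (c ++ [a]) (valid_base 0)
  obtain ⟨x, σ⟩ := a
  have h3 := not_both_down hM hp hq x
  cases σ
  · have := h3 (by simpa [bar] using e1)
    simp only [bar, Bool.not_false, Bool.not_true] at e2
    omega
  · have := h3 (by simpa [bar] using e2)
    simp only [bar, Bool.not_true] at e1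
    omega

theorem DRel.last_eq_of_fst {c c' : Word S} {a b : S × Bool}
    (h : DRel A s t (c ++ [a]) (c' ++ [b])) (hab : a.1 = b.1) : a = b := by
  obtain ⟨hs, M, e, e', hm, h1, h2, hg, hg', he⟩ := h
  have hM := label_two_le hs hm
  obtain ⟨d, x, rfl, rfl, rfl⟩ := emb_eq_concat h1.symm
  obtain ⟨d', y, rfl, rfl, rfl⟩ := emb_eq_concat h2.symm
  have hxy : x.1 = y.1 := by
    simp only at hab
    split_ifs at hab <;> simp_all
  rw [Geo.last_eq_of_fst hM hg hg' he hxy]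

theorem DRel.congr {c c' k q : Word S} (h : DRel A s t c c')
    (hk : DRel A s t (k ++ c ++ q) (k ++ c ++ q)) :
    DRel A s t (k ++ c ++ q) (k ++ c' ++ q) := by
  obtain ⟨hs, M, d, d', hm, rfl, rfl, hg, hg', he⟩ := h
  have hM := label_two_le hs hm
  have hk0 := hk
  obtain ⟨-, -, e, -, -, h1, -⟩ := hk
  obtain ⟨e₁, e₃, rfl, h2, rfl⟩ := emb_eq_append h1.symm
  obtain ⟨e₁, e₂, rfl, rfl, h3⟩ := emb_eq_append h2.symm
  obtain rfl := emb_injective hs h3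
  rw [← emb_append, ← emb_append] at hk0 ⊢
  rw [← emb_append, ← emb_append]
  obtain ⟨hg1, -, -⟩ := (DRel.emb_iff hs hm).1 hk0
  have h4 : run M (base 0) (e₁ ++ d ++ e₃) = run M (base 0) (e₁ ++ d' ++ e₃) :=
    (((hg.rEquiv hM hg' he).append_left e₁).append_right e₃).run_eq hM (valid_base 0)
  refine (DRel.emb_iff hs hm).2 ⟨hg1, hg1.of_length_eq h4 ?_, h4⟩
  simp [hg.length_eq hM hg' he]

theorem DRel.concat_or {c : Word S} (h : DRel A s t c c) {a : S × Bool}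
    (ha : a.1 = s ∨ a.1 = t) :
    DRel A s t (c ++ [a]) (c ++ [a]) ∨ ∃ c', DRel A s t (c' ++ [bar a]) c := by
  obtain ⟨hs, M, d, -, hm, rfl, -, hg, -, -⟩ := h
  have hM := label_two_le hs hm
  obtain ⟨x, hx⟩ := exists_emb_eq (s := s) (t := t) [a] (by simpa using ha)
  obtain ⟨_, x, rfl, h1, rfl⟩ := emb_eq_concat (x := []) (a := a) hx.symm
  rw [emb, eq_comm, map_eq_nil_iff] at h1
  subst h1
  rw [hx, ← emb_append]
  rcases hg.concat_or hM x with h | ⟨c', h, h'⟩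
  · exact .inl ((DRel.emb_iff hs hm).2 ⟨h, h, rfl⟩)
  · right
    refine ⟨emb s t c', ?_⟩
    have : emb s t c' ++ [bar (if x.1 then s else t, x.2)] = emb s t (c' ++ [bar x]) := by
      rw [emb_append]; rfl
    rw [this]
    exact (DRel.emb_iff hs hm).2 ⟨h, hg, h'⟩

theorem DRel.concat_not {c c' : Word S} {a : S × Bool}
    (h : DRel A s t (c ++ [a]) (c ++ [a])) (h' : DRel A s t (c' ++ [bar a]) c) : False := by
  obtain ⟨hs, M, e, -, hm, h1, -, hg, -, -⟩ := h
  have hM := label_two_le hs hm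
  obtain ⟨d, x, rfl, rfl, rfl⟩ := emb_eq_concat h1.symm
  have h0 := h'
  obtain ⟨-, -, e', -, -, h2, -⟩ := h'
  obtain ⟨d', y, rfl, rfl, h3⟩ := emb_eq_concat h2.symm
  obtain rfl : y = bar x := by
    have : emb s t [y] = emb s t [bar x] := by
      simp only [emb, map_cons, map_nil, ← h3]; rfl
    simpa using emb_injective hs this
  rw [h2] at h0
  obtain ⟨hg', -, he⟩ := (DRel.emb_iff hs hm).1 h0
  exact hg.concat_not hM hg' he

theorem DRel.last_eq_of_powers (hlarge : ∀ s t : S, s ≠ t → 3 ≤ A.m s t)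
    {u v c' : Word S} {a b : S × Bool} (h : DRel A s t (u ++ v ++ [a]) (c' ++ [b]))
    (hu : ∀ x ∈ u, x.1 ≠ a.1) (hv : ∀ x ∈ v, x.1 = a.1) : a = b := by
  obtain ⟨hs, M, e, e', hm, h1, h2, hg, hg', he⟩ := h
  have hM : 3 ≤ M := by
    have := hlarge s t hs
    rw [hm] at this
    exact_mod_cast this
  obtain ⟨d, x, rfl, h3, rfl⟩ := emb_eq_concat h1.symm
  obtain ⟨d₁, d₂, rfl, rfl, rfl⟩ := emb_eq_append h3.symm
  obtain ⟨d', y, rfl, rfl, rfl⟩ := emb_eq_concat h2.symm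
  have := Geo.last_eq_of_powers hM hg (fun z hz => ?_) (fun z hz => ?_) hg' he
  · rw [this]
  · have := hu _ (mem_map_of_mem hz)
    apply eq_not_of_ne
    intro h
    simp [h] at this
  · have := hv _ (mem_map_of_mem hz)
    simp only at this
    split_ifs at this <;> simp_all

theorem DRel.nil (hs : s ≠ t) {M : ℕ} (hm : A.m s t = M) : DRel A s t [] [] :=
  (DRel.emb_iff (d := []) (d' := []) hs hm).2 ⟨geo_nil, geo_nil, rfl⟩

theorem exists_drel (hs : s ≠ t) {M : ℕ} (hm : A.m s t = M) {w : Word S}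
    (hw : ∀ a ∈ w, a.1 = s ∨ a.1 = t) : ∃ c, DRel A s t c c ∧ ERel A s t c w := by
  obtain ⟨d, rfl⟩ := exists_emb_eq w hw
  obtain ⟨c, hc, he⟩ := exists_geo_word (label_two_le hs hm) d
  exact ⟨emb s t c, (DRel.emb_iff hs hm).2 ⟨hc, hc, rfl⟩, (ERel.emb_iff hs hm).2 he⟩

theorem ERel.append_right {c c' : Word S} (h : ERel A s t c c') {a : S × Bool}
    (ha : a.1 = s ∨ a.1 = t) : ERel A s t (c ++ [a]) (c' ++ [a]) := by
  obtain ⟨hs, M, d, d', hm, rfl, rfl, he⟩ := h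
  obtain ⟨x, hx⟩ := exists_emb_eq (s := s) (t := t) [a] (by simpa using ha)
  rw [hx, ← emb_append, ← emb_append]
  exact (ERel.emb_iff hs hm).2 (by rw [run_append, run_append, he])

theorem ERel.braid (hs : s ≠ t) {M : ℕ} (hm : A.m s t = M) {k : Word S}
    (hk : ∀ a ∈ k, a.1 = s ∨ a.1 = t) :
    ERel A s t (k ++ altWord s t M) (k ++ altWord t s M) := by
  obtain ⟨d, rfl⟩ := exists_emb_eq k hk
  have hM := label_two_le hs hm
  have h1 := emb_alt (s := s) (t := t) true M
  have h2 := emb_alt (s := s) (t := t) false M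
  simp only [if_true, Bool.false_eq_true, if_false] at h1 h2
  rw [← h1, ← h2, ← emb_append, ← emb_append, ERel.emb_iff hs hm, run_append, run_append,
    run_alt_top hM (valid_run hM d (valid_base 0)), run_alt_top hM (valid_run hM d (valid_base 0))]

theorem ERel.concat_bar (hs : s ≠ t) {M : ℕ} (hm : A.m s t = M) {k : Word S} {a : S × Bool}
    (hk : ∀ x ∈ k, x.1 = s ∨ x.1 = t) (ha : a.1 = s ∨ a.1 = t) :
    ERel A s t (k ++ [a, bar a]) k := by
  obtain ⟨d, rfl⟩ := exists_emb_eq k hk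
  obtain ⟨x, hx⟩ := exists_emb_eq (s := s) (t := t) [a] (by simpa using ha)
  obtain ⟨_, x, rfl, h1, rfl⟩ := emb_eq_concat (x := []) (a := a) hx.symm
  have h2 : [(if x.1 then s else t, x.2), bar (if x.1 then s else t, x.2)] =
      emb s t [x, bar x] := rfl
  rw [h2, ← emb_append, ERel.emb_iff hs hm]
  exact run_concat_bar (label_two_le hs hm) d x

end Relations

open DState

section Moves

variable {S : Type*} {A : ArtinData S} {s t : S}

/-! ### Realization by special transformations -/

theorem Steps012.congr {w w' : Word S} (h : Steps012 A w w') (x y : Word S) :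
    Steps012 A (x ++ w ++ y) (x ++ w' ++ y) := by
  refine Relation.ReflTransGen.lift (fun w => x ++ w ++ y) ?_ _ _ h
  rintro w w' (⟨w₁, w₂, s, b, rfl, rfl⟩ | ⟨w₁, w₂, u, v, hr, h⟩ | h)
  · exact .inl ⟨x ++ w₁, w₂ ++ y, s, b, by simp, by simp⟩
  · refine .inr (.inl ⟨x ++ w₁, w₂ ++ y, u, v, hr, ?_⟩)
    rcases h with ⟨rfl, rfl⟩ | ⟨rfl, rfl⟩
    · exact .inl (by simp)
    · exact .inr (by simp)
  · rcases h with ⟨w₁, w₂, u₁, u₂, v₁, v₂, hr, h1, h2, rfl, rfl⟩ |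
      ⟨w₁, w₂, u₁, u₂, v₁, v₂, hr, h1, h2, rfl, rfl⟩
    · exact .inr (.inr (.inl ⟨x ++ w₁, w₂ ++ y, u₁, u₂, v₁, v₂, hr, h1, h2, by simp, by simp⟩))
    · exact .inr (.inr (.inr ⟨x ++ w₁, w₂ ++ y, u₁, u₂, v₁, v₂, hr, h1, h2, by simp, by simp⟩))

theorem isRel_emb (hs : s ≠ t) {M : ℕ} (hm : A.m s t = M) (b : Bool) :
    IsRel A (emb s t (alt b M)) (emb s t (alt (!b) M)) := by
  rw [emb_alt, emb_alt]
  cases b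
  · exact ⟨t, s, M, hs.symm, by rw [A.symm, hm], rfl, rfl⟩
  · exact ⟨s, t, M, hs, hm, rfl, rfl⟩

theorem steps_of_core (hs : s ≠ t) {M : ℕ} (hm : A.m s t = M) {u v : Word Bool}
    (h : Core M u v) : Steps012 A (emb s t u) (emb s t v) ∧ Steps012 A (emb s t v) (emb s t u) := by
  rcases h with b | b | ⟨b, v, v', u, u', h, h', hv, hv', hu, hu'⟩
  · have h1 := isRel_emb hs hm b
    have h2 := isRel_emb hs hm (!b)
    rw [Bool.not_not] at h2
    exact ⟨.single (.inr (.inl ⟨[], [], _, _, h2, .inl (by simp)⟩)),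
      .single (.inr (.inl ⟨[], [], _, _, h1, .inl (by simp)⟩))⟩
  · have h1 := isRel_emb hs hm b
    have h2 := isRel_emb hs hm (!b)
    rw [Bool.not_not] at h2
    exact ⟨.single (.inr (.inl ⟨[], [], _, _, h2, .inr (by simp [emb_wordInv])⟩)),
      .single (.inr (.inl ⟨[], [], _, _, h1, .inr (by simp [emb_wordInv])⟩))⟩
  · have h2 := isRel_emb hs hm (!b)
    rw [Bool.not_not, ← h, ← h', emb_append, emb_append] at h2
    have key : ∀ z : Word Bool, z ≠ [] → emb s t z ≠ [] := fun z hz hz' => hz (by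
      simpa [emb] using hz')
    exact ⟨.single (.inr (.inr (.inr ⟨[], [], _, _, _, _, h2, key _ hu', key _ hv',
        by simp [emb_append, emb_wordInv], by simp [emb_append, emb_wordInv]⟩))),
      .single (.inr (.inr (.inl ⟨[], [], _, _, _, _, h2, key _ hu, key _ hv,
        by simp [emb_append, emb_wordInv], by simp [emb_append, emb_wordInv]⟩)))⟩

theorem steps_of_rEquiv (hs : s ≠ t) {M : ℕ} (hm : A.m s t = M) {u v : Word Bool}
    (h : REquiv M u v) :
    Steps012 A (emb s t u) (emb s t v) ∧ Steps012 A (emb s t v) (emb s t u) := by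
  induction h with
  | rel u v h =>
    obtain ⟨x, y, u, v, h, rfl, rfl⟩ := h
    obtain ⟨h1, h2⟩ := steps_of_core hs hm h
    simp only [emb_append]
    exact ⟨h1.congr _ _, h2.congr _ _⟩
  | refl u => exact ⟨.refl, .refl⟩
  | symm u v _ ih => exact ih.symm
  | trans u v w _ _ ih ih' => exact ⟨ih.1.trans ih'.1, ih'.2.trans ih.2⟩

theorem DRel.steps {c c' : Word S} (h : DRel A s t c c') : Steps012 A c c' := by
  obtain ⟨hs, M, d, d', hm, rfl, rfl, hg, hg', he⟩ := h
  exact (steps_of_rEquiv hs hm (hg.rEquiv (label_two_le hs hm) hg' he)).1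

/-! ### Moves between words of the same length -/

/-- Replacement of a dihedral geodesic factor by an equivalent one. -/
def Mv (A : ArtinData S) (w w' : Word S) : Prop :=
  ∃ x y c c' s t, DRel A s t c c' ∧ w = x ++ c ++ y ∧ w' = x ++ c' ++ y

/-- The congruence generated by `Mv`. -/
def Sim (A : ArtinData S) : Word S → Word S → Prop := Relation.ReflTransGen (Mv A)

theorem Mv.symm {w w' : Word S} (h : Mv A w w') : Mv A w' w := by
  obtain ⟨x, y, c, c', s, t, h, rfl, rfl⟩ := h
  exact ⟨x, y, c', c, s, t, h.symm, rfl, rfl⟩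

theorem Sim.symm {w w' : Word S} (h : Sim A w w') : Sim A w' w := by
  induction h with
  | refl => exact .refl
  | tail _ h ih => exact .head h.symm ih

theorem Sim.append {w w' z z' : Word S} (h : Sim A w w') (h' : Sim A z z') :
    Sim A (w ++ z) (w' ++ z') := by
  have h1 : Sim A (w ++ z) (w' ++ z) := by
    refine Relation.ReflTransGen.lift (fun w => w ++ z) ?_ _ _ h
    rintro w w' ⟨x, y, c, c', s, t, h, rfl, rfl⟩
    exact ⟨x, y ++ z, c, c', s, t, h, by simp, by simp⟩
  have h2 : Sim A (w' ++ z) (w' ++ z') := by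
    refine Relation.ReflTransGen.lift (fun z => w' ++ z) ?_ _ _ h'
    rintro z z' ⟨x, y, c, c', s, t, h, rfl, rfl⟩
    exact ⟨w' ++ x, y, c, c', s, t, h, by simp, by simp⟩
  exact h1.trans h2

theorem Sim.length_eq {w w' : Word S} (h : Sim A w w') : w.length = w'.length := by
  induction h with
  | refl => rfl
  | tail _ h ih =>
    obtain ⟨x, y, c, c', s, t, h, rfl, rfl⟩ := h
    rw [ih]
    simp [h.length_eq]

theorem Sim.steps {w w' : Word S} (h : Sim A w w') : Steps012 A w w' := by
  induction h with
  | refl => exact .refl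
  | tail _ h ih =>
    obtain ⟨x, y, c, c', s, t, h, rfl, rfl⟩ := h
    exact ih.trans (h.steps.congr x y)

theorem DRel.eq_of_power (hlarge : ∀ s t : S, s ≠ t → 3 ≤ A.m s t) {p : S} {d d' : Word S}
    (h : DRel A s t d d') (hd : ∀ a ∈ d, a.1 = p) : d = d' := by
  induction d using List.reverseRecOn generalizing d' with
  | nil => exact (length_eq_zero_iff.1 h.length_eq.symm).symm
  | append_singleton d a ih =>
    rcases eq_nil_or_concat' d' with rfl | ⟨d', b, rfl⟩
    · simpa using h.length_eq
    · have ha := hd a (by simp)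
      have hd' : ∀ x ∈ d, x.1 = p := fun x hx => hd x (by simp [hx])
      obtain rfl : a = b := DRel.last_eq_of_powers hlarge (u := []) (v := d) (by simpa using h)
        (by simp) (fun x hx => by rw [hd' x hx, ha])
      rw [ih h.cancel hd']

theorem DRel.mv (hlarge : ∀ s t : S, s ≠ t → 3 ≤ A.m s t) {c c' : Word S}
    (h : DRel A s t c c) (h' : Mv A c c') : DRel A s t c c' := by
  obtain ⟨x, y, d, d', p, q, hd, rfl, rfl⟩ := h'
  have hne := hd.ne
  have hmem : ∀ a ∈ d, (a.1 = s ∨ a.1 = t) ∧ (a.1 = p ∨ a.1 = q) := fun a ha =>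
    ⟨h.fst_of_mem (by simp [ha]), hd.fst_of_mem ha⟩
  by_cases h1 : s = p ∧ t = q
  · obtain ⟨rfl, rfl⟩ := h1
    exact hd.congr h
  by_cases h2 : s = q ∧ t = p
  · obtain ⟨rfl, rfl⟩ := h2
    exact hd.flip.congr h
  have h3 : ∃ r, ∀ a ∈ d, a.1 = r := by
    by_cases hp : p = s ∨ p = t
    · refine ⟨p, fun a ha => ?_⟩
      have := hmem a ha
      grind
    · refine ⟨q, fun a ha => ?_⟩
      have := hmem a ha
      grind
  obtain ⟨r, hr⟩ := h3
  rw [← hd.eq_of_power hlarge hr]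
  exact h

theorem DRel.sim (hlarge : ∀ s t : S, s ≠ t → 3 ≤ A.m s t) {c c' : Word S}
    (h : DRel A s t c c) (h' : Sim A c c') : DRel A s t c c' := by
  induction h' with
  | refl => exact h
  | tail _ h' ih => exact ih.trans (ih.refl_right.mv hlarge h')

theorem DRel.mem_of_mem {c c' : Word S} (hlarge : ∀ s t : S, s ≠ t → 3 ≤ A.m s t)
    (h : DRel A s t c c') {a : S × Bool} (ha : a ∈ c') : ∃ b ∈ c, b.1 = a.1 := by
  by_contra hn
  push Not at hn
  have h1 := h.symm.fst_of_mem ha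
  have h2 : ∃ r, ∀ b ∈ c, b.1 = r := by
    rcases h1 with h1 | h1
    · refine ⟨t, fun b hb => (h.fst_of_mem hb).resolve_left fun h3 => hn b hb (h3.trans h1.symm)⟩
    · refine ⟨s, fun b hb => (h.fst_of_mem hb).resolve_right fun h3 => hn b hb (h3.trans h1.symm)⟩
  obtain ⟨r, hr⟩ := h2
  rw [← h.eq_of_power hlarge hr] at ha
  exact hn a ha rfl

theorem Sim.wordOver (hlarge : ∀ s t : S, s ≠ t → 3 ≤ A.m s t) {T : Set S} {w w' : Word S}
    (h : Sim A w w') (hw : WordOver T w) : WordOver T w' := by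
  induction h with
  | refl => exact hw
  | tail _ h ih =>
    obtain ⟨x, y, c, c', s, t, h, rfl, rfl⟩ := h
    intro a ha
    simp only [mem_append] at ha
    rcases ha with (ha | ha) | ha
    · exact ih a (by simp [ha])
    · obtain ⟨b, hb, hb'⟩ := h.mem_of_mem hlarge ha
      rw [← hb']
      exact ih b (by simp [hb])
    · exact ih a (by simp [ha])

end Moves

/-! ### The quotient monoid -/

section Quotient

variable {S : Type*}

/-- The congruence `Sim` on the free monoid. -/
def simCon (A : ArtinData S) : Con (FreeMonoid (S × Bool)) where
  r w w' := Sim A w.toList w'.toList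
  iseqv := ⟨fun _ => .refl, Sim.symm, .trans⟩
  mul' h h' := h.append h'

/-- The monoid of words up to `Sim`. -/
abbrev SimMonoid (A : ArtinData S) := (simCon A).Quotient

variable {A : ArtinData S}

/-- The class of a word. -/
def cls (A : ArtinData S) (w : Word S) : SimMonoid A :=
  ((FreeMonoid.ofList w : FreeMonoid (S × Bool)) : SimMonoid A)

/-- The class of a letter. -/
def gen (A : ArtinData S) (a : S × Bool) : SimMonoid A := cls A [a]

theorem cls_append (w w' : Word S) : cls A (w ++ w') = cls A w * cls A w' := rfl

theorem cls_cons (a : S × Bool) (w : Word S) : cls A (a :: w) = gen A a * cls A w := rfl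

theorem cls_eq {w w' : Word S} : cls A w = cls A w' ↔ Sim A w w' := (simCon A).eq

theorem exists_cls (g : SimMonoid A) : ∃ w, g = cls A w := by
  induction g using Con.induction_on with
  | _ w => exact ⟨w.toList, rfl⟩

/-- The length of an element of the monoid. -/
def len (g : SimMonoid A) : ℕ :=
  Con.liftOn g (fun w => w.toList.length) fun _ _ h => Sim.length_eq h

theorem len_cls (w : Word S) : len (cls A w) = w.length := rfl

@[simp] theorem len_gen (a : S × Bool) : len (gen A a) = 1 := rfl

@[simp] theorem len_one : len (1 : SimMonoid A) = 0 := rfl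

@[simp] theorem len_mul (g h : SimMonoid A) : len (g * h) = len g + len h := by
  obtain ⟨w, rfl⟩ := exists_cls g
  obtain ⟨w', rfl⟩ := exists_cls h
  rw [← cls_append, len_cls, len_cls, len_cls, length_append]

theorem exists_gen {g : SimMonoid A} (h : g ≠ 1) : ∃ z a, g = z * gen A a := by
  obtain ⟨w, rfl⟩ := exists_cls g
  rcases eq_nil_or_concat' w with rfl | ⟨w, a, rfl⟩
  · exact (h rfl).elim
  · exact ⟨cls A w, a, rfl⟩

theorem eq_one_of_len {g : SimMonoid A} (h : len g = 0) : g = 1 := by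
  by_contra h1
  obtain ⟨z, a, rfl⟩ := exists_gen h1
  simp at h

theorem DRel.cls_eq {s t : S} {c c' : Word S} (h : DRel A s t c c') : cls A c = cls A c' :=
  ArtinTits.cls_eq.2 (.single ⟨[], [], c, c', s, t, h, by simp, by simp⟩)

/-- Elements represented by words over `T`. -/
def Over (T : Set S) (g : SimMonoid A) : Prop := ∃ w, WordOver T w ∧ g = cls A w

/-- Elements without right factor in `T`. -/
def Red (T : Set S) (g : SimMonoid A) : Prop := ∀ z a, a.1 ∈ T → g ≠ z * gen A a

/-- Elements without cancelling factor. -/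
def Irr (g : SimMonoid A) : Prop := ∀ x y a, g ≠ x * gen A a * gen A (bar a) * y

theorem Irr.left {g h : SimMonoid A} (hi : Irr (g * h)) : Irr g := by
  rintro x y a rfl
  exact hi x (y * h) a (by simp only [mul_assoc])

theorem Irr.right {g h : SimMonoid A} (hi : Irr (g * h)) : Irr h := by
  rintro x y a rfl
  exact hi (g * x) y a (by simp only [mul_assoc])

theorem irr_one : Irr (1 : SimMonoid A) := by
  intro x y a h
  have := congrArg len h
  simp at this
  omega

theorem over_one (T : Set S) : Over T (1 : SimMonoid A) := ⟨[], by simp [WordOver], rfl⟩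

theorem over_gen {T : Set S} {a : S × Bool} (h : a.1 ∈ T) : Over T (gen A a) :=
  ⟨[a], by simpa [WordOver] using h, rfl⟩

theorem red_one (T : Set S) : Red T (1 : SimMonoid A) := by
  intro z a _ h
  have := congrArg len h
  simp at this

theorem Over.mul {T : Set S} {g h : SimMonoid A} (hg : Over T g) (hh : Over T h) :
    Over T (g * h) := by
  obtain ⟨w, hw, rfl⟩ := hg
  obtain ⟨w', hw', rfl⟩ := hh
  exact ⟨w ++ w', fun a ha => (mem_append.1 ha).elim (hw a) (hw' a), rfl⟩

theorem Over.exists_gen {T : Set S} {g : SimMonoid A} (hg : Over T g) (h : g ≠ 1) :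
    ∃ z a, a.1 ∈ T ∧ Over T z ∧ g = z * gen A a := by
  obtain ⟨w, hw, rfl⟩ := hg
  rcases eq_nil_or_concat' w with rfl | ⟨w, a, rfl⟩
  · exact (h rfl).elim
  · exact ⟨cls A w, a, hw a (by simp), ⟨w, fun b hb => hw b (by simp [hb]), rfl⟩, rfl⟩

theorem exists_peel (T : Set S) (g : SimMonoid A) :
    ∃ y e, Red T y ∧ Over T e ∧ g = y * e := by
  obtain ⟨n, hn⟩ : ∃ n, len g = n := ⟨_, rfl⟩
  induction n generalizing g with
  | zero => exact ⟨1, 1, red_one T, over_one T, by simp [eq_one_of_len hn]⟩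
  | succ n ih =>
    by_cases hg : Red T g
    · exact ⟨g, 1, hg, over_one T, by simp⟩
    · simp only [Red, not_forall, not_not] at hg
      obtain ⟨z, a, ha, rfl⟩ := hg
      obtain ⟨y, e, hy, he, rfl⟩ := ih z (by simpa using hn)
      exact ⟨y, e * gen A a, hy, he.mul (over_gen ha), by rw [mul_assoc]⟩

theorem over_cls (hlarge : ∀ s t : S, s ≠ t → 3 ≤ A.m s t) {T : Set S} {w : Word S} :
    Over T (cls A w) ↔ WordOver T w := by
  constructor
  · rintro ⟨w', hw', h⟩
    exact (cls_eq.1 h).symm.wordOver hlarge hw'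
  · exact fun h => ⟨w, h, rfl⟩

theorem Over.of_mul (hlarge : ∀ s t : S, s ≠ t → 3 ≤ A.m s t) {T : Set S} {g h : SimMonoid A}
    (hgh : Over T (g * h)) : Over T g ∧ Over T h := by
  obtain ⟨w, rfl⟩ := exists_cls g
  obtain ⟨w', rfl⟩ := exists_cls h
  rw [← cls_append, over_cls hlarge] at hgh
  rw [over_cls hlarge, over_cls hlarge]
  exact ⟨fun a ha => hgh a (by simp [ha]), fun a ha => hgh a (by simp [ha])⟩

theorem drel_of_irr {s t : S} (hs : s ≠ t) {M : ℕ} (hm : A.m s t = M) {c : Word S}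
    (hc : ∀ a ∈ c, a.1 = s ∨ a.1 = t) (h : Irr (cls A c)) : DRel A s t c c := by
  induction c using List.reverseRecOn with
  | nil => exact .nil hs hm
  | append_singleton c a ih =>
    rw [cls_append] at h
    have h1 := ih (fun b hb => hc b (by simp [hb])) h.left
    rcases h1.concat_or (hc a (by simp)) with h2 | ⟨c', h2⟩
    · exact h2
    · exfalso
      refine h (cls A c') 1 (bar a) ?_
      rw [← h2.cls_eq, cls_append, DState.bar_bar, mul_one]
      rfl

theorem DRel.irr (hlarge : ∀ s t : S, s ≠ t → 3 ≤ A.m s t) {s t : S} {c : Word S}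
    (h : DRel A s t c c) : Irr (cls A c) := by
  intro x y a he
  obtain ⟨x, rfl⟩ := exists_cls x
  obtain ⟨y, rfl⟩ := exists_cls y
  have h1 : Sim A c (x ++ [a] ++ [bar a] ++ y) := ArtinTits.cls_eq.1 he
  have h2 := (h.sim hlarge h1).refl_right.of_append
  exact h2.concat_not (c' := x) (by rw [DState.bar_bar]; exact h2.of_append)

end Quotient

section Main

variable {S : Type*} {A : ArtinData S}

/-! ### The inductive statement -/

/-- The description of last letters of irreducible elements of length at most `n`. -/
structure LastLetters (A : ArtinData S) (n : ℕ) : Prop where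
  cancel : ∀ (g h : SimMonoid A) (a : S × Bool), len g + 1 ≤ n → Irr (g * gen A a) →
    g * gen A a = h * gen A a → g = h
  braid : ∀ (g h : SimMonoid A) (a b : S × Bool), len g + 1 ≤ n → Irr (g * gen A a) →
    g * gen A a = h * gen A b → a ≠ b → ∃ y c c', DRel A a.1 b.1 (c ++ [a]) (c' ++ [b]) ∧
      g = y * cls A c ∧ h = y * cls A c'
  descent : ∀ (g : SimMonoid A) (a : S × Bool), len g + 1 ≤ n → Irr g → ¬ Irr (g * gen A a) →
    ∃ h, g = h * gen A (bar a)

theorem over_pair {s t : S} {c : Word S} (h : ∀ a ∈ c, a.1 = s ∨ a.1 = t) {T : Set S}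
    (hs : s ∈ T) (ht : t ∈ T) : Over T (cls A c) := by
  refine ⟨c, fun a ha => ?_, rfl⟩
  rcases h a ha with h | h <;> rw [h] <;> assumption

theorem DRel.over_left {s t : S} {c c' : Word S} {a : S × Bool} (h : DRel A s t (c ++ [a]) c')
    {T : Set S} (hs : s ∈ T) (ht : t ∈ T) : Over T (cls A c) :=
  over_pair (fun b hb => h.fst_of_mem (by simp [hb])) hs ht

/-- Uniqueness of the decomposition with respect to a set of generators. -/
theorem LastLetters.unique {n : ℕ} (hn : LastLetters A n) {T : Set S}
    {y y' e e' : SimMonoid A} (hl : len (y * e) ≤ n) (hi : Irr (y * e)) (hy : Red T y)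
    (hy' : Red T y') (he : Over T e) (he' : Over T e') (h : y * e = y' * e') :
    y = y' ∧ e = e' := by
  obtain ⟨k, hk⟩ : ∃ k, len (y * e) = k := ⟨_, rfl⟩
  induction k generalizing y y' e e' with
  | zero =>
    have h1 := hk
    rw [h] at h1
    simp only [len_mul, Nat.add_eq_zero_iff] at hk h1
    rw [eq_one_of_len hk.1, eq_one_of_len hk.2, eq_one_of_len h1.1, eq_one_of_len h1.2]
    exact ⟨rfl, rfl⟩
  | succ k ih =>
    by_cases h1 : e = 1
    · subst h1
      by_cases h2 : e' = 1
      · subst h2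
        simpa using h
      · obtain ⟨z, a, ha, -, rfl⟩ := he'.exists_gen h2
        exact (hy (y' * z) a ha (by rw [mul_one] at h; rw [h, mul_assoc])).elim
    by_cases h2 : e' = 1
    · subst h2
      obtain ⟨z, a, ha, -, rfl⟩ := he.exists_gen h1
      exact (hy' (y * z) a ha (by rw [mul_one] at h; rw [← h, mul_assoc])).elim
    obtain ⟨f, a, ha, hf, rfl⟩ := he.exists_gen h1
    obtain ⟨f', b, hb, hf', rfl⟩ := he'.exists_gen h2
    rw [← mul_assoc, ← mul_assoc] at h
    rw [← mul_assoc] at hi hk hl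
    have hl' : len (y * f) + 1 ≤ n := by simpa using hl
    have hk' : len (y * f) = k := by
      simp only [len_mul, len_gen] at hk ⊢
      omega
    have hi' := hi.left
    by_cases hab : a = b
    · subst hab
      have h3 := hn.cancel _ _ a hl' hi h
      obtain ⟨h4, h5⟩ := ih (by omega) hi' hy hy' hf hf' h3 hk'
      rw [h4, h5]
      exact ⟨rfl, rfl⟩
    · obtain ⟨z, c, c', hD, h3, h4⟩ := hn.braid _ _ a b hl' hi h hab
      obtain ⟨z, e₀, hz, he₀, rfl⟩ := exists_peel T z
      have hc := hD.over_left ha hb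
      have hc' := hD.symm.over_left ha hb
      have h3' := h3
      have h4' := h4
      rw [mul_assoc] at h3 h4
      obtain ⟨h5, h6⟩ := ih (by omega) hi' hy hz hf (he₀.mul hc) h3 hk'
      have hi4 : Irr (y' * f') := by
        rw [h] at hi
        exact hi.left
      have hlen : len (y' * f') = k := by
        have := congrArg len h
        simp only [len_mul, len_gen] at this hk' ⊢
        omega
      obtain ⟨h7, h8⟩ := ih (by omega) hi4 hy' hz hf' (he₀.mul hc') h4 hlen
      refine ⟨h5.trans h7.symm, ?_⟩
      rw [h6, h8, mul_assoc, mul_assoc]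
      congr 1
      exact hD.cls_eq

/-- Products of a reduced element and an irreducible element over `T` are irreducible. -/
theorem LastLetters.irr_mul {n : ℕ} (hn : LastLetters A n) {T : Set S}
    {y e : SimMonoid A} (hl : len (y * e) ≤ n) (hy : Red T y) (hyi : Irr y)
    (he : Over T e) (hei : Irr e) : Irr (y * e) := by
  obtain ⟨k, hk⟩ : ∃ k, len e = k := ⟨_, rfl⟩
  induction k generalizing e with
  | zero => rwa [eq_one_of_len hk, mul_one]
  | succ k ih =>
    obtain ⟨f, a, ha, hf, rfl⟩ := he.exists_gen (by rintro rfl; simp at hk)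
    have hl' : len (y * f) + 1 ≤ n := by simpa [add_assoc] using hl
    have h1 := ih (e := f) (by omega) hf hei.left (by simpa using hk)
    by_contra hni
    rw [← mul_assoc] at hni
    obtain ⟨h, h2⟩ := hn.descent _ a hl' h1 hni
    obtain ⟨z, e₀, hz, he₀, rfl⟩ := exists_peel T h
    rw [mul_assoc] at h2
    obtain ⟨-, h3⟩ := hn.unique (by omega) h1 hy hz hf (he₀.mul (over_gen (a := bar a) ha)) h2
    subst h3
    refine hei e₀ 1 (bar a) ?_
    rw [DState.bar_bar, mul_one]

theorem LastLetters.red_mul {n : ℕ} (hn : LastLetters A n) {T T' : Set S} (hT : T' ⊆ T)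
    {x e : SimMonoid A} (hl : len (x * e) ≤ n) (hi : Irr (x * e)) (hx : Red T x)
    (he : Over T e) (he' : Red T' e) : Red T' (x * e) := by
  intro z a ha h
  obtain ⟨z, f, hz, hf, rfl⟩ := exists_peel T z
  rw [mul_assoc] at h
  obtain ⟨-, h1⟩ := hn.unique hl hi hx hz he (hf.mul (over_gen (hT ha))) h
  exact he' f a ha h1

/-- The left factor in `braid` may be taken to be reduced. -/
theorem exists_red_of_drel {a b : S × Bool} {y : SimMonoid A} {c c' : Word S}
    (hD : DRel A a.1 b.1 (c ++ [a]) (c' ++ [b])) (hi : Irr (y * cls A c))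
    (hg : ∀ h, y * cls A c ≠ h * gen A (bar a)) :
    ∃ y₀ d d', DRel A a.1 b.1 (d ++ [a]) (d' ++ [b]) ∧ Red {a.1, b.1} y₀ ∧
      y * cls A c = y₀ * cls A d ∧ y * cls A c' = y₀ * cls A d' := by
  obtain ⟨k, hk⟩ : ∃ k, len y = k := ⟨_, rfl⟩
  induction k generalizing y c c' with
  | zero =>
    refine ⟨y, c, c', hD, ?_, rfl, rfl⟩
    rw [eq_one_of_len hk]
    exact red_one _
  | succ k ih =>
    by_cases hy : Red {a.1, b.1} y
    · exact ⟨y, c, c', hD, hy, rfl, rfl⟩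
    simp only [Red, not_forall, not_not] at hy
    obtain ⟨z, x, hx, rfl⟩ := hy
    have hx' : x.1 = a.1 ∨ x.1 = b.1 := by simpa using hx
    have hD0 := hD
    obtain ⟨hs, M, -, -, hm, -⟩ := hD0
    have e1 : ∀ c, z * gen A x * cls A c = z * cls A (x :: c) := fun c => by
      rw [cls_cons, mul_assoc]
    rw [e1] at hi hg
    have h1 : DRel A a.1 b.1 (x :: c) (x :: c) := by
      refine drel_of_irr hs hm ?_ hi.right
      intro d hd
      rcases mem_cons.1 hd with rfl | hd
      · exact hx'
      · exact hD.fst_of_mem (by simp [hd])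
    have h2 : DRel A a.1 b.1 ((x :: c) ++ [a]) ((x :: c') ++ [b]) := by
      rcases h1.concat_or (a := a) (.inl rfl) with h2 | ⟨d, h2⟩
      · have := hD.congr (k := [x]) (q := []) (by simpa using h2)
        simpa using this
      · refine (hg (z * cls A d) ?_).elim
        rw [← h2.cls_eq, cls_append, mul_assoc]
        rfl
    have := ih h2 hi hg (by simpa using hk)
    simpa only [e1] using this

/-- The tail of a dihedral geodesic with two possible last letters. -/
theorem LastLetters.exists_tail (hlarge : ∀ s t : S, s ≠ t → 3 ≤ A.m s t) {n : ℕ}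
    (hn : LastLetters A n) {a b : S × Bool} {x : SimMonoid A} {c c' : Word S}
    (hl : len (x * cls A c) ≤ n) (hi : Irr (x * cls A c)) (hx : Red {a.1, b.1} x)
    (hD : DRel A a.1 b.1 (c ++ [a]) (c' ++ [b])) :
    ∃ e v₂ v₁ : SimMonoid A, cls A c = e * v₂ * v₁ ∧ Over {a.1} v₁ ∧ Over {b.1} v₂ ∧ v₂ ≠ 1 ∧
      (∃ z d, d.1 = a.1 ∧ x * e = z * gen A d) ∧ Red {b.1} (x * e) ∧ Red {a.1} (x * e * v₂) := by
  obtain ⟨e₁, v₁, he₁, hv₁, h1⟩ := exists_peel {a.1} (cls A c)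
  obtain ⟨e, v₂, he, hv₂, rfl⟩ := exists_peel {b.1} e₁
  have hc : Over {a.1, b.1} (cls A c) := hD.over_left (by simp) (by simp)
  have hab : a ≠ b := fun h => hD.ne (by rw [h])
  rw [h1] at hc hi hl
  have hc1 := (hc.of_mul hlarge).1
  have hc2 := (hc1.of_mul hlarge).1
  rw [← mul_assoc] at hi hl
  have hi1 := hi.left
  have hl1 : len (x * (e * v₂)) ≤ n := by
    simp only [len_mul] at hl ⊢
    omega
  have hi2 : Irr (x * e) := by
    rw [← mul_assoc] at hi1
    exact hi1.left
  have hl2 : len (x * e) ≤ n := by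
    simp only [len_mul] at hl ⊢
    omega
  have hr1 : Red {a.1} (x * e * v₂) := by
    rw [mul_assoc]
    exact hn.red_mul (by simp) hl1 hi1 hx hc1 he₁
  have hr2 : Red {b.1} (x * e) := hn.red_mul (by simp) hl2 hi2 hx hc2 he
  have he_ne : e ≠ 1 := by
    rintro rfl
    obtain ⟨u, hu, rfl⟩ := hv₂
    obtain ⟨v, hv, rfl⟩ := hv₁
    rw [one_mul, ← cls_append] at h1
    have h2 : Sim A (c ++ [a]) (u ++ v ++ [a]) := (cls_eq.1 h1).append .refl
    have h3 := (hD.refl_left.sim hlarge h2).symm.trans hD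
    refine hab (h3.last_eq_of_powers hlarge (fun z hz => ?_) fun z hz => hv z hz)
    rw [hu z hz]
    exact hD.ne.symm
  obtain ⟨f, d, hd, -, rfl⟩ := hc2.exists_gen he_ne
  have hd : d.1 = a.1 ∨ d.1 = b.1 := by simpa using hd
  have hda : d.1 = a.1 := hd.resolve_right fun h => he f d h rfl
  refine ⟨f * gen A d, v₂, v₁, h1, hv₁, hv₂, ?_, ⟨x * f, d, hda, by rw [mul_assoc]⟩, hr2, hr1⟩
  rintro rfl
  exact he₁ f d hda (by rw [mul_one])

/-- An element which ends with a power of `s` and with another generator `r`: what is left after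
removing this power of `s` can only end with `r`. -/
theorem LastLetters.red_of_ends (hlarge : ∀ s t : S, s ≠ t → 3 ≤ A.m s t) {n : ℕ}
    (hn : LastLetters A n) {s : S} {z v h : SimMonoid A} {b : S × Bool} (hl : len (z * v) ≤ n)
    (hi : Irr (z * v)) (hv : Over {s} v) (hv1 : v ≠ 1) (hz : Red {s} z)
    (hb : b.1 ≠ s) (hh : z * v = h * gen A b) {t : S} (ht : t ≠ b.1) : Red {t} z := by
  obtain ⟨k, hk⟩ : ∃ k, len (z * v) = k := ⟨_, rfl⟩
  induction k using Nat.strong_induction_on generalizing s z v h b t with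
  | _ k ih =>
    obtain ⟨v', a, ha, hv', rfl⟩ := hv.exists_gen hv1
    have ha : a.1 = s := ha
    subst ha
    have hl0 : len z < len (z * (v' * gen A a)) := by simp
    rw [← mul_assoc] at hh hi hl hk hl0
    have hl1 : len (z * v') + 1 ≤ n := by simpa using hl
    have hab : a ≠ b := by
      rintro rfl
      exact hb rfl
    obtain ⟨x, c, c', hD, h1, h2⟩ := hn.braid _ _ a b hl1 hi hh hab
    obtain ⟨x, c, c', hD, hx, h1, -⟩ : ∃ y₀ d d', DRel A a.1 b.1 (d ++ [a]) (d' ++ [b]) ∧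
        Red {a.1, b.1} y₀ ∧ z * v' = y₀ * cls A d ∧ h = y₀ * cls A d' := by
      rw [h1, h2]
      refine exists_red_of_drel hD (h1 ▸ hi.left) ?_
      intro k hk
      rw [h1, hk] at hi
      refine hi k 1 (bar a) ?_
      rw [DState.bar_bar, mul_one]
    obtain ⟨e, v₂, v₁, h3, hv₁, hv₂, hv₂1, ⟨z₁, d, hd, h4⟩, h5, h6⟩ :=
      hn.exists_tail hlarge (by rw [← h1]; omega) (h1 ▸ hi.left) hx hD
    have h7 : z * v' = x * e * v₂ * v₁ := by rw [h1, h3]; simp only [mul_assoc]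
    obtain ⟨h8, -⟩ := hn.unique (by omega) hi.left hz h6 hv' hv₁ h7
    intro z' d' hd' hzd
    have hd' : d'.1 = t := hd'
    by_cases hta : t = a.1
    · exact hz z' d' (by simp [hd', hta]) hzd
    · have hlz : len z < k := by omega
      have h9 := ih (len z) hlz (s := b.1) (z := x * e) (v := v₂) (h := z') (b := d')
        (by rw [← h8]; omega) (by rw [← h8]; exact hi.left.left) hv₂ hv₂1 h5 (by rw [hd']; exact ht)
        (by rw [← h8, hzd]) (t := a.1) (by rw [hd']; exact fun h => hta h.symm) (by rw [h8])
      exact h9 z₁ d hd h4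

/-! ### The induction step -/

/-- Pairs of an element and a letter whose product is not obviously reducible. -/
def Good (n : ℕ) (g : SimMonoid A) (b : S × Bool) : Prop :=
  Irr g ∧ len g ≤ n ∧ ∀ h, g ≠ h * gen A (bar b)

/-- Pairs whose products agree up to one dihedral transformation at the end. -/
def EndRel (g : SimMonoid A) (b : S × Bool) (g' : SimMonoid A) (b' : S × Bool) : Prop :=
  (b = b' ∧ g = g') ∨ ∃ y c c', DRel A b.1 b'.1 (c ++ [b]) (c' ++ [b']) ∧
    g = y * cls A c ∧ g' = y * cls A c'

theorem Good.exists_red {n : ℕ} {g g' : SimMonoid A} {b b' : S × Bool} (hg : Good n g b)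
    {y : SimMonoid A} {c c' : Word S} (hD : DRel A b.1 b'.1 (c ++ [b]) (c' ++ [b']))
    (h : g = y * cls A c) (h' : g' = y * cls A c') :
    ∃ y₀ d d', DRel A b.1 b'.1 (d ++ [b]) (d' ++ [b']) ∧ Red {b.1, b'.1} y₀ ∧
      g = y₀ * cls A d ∧ g' = y₀ * cls A d' := by
  subst h h'
  exact exists_red_of_drel hD hg.1 hg.2.2

theorem Good.of_endRel (hlarge : ∀ s t : S, s ≠ t → 3 ≤ A.m s t) {n : ℕ} (hn : LastLetters A n)
    {g g' : SimMonoid A} {b b' : S × Bool} (hg : Good n g b) (h : EndRel g b g' b') :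
    Good n g' b' := by
  rcases h with ⟨rfl, rfl⟩ | ⟨y, c, c', hD, h, h'⟩
  · exact hg
  obtain ⟨y, c, c', hD, hy, rfl, rfl⟩ := hg.exists_red hD h h'
  have hlen := hD.length_eq
  simp only [length_append, length_singleton, Nat.add_right_cancel_iff] at hlen
  have hl : len (y * cls A c') ≤ n := by
    have := hg.2.1
    simp only [len_mul, len_cls] at this ⊢
    omega
  have hc' : Over {b.1, b'.1} (cls A c') := hD.symm.over_left (by simp) (by simp)
  have hi : Irr (y * cls A c') :=
    hn.irr_mul hl hy hg.1.left hc' (hD.refl_right.of_append.irr hlarge)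
  refine ⟨hi, hl, fun h he => ?_⟩
  obtain ⟨z, e₀, hz, he₀, rfl⟩ := exists_peel {b.1, b'.1} h
  rw [mul_assoc] at he
  obtain ⟨-, h1⟩ := hn.unique hl hi hy hz hc'
    (he₀.mul (over_gen (a := bar b') (by simp [bar]))) he
  obtain ⟨w, hw, rfl⟩ := he₀
  have h2 : Sim A c' (w ++ [bar b']) := cls_eq.1 h1
  exact hD.refl_right.concat_not (c' := w) (hD.refl_right.of_append.sim hlarge h2).symm

theorem Good.trans (hlarge : ∀ s t : S, s ≠ t → 3 ≤ A.m s t) {n : ℕ} (hn : LastLetters A n)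
    {g g' g'' : SimMonoid A} {b b' b'' : S × Bool} (hg : Good n g b) (h : EndRel g b g' b')
    (h' : EndRel g' b' g'' b'') : EndRel g b g'' b'' := by
  have hg' := hg.of_endRel hlarge hn h
  have h0 := h
  rcases h with ⟨rfl, rfl⟩ | ⟨y, c, c', hD, h1, h2⟩
  · exact h'
  rcases h' with ⟨rfl, rfl⟩ | ⟨y', d, d', hD', h3, h4⟩
  · exact h0
  obtain ⟨y, c, c', hD, hy, rfl, h2⟩ := hg.exists_red hD h1 h2
  obtain ⟨y', d, d', hD', hy', rfl, rfl⟩ := hg'.exists_red hD' h3 h4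
  have hc' : Over {b.1, b'.1} (cls A c') := hD.symm.over_left (by simp) (by simp)
  have hd : Over {b'.1, b''.1} (cls A d) := hD'.over_left (by simp) (by simp)
  have hi := hg'.1
  have hl := hg'.2.1
  by_cases hb : b''.1 = b.1
  · left
    rw [hb, Set.pair_comm] at hy' hd
    rw [hb] at hD'
    obtain ⟨h5, h6⟩ := hn.unique hl hi hy' hy hd hc' h2
    subst h5
    have h7 : Sim A (c' ++ [b']) (d ++ [b']) := (cls_eq.1 h6.symm).append .refl
    have h8 := (hD.trans (hD.refl_right.sim hlarge h7)).trans hD'.flip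
    obtain rfl := h8.last_eq_of_fst hb.symm
    rw [h8.cancel.cls_eq]
    exact ⟨rfl, rfl⟩
  · exfalso
    obtain ⟨e, v₂, v₁, h3, hv₁, hv₂, hv₂1, ⟨z₁, x, hx, h4⟩, h5, h6⟩ :=
      hn.exists_tail hlarge (x := y) (c := c') (a := b') (b := b) (by rw [← h2]; exact hl)
        (by rw [← h2]; exact hi) (by rw [Set.pair_comm]; exact hy) hD.symm.flip
    obtain ⟨e', v₂', v₁', h3', hv₁', hv₂', hv₂1', -, -, h6'⟩ :=
      hn.exists_tail hlarge (x := y') (c := d) (a := b') (b := b'') hl hi hy' hD'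
    rw [h3', h3, ← mul_assoc, ← mul_assoc, ← mul_assoc, ← mul_assoc] at h2
    rw [h3', ← mul_assoc, ← mul_assoc] at hi hl
    obtain ⟨h7, -⟩ := hn.unique hl hi h6' h6 hv₁' hv₁ h2
    obtain ⟨f, r, hr, -, rfl⟩ := hv₂'.exists_gen hv₂1'
    have hr : r.1 = b''.1 := hr
    rw [h7] at hi hl
    have hl7 : len (y * e * v₂) ≤ n := by
      simp only [len_mul] at hl ⊢
      omega
    exact hn.red_of_ends hlarge (s := b.1) (z := y * e) (v := v₂) (h := y' * e' * f) (b := r)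
      hl7 hi.left hv₂ hv₂1 h5 (by rw [hr]; exact hb)
      (by rw [← h7]; simp only [mul_assoc]) (t := b'.1)
      (by rw [hr]; exact hD'.ne) z₁ x hx h4

theorem exists_endRel_of_mv {v w : Word S} {b : S × Bool} (h : Mv A (v ++ [b]) w) :
    ∃ v' b', w = v' ++ [b'] ∧ EndRel (cls A v) b (cls A v') b' := by
  obtain ⟨x, y, c, c', s, t, hD, h1, rfl⟩ := h
  rcases eq_nil_or_concat' y with rfl | ⟨y, d, rfl⟩
  · rw [append_nil] at h1
    rcases eq_nil_or_concat' c with rfl | ⟨c, d, rfl⟩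
    · have : c' = [] := length_eq_zero_iff.1 hD.length_eq.symm
      subst this
      exact ⟨v, b, by simpa using h1.symm, .inl ⟨rfl, rfl⟩⟩
    · rcases eq_nil_or_concat' c' with rfl | ⟨c', d', rfl⟩
      · simpa using hD.length_eq
      rw [← append_assoc] at h1
      obtain ⟨rfl, h2⟩ := append_inj' h1 rfl
      obtain rfl : b = d := by simpa using h2
      refine ⟨x ++ c', d', by simp, ?_⟩
      by_cases hb : b.1 = d'.1
      · obtain rfl := hD.last_eq_of_fst hb
        refine .inl ⟨rfl, ?_⟩
        rw [cls_append, cls_append, hD.cancel.cls_eq]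
      · refine .inr ⟨cls A x, c, c', ?_, rfl, rfl⟩
        rcases hD.fst_of_mem (a := b) (by simp) with h3 | h3 <;>
        rcases hD.symm.fst_of_mem (a := d') (by simp) with h4 | h4
        · exact (hb (h3.trans h4.symm)).elim
        · rw [h3, h4]; exact hD
        · rw [h3, h4]; exact hD.flip
        · exact (hb (h3.trans h4.symm)).elim
  · rw [← append_assoc] at h1
    obtain ⟨rfl, h2⟩ := append_inj' h1 rfl
    obtain rfl : b = d := by simpa using h2
    refine ⟨x ++ c' ++ y, b, by simp, .inl ⟨rfl, ?_⟩⟩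
    simp only [cls_append]
    rw [hD.cls_eq]

theorem Good.endRel_of_sim (hlarge : ∀ s t : S, s ≠ t → 3 ≤ A.m s t) {n : ℕ}
    (hn : LastLetters A n) {v w : Word S} {b : S × Bool} (hg : Good n (cls A v) b)
    (h : Sim A (v ++ [b]) w) : ∃ v' b', w = v' ++ [b'] ∧ EndRel (cls A v) b (cls A v') b' := by
  induction h with
  | refl => exact ⟨v, b, rfl, .inl ⟨rfl, rfl⟩⟩
  | tail _ h ih =>
    obtain ⟨v', b', rfl, h1⟩ := ih
    obtain ⟨v'', b'', rfl, h2⟩ := exists_endRel_of_mv h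
    exact ⟨v'', b'', rfl, hg.trans hlarge hn h1 h2⟩

theorem Good.endRel (hlarge : ∀ s t : S, s ≠ t → 3 ≤ A.m s t) {n : ℕ} (hn : LastLetters A n)
    {g g' : SimMonoid A} {b b' : S × Bool} (hg : Good n g b)
    (h : g * gen A b = g' * gen A b') : EndRel g b g' b' := by
  obtain ⟨v, rfl⟩ := exists_cls g
  obtain ⟨v', rfl⟩ := exists_cls g'
  obtain ⟨v'', b'', h1, h2⟩ := hg.endRel_of_sim hlarge hn (w := v' ++ [b']) (cls_eq.1 h)
  obtain ⟨rfl, h3⟩ := append_inj' h1 rfl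
  obtain rfl : b' = b'' := by simpa using h3
  exact h2

theorem good_of_irr {n : ℕ} {g : SimMonoid A} {a : S × Bool} (hl : len g ≤ n)
    (hi : Irr (g * gen A a)) : Good n g a := by
  refine ⟨hi.left, hl, ?_⟩
  rintro h rfl
  refine hi h 1 (bar a) ?_
  rw [DState.bar_bar, mul_one]

theorem LastLetters.succ (hlarge : ∀ s t : S, s ≠ t → 3 ≤ A.m s t) {n : ℕ}
    (hn : LastLetters A n) : LastLetters A (n + 1) := by
  refine ⟨fun g h a hl hi he => ?_, fun g h a b hl hi he hab => ?_, fun g a hl hi hni => ?_⟩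
  · rcases (good_of_irr (by omega) hi).endRel hlarge hn he with ⟨-, h⟩ | ⟨y, c, c', hD, -, -⟩
    · exact h
    · exact (hD.ne rfl).elim
  · rcases (good_of_irr (by omega) hi).endRel hlarge hn he with ⟨h, -⟩ | h
    · exact (hab h).elim
    · exact h
  · by_contra hne
    push Not at hne
    have hg : Good n g a := ⟨hi, by omega, hne⟩
    simp only [Irr, not_forall, not_not] at hni
    obtain ⟨x, y, d, h⟩ := hni
    by_cases hy : y = 1
    · subst hy
      rw [mul_one] at h
      refine (hg.of_endRel hlarge hn (hg.endRel hlarge hn h)).2.2 x ?_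
      rw [DState.bar_bar]
    · obtain ⟨y, b, rfl⟩ := exists_gen hy
      rw [← mul_assoc] at h
      exact (hg.of_endRel hlarge hn (hg.endRel hlarge hn h)).1 x y d rfl

theorem lastLetters (hlarge : ∀ s t : S, s ≠ t → 3 ≤ A.m s t) (n : ℕ) : LastLetters A n := by
  induction n with
  | zero => exact ⟨fun _ _ _ h => by omega, fun _ _ _ _ h => by omega, fun _ _ h => by omega⟩
  | succ n ih => exact ih.succ hlarge

end Main

section Action

variable {S : Type*} {A : ArtinData S}

/-! ### The action on irreducible elements -/

/-- Right multiplication by a letter followed by cancellation, as a relation between irreducible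
elements. -/
def Acts (a : S × Bool) (g h : {g : SimMonoid A // Irr g}) : Prop :=
  h.1 = g.1 * gen A a ∨ g.1 = h.1 * gen A (bar a)

theorem Acts.symm {a : S × Bool} {g h : {g : SimMonoid A // Irr g}} (h1 : Acts a g h) :
    Acts (bar a) h g := by
  unfold Acts
  rw [DState.bar_bar]
  exact Or.symm h1

theorem Acts.unique (hlarge : ∀ s t : S, s ≠ t → 3 ≤ A.m s t) {a : S × Bool}
    {g h h' : {g : SimMonoid A // Irr g}} (h1 : Acts a g h) (h2 : Acts a g h') : h = h' := by
  have key : ∀ k k' : {g : SimMonoid A // Irr g}, k.1 = g.1 * gen A a →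
      g.1 = k'.1 * gen A (bar a) → False := by
    intro k k' hk hk'
    refine k.2 k'.1 1 (bar a) ?_
    rw [hk, hk', DState.bar_bar, mul_one]
  rcases h1 with h1 | h1 <;> rcases h2 with h2 | h2
  · exact Subtype.ext (h1.trans h2.symm)
  · exact (key h h' h1 h2).elim
  · exact (key h' h h2 h1).elim
  · exact Subtype.ext ((lastLetters hlarge _).cancel _ _ (bar a) le_rfl (h1 ▸ g.2)
      (h1.symm.trans h2))

theorem exists_acts (hlarge : ∀ s t : S, s ≠ t → 3 ≤ A.m s t) (a : S × Bool)
    (g : {g : SimMonoid A // Irr g}) : ∃ h, Acts a g h := by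
  by_cases hg : Irr (g.1 * gen A a)
  · exact ⟨⟨_, hg⟩, .inl rfl⟩
  · obtain ⟨h, hh⟩ := (lastLetters hlarge _).descent g.1 a le_rfl g.2 hg
    have hi := g.2
    rw [hh] at hi
    exact ⟨⟨h, hi.left⟩, .inr hh⟩

theorem irr_mul_of_large (hlarge : ∀ s t : S, s ≠ t → 3 ≤ A.m s t) {T : Set S}
    {y e : SimMonoid A} (hy : Red T y) (hyi : Irr y) (he : Over T e) (hei : Irr e) :
    Irr (y * e) :=
  (lastLetters hlarge _).irr_mul le_rfl hy hyi he hei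

variable {p : S × Bool → {g : SimMonoid A // Irr g} → {g : SimMonoid A // Irr g}}

theorem foldl_acts (hlarge : ∀ s t : S, s ≠ t → 3 ≤ A.m s t) (hp : ∀ a g, Acts a g (p a g))
    {s t : S} (hs : s ≠ t) {M : ℕ} (hm : A.m s t = M) {y : SimMonoid A} (hy : Red {s, t} y)
    {k k' w : Word S} (hk : DRel A s t k k) (hk' : DRel A s t k' k')
    (hw : ∀ a ∈ w, a.1 = s ∨ a.1 = t) (h : ERel A s t k' (k ++ w)) (hi : Irr (y * cls A k)) :
    (w.foldl (fun g a => p a g) ⟨y * cls A k, hi⟩).1 = y * cls A k' := by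
  have hirr : ∀ {c}, DRel A s t c c → Irr (y * cls A c) := fun {c} hc =>
    irr_mul_of_large hlarge hy hi.left (over_pair (fun _ => hc.fst_of_mem) (by simp) (by simp))
      (hc.irr hlarge)
  induction w using List.reverseRecOn generalizing k' with
  | nil =>
    rw [append_nil] at h
    rw [foldl_nil, (h.of_eq hk' hk).cls_eq]
  | append_singleton w a ih =>
    have ha := hw a (by simp)
    have hw' : ∀ x ∈ w, x.1 = s ∨ x.1 = t := fun x hx => hw x (by simp [hx])
    obtain ⟨c, hc, hcw⟩ := exists_drel hs hm (w := k ++ w) fun x hx =>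
      (mem_append.1 hx).elim (fun hx => hk.fst_of_mem hx) (hw' x)
    have h1 : w.foldl (fun g a => p a g) ⟨y * cls A k, hi⟩ = ⟨y * cls A c, hirr hc⟩ :=
      Subtype.ext (ih hc hw' hcw)
    have h2 : ERel A s t k' (c ++ [a]) := by
      refine h.trans ?_
      rw [← append_assoc]
      exact (hcw.append_right ha).symm
    rw [foldl_append, h1, foldl_cons, foldl_nil]
    suffices h3 : Acts a ⟨y * cls A c, hirr hc⟩ ⟨y * cls A k', hirr hk'⟩ from
      congrArg Subtype.val ((hp a _).unique hlarge h3)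
    rcases hc.concat_or ha with h3 | ⟨c', h3⟩
    · left
      change y * cls A k' = y * cls A c * gen A a
      rw [(h2.of_eq hk' h3).cls_eq, mul_assoc]
      rfl
    · right
      change y * cls A c = y * cls A k' * gen A (bar a)
      have h4 := h3.refl_left.of_append
      have h5 := h3.erel.append_right ha
      have h6 := ERel.concat_bar hs hm (k := c') (a := bar a) (fun x hx => h4.fst_of_mem hx) ha
      rw [DState.bar_bar] at h6
      rw [append_assoc] at h5
      have h7 := ((h2.trans h5.symm).trans h6).of_eq hk' h4
      rw [← h3.cls_eq, h7.cls_eq, mul_assoc]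
      rfl

theorem fst_of_mem_altWord {s t : S} {n : ℕ} {a : S × Bool} (ha : a ∈ altWord s t n) :
    a.1 = s ∨ a.1 = t := by
  induction n generalizing s t with
  | zero => simp [altWord] at ha
  | succ n ih =>
    rw [altWord, mem_cons] at ha
    rcases ha with rfl | ha
    · exact .inl rfl
    · exact (ih ha).symm

theorem foldl_rel (hlarge : ∀ s t : S, s ≠ t → 3 ≤ A.m s t) (hp : ∀ a g, Acts a g (p a g))
    {u v : Word S} (h : IsRel A u v) (g : {g : SimMonoid A // Irr g}) :
    u.foldl (fun g a => p a g) g = v.foldl (fun g a => p a g) g := by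
  obtain ⟨s, t, M, hs, hm, rfl, rfl⟩ := h
  obtain ⟨g, hg⟩ := g
  obtain ⟨y, e, hy, ⟨k, hk, rfl⟩, rfl⟩ := exists_peel {s, t} g
  have hu : ∀ a ∈ altWord s t M, a.1 = s ∨ a.1 = t := fun a => fst_of_mem_altWord
  have hv : ∀ a ∈ altWord t s M, a.1 = s ∨ a.1 = t := fun a ha => (fst_of_mem_altWord ha).symm
  have hkD := drel_of_irr hs hm hk hg.right
  obtain ⟨k', hk', h1⟩ := exists_drel hs hm (w := k ++ altWord s t M) fun a ha =>
    (mem_append.1 ha).elim (hk a) (hu a)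
  have h2 := h1.trans (ERel.braid hs hm hk)
  exact Subtype.ext ((foldl_acts hlarge hp hs hm hy hkD hk' hu h1 hg).trans
    (foldl_acts hlarge hp hs hm hy hkD hk' hv h2 hg).symm)

theorem foldl_cls (hlarge : ∀ s t : S, s ≠ t → 3 ≤ A.m s t) (hp : ∀ a g, Acts a g (p a g))
    {w : Word S} (hw : Irr (cls A w)) :
    w.foldl (fun g a => p a g) ⟨1, irr_one⟩ = ⟨cls A w, hw⟩ := by
  induction w using List.reverseRecOn with
  | nil => rfl
  | append_singleton w a ih =>
    have h1 : Irr (cls A w) := by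
      rw [cls_append] at hw
      exact hw.left
    rw [foldl_append, ih h1, foldl_cons, foldl_nil]
    exact (hp a _).unique hlarge (.inl rfl)

/-- Irreducible words representing the same element of the Artin–Tits group are equivalent. -/
theorem cls_eq_of_wbar (hlarge : ∀ s t : S, s ≠ t → 3 ≤ A.m s t) {w w' : Word S}
    (hw : Irr (cls A w)) (hw' : Irr (cls A w')) (h : wbar A w = wbar A w') :
    cls A w = cls A w' := by
  choose p hp using exists_acts (A := A) hlarge
  have hbar : ∀ a g, p (bar a) (p a g) = g := fun a g =>
    (hp (bar a) (p a g)).unique hlarge (hp a g).symm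
  let f : S → Equiv.Perm {g : SimMonoid A // Irr g} := fun s =>
    ⟨p (s, false), p (s, true), hbar (s, false), hbar (s, true)⟩
  have hf : ∀ (w : Word S) g,
      FreeGroup.lift f (FreeGroup.mk w) (w.foldl (fun g a => p a g) g) = g := by
    intro w
    simp only [FreeGroup.lift_mk]
    induction w with
    | nil => exact fun g => rfl
    | cons a w ih =>
      intro g
      rw [map_cons, prod_cons, foldl_cons, Equiv.Perm.mul_apply, ih]
      obtain ⟨s, _ | _⟩ := a
      · exact hbar (s, false) g
      · exact hbar (s, true) g
  have hrel : ∀ x ∈ rels A, FreeGroup.lift f x = 1 := by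
    rintro x ⟨u, v, hr, rfl⟩
    rw [map_mul, map_inv, mul_inv_eq_one]
    ext1 z
    have h1 := (FreeGroup.lift f (FreeGroup.mk u)).injective
      (hf u (FreeGroup.lift f (FreeGroup.mk u) z))
    rw [foldl_rel hlarge hp hr] at h1
    have h2 := hf v (FreeGroup.lift f (FreeGroup.mk u) z)
    rw [h1] at h2
    exact h2.symm
  have h1 : FreeGroup.lift f (FreeGroup.mk w) = FreeGroup.lift f (FreeGroup.mk w') :=
    congrArg (PresentedGroup.toGroup hrel) h
  have h2 := hf w ⟨1, irr_one⟩
  have h3 := hf w' ⟨1, irr_one⟩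
  rw [← h1] at h3
  have h4 := (FreeGroup.lift f (FreeGroup.mk w)).injective (h2.trans h3.symm)
  rw [foldl_cls hlarge hp hw, foldl_cls hlarge hp hw'] at h4
  exact congrArg Subtype.val h4

/-! ### Reduction of words -/

theorem wbar_append (u v : Word S) : wbar A (u ++ v) = wbar A u * wbar A v := rfl

theorem wbar_nil : wbar A [] = 1 := rfl

theorem wbar_bar (a : S × Bool) : wbar A [bar a] = (wbar A [a])⁻¹ := rfl

theorem wbar_wordInv (w : Word S) : wbar A (wordInv w) = (wbar A w)⁻¹ := by
  induction w with
  | nil => simp [wordInv_nil, wbar_nil]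
  | cons a w ih =>
    rw [wordInv_cons, wbar_append, ih, wbar_bar, ← mul_inv_rev]
    rfl

theorem wbar_rel {u v : Word S} (h : IsRel A u v) : wbar A u = wbar A v := by
  have h1 : PresentedGroup.mk (rels A) (FreeGroup.mk u * (FreeGroup.mk v)⁻¹) = 1 :=
    PresentedGroup.one_of_mem ⟨u, v, h, rfl⟩
  rw [map_mul, map_inv, mul_inv_eq_one] at h1
  exact h1

theorem Steps012.wbar_eq {w w' : Word S} (h : Steps012 A w w') : wbar A w = wbar A w' := by
  induction h with
  | refl => rfl
  | tail _ h ih =>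
    rw [ih]
    rcases h with ⟨x, y, s, b, rfl, rfl⟩ | ⟨x, y, u, v, hr, h⟩ |
      ⟨x, y, u₁, u₂, v₁, v₂, hr, -, -, rfl, rfl⟩ | ⟨x, y, u₁, u₂, v₁, v₂, hr, -, -, rfl, rfl⟩
    · have h1 : wbar A [(s, b), (s, !b)] = 1 :=
        (mul_eq_one_iff_inv_eq (a := wbar A [(s, b)])).2 (wbar_bar (s, b)).symm
      simp only [wbar_append, h1, mul_one]
    · rcases h with ⟨rfl, rfl⟩ | ⟨rfl, rfl⟩ <;> simp only [wbar_append, wbar_wordInv, wbar_rel hr]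
    · have h1 := wbar_rel hr
      simp only [wbar_append, wbar_wordInv] at h1 ⊢
      have h2 : (wbar A v₁)⁻¹ * wbar A u₁ = wbar A v₂ * (wbar A u₂)⁻¹ := by
        rw [inv_mul_eq_iff_eq_mul, ← mul_assoc, ← h1, mul_inv_cancel_right]
      rw [mul_assoc (wbar A x) (wbar A v₁)⁻¹, h2, ← mul_assoc]
    · have h1 := wbar_rel hr
      simp only [wbar_append, wbar_wordInv] at h1 ⊢
      have h2 : (wbar A v₁)⁻¹ * wbar A u₁ = wbar A v₂ * (wbar A u₂)⁻¹ := by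
        rw [inv_mul_eq_iff_eq_mul, ← mul_assoc, ← h1, mul_inv_cancel_right]
      rw [mul_assoc (wbar A x) (wbar A v₂), ← h2, ← mul_assoc]

/-- Every word can be reduced to an irreducible one. -/
theorem exists_reduction (hlarge : ∀ s t : S, s ≠ t → 3 ≤ A.m s t) (w : Word S) :
    ∃ w', Steps012 A w w' ∧ Irr (cls A w') ∧ w'.length ≤ w.length ∧
      ∀ T, WordOver T w → WordOver T w' := by
  obtain ⟨n, hn⟩ : ∃ n, w.length = n := ⟨_, rfl⟩
  induction n using Nat.strong_induction_on generalizing w with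
  | _ n ih =>
    by_cases hi : Irr (cls A w)
    · exact ⟨w, .refl, hi, le_rfl, fun _ h => h⟩
    unfold Irr at hi
    push Not at hi
    obtain ⟨x, y, a, h⟩ := hi
    obtain ⟨x, rfl⟩ := exists_cls x
    obtain ⟨y, rfl⟩ := exists_cls y
    have h1 : Sim A w (x ++ [a, bar a] ++ y) := by
      rw [← cls_eq, h, cls_append, cls_append, mul_assoc (cls A x)]
      rfl
    have h2 := h1.length_eq
    simp only [length_append, length_cons, length_nil] at h2
    obtain ⟨w', h3, h4, h5, h6⟩ := ih _ (by rw [length_append]; omega) (x ++ y) rfl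
    refine ⟨w', (h1.steps.tail (.inl ⟨x, y, a.1, a.2, rfl, rfl⟩)).trans h3, h4, ?_, ?_⟩
    · rw [length_append] at h5
      omega
    · intro T hT
      refine h6 T fun b hb => h1.wordOver hlarge hT b ?_
      simp only [mem_append] at hb ⊢
      tauto

theorem elLength_wbar (hlarge : ∀ s t : S, s ≠ t → 3 ≤ A.m s t) {w : Word S}
    (hw : Irr (cls A w)) : elLength A (wbar A w) = w.length := by
  refine le_antisymm (Nat.sInf_le ⟨w, rfl, rfl⟩) (le_csInf ⟨_, w, rfl, rfl⟩ ?_)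
  rintro _ ⟨u, hu, rfl⟩
  obtain ⟨u', h1, h2, h3, -⟩ := exists_reduction hlarge u
  have h4 := cls_eq_of_wbar hlarge hw h2 (hu.symm.trans h1.wbar_eq)
  rw [(cls_eq.1 h4).length_eq]
  exact h3

theorem wbar_mem_parab {T : Set S} {w : Word S} (hw : WordOver T w) : wbar A w ∈ parab A T := by
  induction w with
  | nil => exact one_mem _
  | cons a w ih =>
    refine mul_mem (a := wbar A [a]) ?_ (ih fun b hb => hw b (by simp [hb]))
    have h1 : wbar A [(a.1, true)] ∈ parab A T :=
      Subgroup.subset_closure ⟨a.1, hw a (by simp), rfl⟩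
    obtain ⟨s, _ | _⟩ := a
    · exact inv_mem h1
    · exact h1

theorem exists_word_of_mem_parab {T : Set S} {x : ArtinGroup A} (hx : x ∈ parab A T) :
    ∃ w, WordOver T w ∧ wbar A w = x := by
  induction hx using Subgroup.closure_induction with
  | mem x hx =>
    obtain ⟨s, hs, rfl⟩ := hx
    exact ⟨[(s, true)], by simpa [WordOver] using hs, rfl⟩
  | one => exact ⟨[], by simp [WordOver], rfl⟩
  | mul x y _ _ hx hy =>
    obtain ⟨u, hu, rfl⟩ := hx
    obtain ⟨v, hv, rfl⟩ := hy
    exact ⟨u ++ v, fun a ha => (mem_append.1 ha).elim (hu a) (hv a), rfl⟩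
  | inv x _ hx =>
    obtain ⟨u, hu, rfl⟩ := hx
    refine ⟨wordInv u, fun a ha => ?_, wbar_wordInv u⟩
    simp only [wordInv, mem_map, mem_reverse] at ha
    obtain ⟨b, hb, rfl⟩ := ha
    exact hu b hb

theorem exists_irr_of_mem_parab (hlarge : ∀ s t : S, s ≠ t → 3 ≤ A.m s t) {T : Set S}
    {x : ArtinGroup A} (hx : x ∈ parab A T) :
    ∃ w, WordOver T w ∧ Irr (cls A w) ∧ wbar A w = x := by
  obtain ⟨w, hw, rfl⟩ := exists_word_of_mem_parab hx
  obtain ⟨w', h1, h2, -, h3⟩ := exists_reduction hlarge w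
  exact ⟨w', h3 T hw, h2, h1.wbar_eq.symm⟩

theorem exists_wbar (g : ArtinGroup A) : ∃ w, g = wbar A w := by
  obtain ⟨x, rfl⟩ := PresentedGroup.mk_surjective (rels A) g
  exact ⟨x.toWord, by rw [wbar, FreeGroup.mk_toWord]⟩

/-- The product of a reduced irreducible word and an irreducible word over `T`. -/
theorem irr_append (hlarge : ∀ s t : S, s ≠ t → 3 ≤ A.m s t) {T : Set S} {v u : Word S}
    (hv : Irr (cls A v)) (hT : Red T (cls A v)) (hu : WordOver T u) (hi : Irr (cls A u)) :
    Irr (cls A (v ++ u)) :=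
  irr_mul_of_large hlarge hT hv ⟨u, hu, rfl⟩ hi

theorem exists_peel_wbar (hlarge : ∀ s t : S, s ≠ t → 3 ≤ A.m s t) (T : Set S)
    (w : Word S) : ∃ v u, Steps012 A w (v ++ u) ∧ Irr (cls A (v ++ u)) ∧ Red T (cls A v) ∧
      WordOver T u := by
  obtain ⟨w', h1, h2, -, -⟩ := exists_reduction hlarge w
  obtain ⟨y, e, hy, ⟨u, hu, rfl⟩, h3⟩ := exists_peel T (cls A w')
  obtain ⟨v, rfl⟩ := exists_cls y
  rw [← cls_append] at h3
  exact ⟨v, u, h1.trans (cls_eq.1 h3).steps, h3 ▸ h2, hy, hu⟩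

theorem elLength_le (hlarge : ∀ s t : S, s ≠ t → 3 ≤ A.m s t) {T : Set S} {v : Word S}
    (hv : Irr (cls A v)) (hT : Red T (cls A v)) (y : ArtinGroup A)
    (hy : (wbar A v)⁻¹ * y ∈ parab A T) : elLength A (wbar A v) ≤ elLength A y := by
  obtain ⟨u, hu, hi, h⟩ := exists_irr_of_mem_parab hlarge hy
  rw [eq_inv_mul_iff_mul_eq, ← wbar_append] at h
  rw [← h, elLength_wbar hlarge hv, elLength_wbar hlarge (irr_append hlarge hv hT hu hi),
    length_append]
  exact Nat.le_add_right _ _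

/-- Elements of minimal length in their coset are represented by reduced words. -/
theorem exists_red_word (hlarge : ∀ s t : S, s ≠ t → 3 ≤ A.m s t) {T : Set S} {x : ArtinGroup A}
    (hx : ∀ y : ArtinGroup A, x⁻¹ * y ∈ parab A T → elLength A x ≤ elLength A y) :
    ∃ v, Irr (cls A v) ∧ Red T (cls A v) ∧ x = wbar A v := by
  obtain ⟨w, rfl⟩ := exists_wbar x
  obtain ⟨v, u, h1, h2, h3, h4⟩ := exists_peel_wbar hlarge T w
  have hv : Irr (cls A v) := by
    rw [cls_append] at h2
    exact h2.left
  rw [h1.wbar_eq] at hx ⊢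
  have h5 := hx (wbar A v) (by
    rw [wbar_append, mul_inv_rev, inv_mul_cancel_right]
    exact inv_mem (wbar_mem_parab h4))
  rw [elLength_wbar hlarge h2, elLength_wbar hlarge hv, length_append] at h5
  have h6 : u = [] := length_eq_zero_iff.1 (by omega)
  subst h6
  exact ⟨v, hv, h3, by rw [append_nil]⟩

theorem isLeftTransversal (hlarge : ∀ s t : S, s ≠ t → 3 ≤ A.m s t) (T : Set S) :
    IsLeftTransversal (parab A T) {x : ArtinGroup A |
      ∀ y : ArtinGroup A, x⁻¹ * y ∈ parab A T → elLength A x ≤ elLength A y} := by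
  refine ⟨elLength_le hlarge (v := []) irr_one (red_one T), fun g => ?_⟩
  obtain ⟨w, rfl⟩ := exists_wbar g
  obtain ⟨v, u, h1, h2, h3, h4⟩ := exists_peel_wbar hlarge T w
  have hv : Irr (cls A v) := by
    rw [cls_append] at h2
    exact h2.left
  rw [h1.wbar_eq]
  have hvu : (wbar A (v ++ u))⁻¹ * wbar A v ∈ parab A T := by
    rw [wbar_append, mul_inv_rev, inv_mul_cancel_right]
    exact inv_mem (wbar_mem_parab h4)
  refine ⟨wbar A v, ⟨elLength_le hlarge hv h3, hvu⟩, ?_⟩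
  rintro x ⟨hx, hxu⟩
  obtain ⟨v', hv', h3', rfl⟩ := exists_red_word hlarge hx
  have h5 : (wbar A v)⁻¹ * wbar A v' ∈ parab A T := by
    have := mul_mem (inv_mem hvu) hxu
    rwa [mul_inv_rev, inv_inv, mul_assoc, mul_inv_cancel_left] at this
  obtain ⟨e, he, hi, h6⟩ := exists_irr_of_mem_parab hlarge h5
  rw [eq_inv_mul_iff_mul_eq, ← wbar_append] at h6
  have h7 := irr_append hlarge hv h3 he hi
  have h8 := cls_eq_of_wbar hlarge h7 hv' h6
  rw [cls_append] at h7 h8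
  have h9 := ((lastLetters hlarge _).unique le_rfl h7 h3 h3' ⟨e, he, rfl⟩ (over_one T)
    (h8.trans (mul_one _).symm)).2
  have h10 : e = [] := length_eq_zero_iff.1 (by rw [← len_cls (A := A), h9, len_one])
  rw [← h6, h10, append_nil]

end Action

/-- Proposition 4.3: every Artin–Tits group of large type satisfies
Property `H#` with respect to the `S`-sequence of transversals of minimal-length coset
representatives. -/
theorem stmt17 {S : Type*} [Finite S] (A : ArtinData S)
    (hlarge : ∀ s t : S, s ≠ t → 3 ≤ A.m s t) :
    PropertyHSharpWrt A (fun S₀ =>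
      {x : ArtinGroup A | ∀ y : ArtinGroup A, x⁻¹ * y ∈ parab A S₀ →
        elLength A x ≤ elLength A y}) := by
  refine ⟨isLeftTransversal hlarge, fun S' S₀ w hw => ?_⟩
  obtain ⟨v, u, h1, h2, h3, h4⟩ := exists_peel_wbar hlarge S₀ w
  obtain ⟨w', hw', hi, h⟩ := exists_irr_of_mem_parab hlarge hw
  have h5 : WordOver S' (v ++ u) :=
    (over_cls hlarge).1 ⟨w', hw', cls_eq_of_wbar hlarge h2 hi (h1.wbar_eq.symm.trans h.symm)⟩
  rw [cls_append] at h2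
  exact ⟨v, u, fun a ha => h5 a (by simp [ha]), fun a ha => ⟨h5 a (by simp [ha]), h4 a ha⟩, h1,
    elLength_le hlarge h2.left h3⟩

end ArtinTits
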